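/- Let ℓ be a prime, k an algebraically closed field of characteristic ≠ ℓ, K|k a function field with td(K|k) > 0, and K'|K a Galois subextension of K^ℓ|K. Call g ∈ Gal(K'|K) a divisorial inertia element if g lies in the inertia subgroup of a prolongation to K' of a Zariski prime divisor of K|k, and call a valuation v of K trivial on k defectless if td(K|k) = rr(vK) + td(Kv|k), where rr(vK) = dim_ℚ(vK ⊗_ℤ ℚ) is the rational rank of the value group vK. Then the topological closure in Gal(K'|K) of the set of divisorial inertia elements contains every element lying in the inertia subgroup of a prolongation to K' of a defectless valuation of K trivial on k. -/

import Mathlib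

open IntermediateField
open scoped TensorProduct

/-- Transcendence degree of a ring extension. -/
noncomputable def trdeg (k K : Type*) [CommRing k] [CommRing K] [Algebra k K] : Cardinal :=
  ⨆ s : {s : Set K // AlgebraicIndependent k ((↑) : s → K)}, Cardinal.mk s.1

/-- The maximal pro-ℓ Galois extension of `K`, inside a fixed algebraic closure: the compositum
of all finite Galois extensions of `K` of `ℓ`-power degree. -/
noncomputable def proL (ℓ : ℕ) (K : Type*) [Field K] :
    IntermediateField K (AlgebraicClosure K) :=
  ⨆ L ∈ {L : IntermediateField K (AlgebraicClosure K) |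
      IsGalois K L ∧ ∃ n : ℕ, Module.finrank K L = ℓ ^ n}, L

/-- `G^ℓ_K`, the Galois group of the maximal pro-ℓ extension of `K`,
carrying the Krull topology. -/
noncomputable abbrev GalL (ℓ : ℕ) (K : Type*) [Field K] :=
  ↥(proL ℓ K) ≃ₐ[K] ↥(proL ℓ K)

section Valuations

variable {F E : Type*} [Field F] [Field E] [Algebra F E]

private theorem aut_apply_inv_apply (a : E ≃ₐ[F] E) (x : E) : a (a⁻¹ x) = x :=
  a.apply_symm_apply x

/-- The decomposition subgroup of a valuation of `E` in the Galois group of `E|F`: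
the stabilizer of the valuation ring. -/
def decompSubgroup (O : ValuationSubring E) : Subgroup (E ≃ₐ[F] E) where
  carrier := {σ | ∀ x : E, σ x ∈ O ↔ x ∈ O}
  one_mem' := by intro x; rfl
  mul_mem' := by
    intro a b ha hb x
    simpa [AlgEquiv.mul_apply] using (ha (b x)).trans (hb x)
  inv_mem' := by
    intro a ha x
    have h := (ha (a⁻¹ x)).symm
    rwa [aut_apply_inv_apply] at h

/-- The inertia subgroup of a valuation of `E` in the Galois group of `E|F`: the elements of
the decomposition group which act trivially on the residue field. -/
def inertiaSubgroup (O : ValuationSubring E) : Subgroup (E ≃ₐ[F] E) where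
  carrier := {σ | (∀ x : E, σ x ∈ O ↔ x ∈ O) ∧
      ∀ x : E, x ∈ O → O.valuation (σ x - x) < 1}
  one_mem' := by
    refine ⟨fun x => Iff.rfl, fun x _ => ?_⟩
    simp
  mul_mem' := by
    rintro a b ⟨had, hai⟩ ⟨hbd, hbi⟩
    refine ⟨fun x => by simpa [AlgEquiv.mul_apply] using (had (b x)).trans (hbd x), ?_⟩
    intro x hx
    have h1 : O.valuation (a (b x) - b x) < 1 := hai (b x) ((hbd x).mpr hx)
    have h2 : O.valuation (b x - x) < 1 := hbi x hx
    have h3 : (a * b) x - x = (a (b x) - b x) + (b x - x) := by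
      rw [AlgEquiv.mul_apply]; ring
    rw [h3]
    exact lt_of_le_of_lt (O.valuation.map_add _ _) (max_lt h1 h2)
  inv_mem' := by
    rintro a ⟨had, hai⟩
    have hdec : ∀ x : E, a⁻¹ x ∈ O ↔ x ∈ O := by
      intro x
      have h := (had (a⁻¹ x)).symm
      rwa [aut_apply_inv_apply] at h
    refine ⟨hdec, ?_⟩
    intro x hx
    have h1 : O.valuation (a (a⁻¹ x) - a⁻¹ x) < 1 := hai _ ((hdec x).mpr hx)
    rw [aut_apply_inv_apply] at h1
    have h3 : a⁻¹ x - x = -(x - a⁻¹ x) := by ring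
    rw [h3, Valuation.map_neg]
    exact h1

end Valuations

section ZPD

variable {k K : Type*} [Field k] [Field K] [Algebra k K]

/-- The canonical map from the base field to the residue field of a valuation subring whose
ring contains the base field. -/
noncomputable def resMap (O : ValuationSubring K)
    (h : ∀ c : k, algebraMap k K c ∈ O) : k →+* IsLocalRing.ResidueField ↥O :=
  (IsLocalRing.residue ↥O).comp ((algebraMap k K).codRestrict O.toSubring h)

/-- A Zariski prime divisor of `K|k`, given by its valuation ring `O`: a nontrivial valuation
of `K`, trivial on `k`, with value group isomorphic to `ℤ`, whose residue field `Kv` satisfies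
`td(Kv|k) = td(K|k) - 1`. -/
structure IsZPD (k : Type*) [Field k] {K : Type*} [Field K] [Algebra k K]
    (O : ValuationSubring K) : Prop where
  trivialBase : ∀ c : k, algebraMap k K c ∈ O
  nontrivial : O ≠ ⊤
  discrete : Nonempty ((O.ValueGroup)ˣ ≃* Multiplicative ℤ)
  residue_td :
    letI := (resMap O trivialBase).toAlgebra
    trdeg k (IsLocalRing.ResidueField ↥O) + 1 = trdeg k K

end ZPD

/-- A valuation of `K`, trivial on `k`, is defectless if
`td(K|k) = rr(vK) + td(Kv|k)`, where `rr(vK) = dim_ℚ (vK ⊗_ℤ ℚ)` is the rational rank of the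
value group. -/
noncomputable def IsDefectless (k : Type*) [Field k] {K : Type*} [Field K] [Algebra k K]
    (O : ValuationSubring K) : Prop :=
  ∃ h : ∀ c : k, algebraMap k K c ∈ O,
    letI := (resMap O h).toAlgebra
    trdeg k K = Module.rank ℚ (ℚ ⊗[ℤ] (Additive ((O.ValueGroup)ˣ))) +
      trdeg k (IsLocalRing.ResidueField ↥O)


/-- inertial self-maps of a valuation ring -/
def Inr {Ω : Type*} [Field Ω] (O : ValuationSubring Ω) (σ : Ω → Ω) : Prop :=
  (∀ x, σ x ∈ O ↔ x ∈ O) ∧ ∀ x ∈ O, O.valuation (σ x - x) < 1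

section Tools
variable {E Ω : Type*} [Field E] [Field Ω] [Algebra E Ω]

def BB (Ω : Type*) [Field Ω] [Algebra E Ω] (A : ValuationSubring E) : Subring Ω :=
  ⨅ V : {V : ValuationSubring Ω // ∀ a ∈ A, algebraMap E Ω a ∈ V}, V.1.toSubring

theorem mem_BB {A : ValuationSubring E} {x : Ω} :
    x ∈ BB Ω A ↔ ∀ V : ValuationSubring Ω, (∀ a ∈ A, algebraMap E Ω a ∈ V) → x ∈ V := by
  simp only [BB, Subring.mem_iInf]
  constructor
  · intro h V hV
    exact h ⟨V, hV⟩
  · rintro h ⟨V, hV⟩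
    exact h V hV

theorem BB_smul {A : ValuationSubring E} (σ : Ω ≃ₐ[E] Ω) {x : Ω} (hx : x ∈ BB Ω A) :
    σ x ∈ BB Ω A := by
  rw [mem_BB] at hx ⊢
  intro V hV
  have := hx (V.comap (σ : Ω →+* Ω)) (by
    intro a ha
    rw [ValuationSubring.mem_comap]
    simpa using hV a ha)
  exact this

instance instBBAction (A : ValuationSubring E) : MulSemiringAction (Ω ≃ₐ[E] Ω) (BB Ω A) where
  smul σ b := ⟨σ b.1, BB_smul σ b.2⟩
  one_smul b := rfl
  mul_smul σ τ b := rfl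
  smul_zero σ := Subtype.ext (map_zero σ)
  smul_add σ a b := Subtype.ext (map_add σ _ _)
  smul_one σ := Subtype.ext (map_one σ)
  smul_mul σ a b := Subtype.ext (map_mul σ _ _)

theorem BB_coe_smul (A : ValuationSubring E) (σ : Ω ≃ₐ[E] Ω) (b : BB Ω A) :
   ((σ • b : BB Ω A) : Ω) = σ b := rfl

instance instBBAlg (A : ValuationSubring E) : Algebra A (BB Ω A) :=
  (((algebraMap E Ω).comp A.subtype).codRestrict (BB Ω A) (by
    intro x; rw [mem_BB]; intro V hV; exact hV _ x.2)).toAlgebra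

theorem BB_coe_algebraMap (A : ValuationSubring E) (a : A) :
   ((algebraMap A (BB Ω A) a : BB Ω A) : Ω) = algebraMap E Ω a := rfl

instance (A : ValuationSubring E) : SMulCommClass (Ω ≃ₐ[E] Ω) A (BB Ω A) := ⟨by
  intro σ a b
  apply Subtype.ext
  rw [Algebra.smul_def, Algebra.smul_def]
  simp [BB_coe_smul, BB_coe_algebraMap]⟩

theorem BB_le {A : ValuationSubring E} {O : ValuationSubring Ω}
    (hA : O.comap (algebraMap E Ω) = A) {x : Ω} (hx : x ∈ BB Ω A) :
    x ∈ O := by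
  rw [mem_BB] at hx
  subst hA
  exact hx O (fun a ha => ha)

theorem BB_isInvariant [IsGalois E Ω] {A : ValuationSubring E} {O : ValuationSubring Ω}
    (hA : O.comap (algebraMap E Ω) = A) :
    Algebra.IsInvariant A (BB Ω A) (Ω ≃ₐ[E] Ω) := ⟨by
  intro b hb
  have : (b : Ω) ∈ Set.range (algebraMap E Ω) := by
    rw [InfiniteGalois.mem_range_algebraMap_iff_fixed]
    intro f
    have := congrArg Subtype.val (hb f)
    exact this
  obtain ⟨e, he⟩ := this
  refine ⟨⟨e, ?_⟩, Subtype.ext he⟩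
  rw [← hA, ValuationSubring.mem_comap, he]
  exact BB_le hA b.2⟩

/-- Lemma A -/
theorem exists_BB_frac {A : ValuationSubring E} {O : ValuationSubring Ω}
    (hA : O.comap (algebraMap E Ω) = A) {x : Ω} (hx : x ∈ O) (hal : IsAlgebraic E x) :
    ∃ y ∈ BB Ω A, x * y ∈ BB Ω A ∧ O.valuation y = 1 := by
  subst hA
  classical
  obtain ⟨p, hp0, hp⟩ := hal
  by_cases hx0 : x = 0
  · exact ⟨1, one_mem _, by simp [hx0, zero_mem], by simp⟩
  let v : E → O.ValueGroup := fun e => O.valuation (algebraMap E Ω e)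
  have hne : p.support.Nonempty := Polynomial.support_nonempty.mpr hp0
  obtain ⟨i0, hi0, hmax⟩ := Finset.exists_max_image p.support (fun i => v (p.coeff i)) hne
  let T := p.support.filter (fun i => v (p.coeff i) = v (p.coeff i0))
  have hT : T.Nonempty := ⟨i0, by simp only [T, Finset.mem_filter]; exact ⟨hi0, trivial⟩⟩
  let j := T.max' hT
  have hjT : j ∈ T := T.max'_mem hT
  have hj : j ∈ p.support ∧ v (p.coeff j) = v (p.coeff i0) := by
    simpa only [T, Finset.mem_filter] using hjT
  have hcj : p.coeff j ≠ 0 := Polynomial.mem_support_iff.mp hj.1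
  have hcj' : algebraMap E Ω (p.coeff j) ≠ 0 := by simpa using hcj
  let c : ℕ → E := fun i => p.coeff i / p.coeff j
  have hc1 : ∀ i, v (c i) ≤ 1 := by
    intro i
    by_cases hi : i ∈ p.support
    · have := hmax i hi
      rw [← hj.2] at this
      simp only [v, c, map_div₀] at this ⊢
      exact div_le_one_of_le₀ this zero_le
    · have : p.coeff i = 0 := by simpa using hi
      simp [v, c, this]
  have hcm : ∀ i, j < i → v (c i) < 1 := by
    intro i hij
    by_cases hi : i ∈ p.support
    · have h1 := hmax i hi
      have h2 : v (p.coeff i) ≠ v (p.coeff i0) := by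
        intro h
        have : i ∈ T := by simp only [T, Finset.mem_filter]; exact ⟨hi, h⟩
        exact absurd (T.le_max' i this) (not_le.mpr hij)
      have h3 := lt_of_le_of_ne h1 h2
      rw [← hj.2] at h3
      simp only [v, c, map_div₀] at h3 ⊢
      rw [div_lt_one₀]
      · exact h3
      · exact zero_lt_iff.mpr (by simpa using hcj)
    · have : p.coeff i = 0 := by simpa using hi
      simp [v, c, this]
  have hcA : ∀ i, c i ∈ O.comap (algebraMap E Ω) := by
    intro i
    rw [ValuationSubring.mem_comap, ← ValuationSubring.valuation_le_one_iff]
    exact hc1 i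
  -- the two sums
  let y : Ω := ∑ i ∈ p.support.filter (fun i => j ≤ i), algebraMap E Ω (c i) * x ^ (i - j)
  let y' : Ω := ∑ i ∈ p.support.filter (fun i => ¬ j ≤ i), algebraMap E Ω (c i) * x⁻¹ ^ (j - i)
  have hyy : y + y' = 0 := by
    have h1 : x ^ j * (y + y') = 0 := by
      have h2 : ∑ i ∈ p.support, algebraMap E Ω (c i) * x ^ i = 0 := by
        rw [Polynomial.aeval_def, Polynomial.eval₂_eq_sum, Polynomial.sum] at hp
        have : ∑ i ∈ p.support, algebraMap E Ω (c i) * x ^ i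
             = (algebraMap E Ω (p.coeff j))⁻¹ *
               ∑ i ∈ p.support, algebraMap E Ω (p.coeff i) * x ^ i := by
          rw [Finset.mul_sum]
          apply Finset.sum_congr rfl
          intro i _
          simp only [c, map_div₀]
          field_simp
        rw [this, hp, mul_zero]
      rw [← h2, ← Finset.sum_filter_add_sum_filter_not p.support (fun i => j ≤ i), mul_add,
        Finset.mul_sum, Finset.mul_sum]
      congr 1
      · apply Finset.sum_congr rfl
        intro i hi
        have : j ≤ i := (Finset.mem_filter.mp hi).2
        rw [mul_left_comm, ← pow_add, Nat.add_sub_cancel' this]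
      · apply Finset.sum_congr rfl
        intro i hi
        have : i ≤ j := le_of_not_ge (Finset.mem_filter.mp hi).2
        rw [mul_left_comm]
        congr 1
        conv_lhs => rw [← Nat.sub_add_cancel this, pow_add]
        rw [Nat.add_sub_cancel, mul_right_comm, ← mul_pow, mul_inv_cancel₀ hx0, one_pow, one_mul]
    exact (mul_eq_zero.mp h1).resolve_left (pow_ne_zero _ hx0)
  have hyB : ∀ V : ValuationSubring Ω, (∀ a ∈ O.comap (algebraMap E Ω), algebraMap E Ω a ∈ V) →
      y ∈ V ∧ x * y ∈ V := by
    intro V hV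
    rcases V.mem_or_inv_mem x with h | h
    · have : y ∈ V := sum_mem fun i _ => mul_mem (hV _ (hcA i)) (pow_mem h _)
      exact ⟨this, mul_mem h this⟩
    · have hy : y = - y' := eq_neg_of_add_eq_zero_left hyy
      rw [hy]
      constructor
      · exact neg_mem (sum_mem fun i _ => mul_mem (hV _ (hcA i)) (pow_mem h _))
      · rw [mul_neg, Finset.mul_sum]
        refine neg_mem (sum_mem fun i hi => ?_)
        have : 1 ≤ j - i := by
          have := (Finset.mem_filter.mp hi).2
          omega
        have h3 : x * (algebraMap E Ω (c i) * x⁻¹ ^ (j - i))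
            = algebraMap E Ω (c i) * x⁻¹ ^ (j - i - 1) := by
          conv_lhs => rw [← Nat.sub_add_cancel this, pow_succ]
          field_simp
        rw [h3]
        exact mul_mem (hV _ (hcA i)) (pow_mem h _)
  refine ⟨y, mem_BB.mpr fun V hV => (hyB V hV).1, mem_BB.mpr fun V hV => (hyB V hV).2, ?_⟩
  have hjmem : j ∈ p.support.filter (fun i => j ≤ i) := by
    rw [Finset.mem_filter]; exact ⟨hj.1, le_rfl⟩
  have hy1 : y = 1 + ∑ i ∈ (p.support.filter (fun i => j ≤ i)).erase j,
      algebraMap E Ω (c i) * x ^ (i - j) := by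
    simp only [y]
    rw [← Finset.add_sum_erase _ _ hjmem]
    simp [c, hcj]
  rw [hy1]
  rw [Valuation.map_add_eq_of_lt_left, map_one]
  rw [map_one]
  apply Valuation.map_sum_lt _ one_ne_zero
  intro i hi
  rw [Finset.mem_erase, Finset.mem_filter] at hi
  rw [map_mul, map_pow]
  calc _ ≤ O.valuation (algebraMap E Ω (c i)) * 1 := by
        gcongr
        exact pow_le_one₀ zero_le ((O.valuation_le_one_iff _).mpr hx)
    _ < 1 := by rw [mul_one]; exact hcm i (lt_of_le_of_ne hi.2.2 (Ne.symm hi.1))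

end Tools

section Tools2
open scoped Pointwise
variable {E Ω : Type*} [Field E] [Field Ω] [Algebra E Ω]

theorem BB_isIntegral {A : ValuationSubring E} [Algebra.IsAlgebraic E Ω] (b : BB Ω A) :
    IsOpen ((MulAction.stabilizer (Ω ≃ₐ[E] Ω) b : Set (Ω ≃ₐ[E] Ω))) := by
  have h := stabilizer_isOpen_of_isIntegral (K := E) (b : Ω)
  convert h using 2
  ext σ
  simp only [MulAction.mem_stabilizer_iff]
  constructor
  · intro h; exact congrArg Subtype.val h
  · intro h; exact Subtype.ext h

def PI {A : ValuationSubring E} {O : ValuationSubring Ω}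
    (hA : O.comap (algebraMap E Ω) = A) : Ideal (BB Ω A) where
  carrier := {b | O.valuation b < 1}
  add_mem' := fun {a b} ha hb => lt_of_le_of_lt (O.valuation.map_add _ _) (max_lt ha hb)
  zero_mem' := by simp
  smul_mem' := fun c {x} hx => by
    have h1 : O.valuation (c : Ω) ≤ 1 := (O.valuation_le_one_iff _).mpr (BB_le hA c.2)
    have h2 : O.valuation (x : Ω) < 1 := hx
    change O.valuation ((c : Ω) * x) < 1
    rw [map_mul]
    exact mul_lt_one_of_nonneg_of_lt_one_right h1 zero_le h2

theorem mem_PI {A : ValuationSubring E} {O : ValuationSubring Ω}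
    (hA : O.comap (algebraMap E Ω) = A) (b : BB Ω A) : b ∈ PI hA ↔ O.valuation (b : Ω) < 1 :=
  Iff.rfl

theorem PI_prime {A : ValuationSubring E} {O : ValuationSubring Ω}
    (hA : O.comap (algebraMap E Ω) = A) : (PI hA).IsPrime := by
  constructor
  · rw [Ideal.ne_top_iff_one, mem_PI]
    simp
  · intro x y hxy
    rw [mem_PI] at hxy ⊢
    rw [mem_PI]
    by_contra! h
    have : O.valuation ((x * y : BB Ω A) : Ω) = O.valuation (x : Ω) * O.valuation (y : Ω) := by
      rw [← map_mul]; rfl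
    rw [this] at hxy
    exact absurd hxy (not_lt.mpr (one_le_mul_of_one_le_of_one_le h.1 h.2))

theorem val_eq_one_iff' (O : ValuationSubring Ω) (x : Ω) :
    O.valuation x = 1 ↔ x ∈ O ∧ ¬ O.valuation x < 1 := by
  rw [← O.valuation_le_one_iff]
  constructor
  · intro h; simp [h]
  · rintro ⟨h1, h2⟩; exact le_antisymm h1 (not_lt.mp h2)

theorem val_lt_one_iff' (O : ValuationSubring Ω) (x : Ω) :
    O.valuation x < 1 ↔ x ∈ O ∧ (x = 0 ∨ x⁻¹ ∉ O) := by
  by_cases hx : x = 0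
  · simp [hx, zero_mem]
  · rw [← O.valuation_le_one_iff, ← O.valuation_le_one_iff, map_inv₀]
    have h0 : O.valuation x ≠ 0 := by simpa using hx
    constructor
    · intro h
      refine ⟨h.le, Or.inr ?_⟩
      rw [not_le]
      exact (one_lt_inv₀ (zero_lt_iff.mpr h0)).mpr h
    · rintro ⟨_, h | h⟩
      · exact absurd h hx
      · rw [not_le] at h
        exact (one_lt_inv₀ (zero_lt_iff.mpr h0)).mp h

theorem val_lt_one_comap {F : Type*} [Field F] (O : ValuationSubring Ω) (f : F →+* Ω) (e : F) :
    (O.comap f).valuation e < 1 ↔ O.valuation (f e) < 1 := by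
  rw [val_lt_one_iff', val_lt_one_iff', ValuationSubring.mem_comap, ValuationSubring.mem_comap,
    map_inv₀, map_eq_zero]

theorem not_mem_iff_inv (O : ValuationSubring Ω) (x : Ω) :
    x ∉ O ↔ x ≠ 0 ∧ O.valuation x⁻¹ < 1 := by
  by_cases hx : x = 0
  · simp [hx, zero_mem]
  · rw [val_lt_one_iff']
    simp only [inv_inv, inv_eq_zero, hx, ne_eq, not_false_eq_true, true_and, false_or]
    constructor
    · intro h; exact ⟨(O.mem_or_inv_mem x).resolve_left h, h⟩
    · exact fun h => h.2

theorem BB_ext_iff {A : ValuationSubring E} {O1 O2 : ValuationSubring Ω}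
    [Algebra.IsAlgebraic E Ω]
    (h1 : O1.comap (algebraMap E Ω) = A) (h2 : O2.comap (algebraMap E Ω) = A)
    (τ : Ω ≃+* Ω) (hB : ∀ b ∈ BB Ω A, τ b ∈ BB Ω A)
    (h : ∀ b ∈ BB Ω A, O1.valuation (τ b) < 1 ↔ O2.valuation b < 1) (x : Ω) :
    τ x ∈ O1 ↔ x ∈ O2 := by
  have key : ∀ x ∈ O2, τ x ∈ O1 ∧ (O2.valuation x < 1 → O1.valuation (τ x) < 1) := by
    intro x hx
    obtain ⟨y, hy, hxy, hv⟩ := exists_BB_frac h2 hx (Algebra.IsAlgebraic.isAlgebraic x)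
    have hy1 : O1.valuation (τ y) = 1 := by
      rw [val_eq_one_iff']
      refine ⟨BB_le h1 (hB y hy), ?_⟩
      rw [h y hy, hv]; simp
    have h3 : O1.valuation (τ (x * y)) = O1.valuation (τ x) := by
      rw [map_mul, map_mul, hy1, mul_one]
    constructor
    · rw [← O1.valuation_le_one_iff, ← h3, O1.valuation_le_one_iff]
      exact BB_le h1 (hB _ hxy)
    · intro hlt
      rw [← h3, h _ hxy, map_mul, hv, mul_one]
      exact hlt
  constructor
  · intro hx
    by_contra hn
    obtain ⟨h0, hlt⟩ := (not_mem_iff_inv O2 x).mp hn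
    have := (key x⁻¹ ((O2.valuation_le_one_iff _).mp hlt.le)).2 hlt
    rw [map_inv₀] at this
    exact (not_mem_iff_inv O1 (τ x)).mpr ⟨by simpa using h0, this⟩ hx
  · exact fun hx => (key x hx).1

theorem conj_galois [IsGalois E Ω] (O1 O2 : ValuationSubring Ω)
    (h : O1.comap (algebraMap E Ω) = O2.comap (algebraMap E Ω)) :
    ∃ τ : Ω ≃ₐ[E] Ω, ∀ x, τ x ∈ O1 ↔ x ∈ O2 := by
  let A := O2.comap (algebraMap E Ω)
  have h2 : O2.comap (algebraMap E Ω) = A := rfl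
  letI : TopologicalSpace (BB Ω A) := ⊥
  haveI : DiscreteTopology (BB Ω A) := ⟨rfl⟩
  haveI := BB_isInvariant (E := E) h2
  haveI : ContinuousSMul (Ω ≃ₐ[E] Ω) (BB Ω A) := by
    rw [continuousSMul_iff_stabilizer_isOpen]
    exact BB_isIntegral
  haveI := PI_prime h2
  haveI := PI_prime (A := A) h
  obtain ⟨g, hg⟩ := Algebra.IsInvariant.exists_smul_of_under_eq_of_profinite (A := A)
    (G := Ω ≃ₐ[E] Ω) (PI h2) (PI (A := A) h) (by
      have key : ∀ (O : ValuationSubring Ω) (h : O.comap (algebraMap E Ω) = A),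
          ∀ a : A, a ∈ (PI h).under A ↔ (a : E) = 0 ∨ (a : E)⁻¹ ∉ A := by
        intro O h a
        rw [Ideal.mem_comap, mem_PI, BB_coe_algebraMap, val_lt_one_iff']
        rw [← map_inv₀, ← ValuationSubring.mem_comap, ← ValuationSubring.mem_comap, h]
        simp
      ext a
      rw [key, key])
  refine ⟨g, BB_ext_iff h h2 (g : Ω ≃+* Ω) (fun b hb => BB_smul g hb) ?_⟩
  intro b hb
  have h3 : g • (⟨b, hb⟩ : BB Ω A) ∈ g • PI h2 ↔ (⟨b, hb⟩ : BB Ω A) ∈ PI h2 :=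
    Ideal.smul_mem_pointwise_smul_iff
  rw [← hg, mem_PI, mem_PI] at h3
  exact h3

theorem lift_galois [IsGalois E Ω] (O : ValuationSubring Ω) (σ : Ω ≃+* Ω) (σE : E ≃+* E)
    (hσ : ∀ e, σ (algebraMap E Ω e) = algebraMap E Ω (σE e))
    (hin : Inr (O.comap (algebraMap E Ω)) σE) :
    ∃ τ : Ω ≃ₐ[E] Ω, Inr O (fun x => σ (τ x)) := by
  let A := O.comap (algebraMap E Ω)
  have hA : O.comap (algebraMap E Ω) = A := rfl
  obtain ⟨τ0, hτ0⟩ := conj_galois (E := E) (O.comap (σ : Ω →+* Ω)) O (by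
    ext e
    simp only [ValuationSubring.mem_comap, RingEquiv.coe_toRingHom, hσ]
    exact hin.1 e)
  let s : Ω ≃+* Ω := (τ0 : Ω ≃+* Ω).trans σ
  have hsO : ∀ x, s x ∈ O ↔ x ∈ O := hτ0
  have hsE : ∀ e, s (algebraMap E Ω e) = algebraMap E Ω (σE e) := by
    intro e
    change σ (τ0 _) = _
    rw [AlgEquiv.commutes, hσ]
  have hsE' : ∀ e, s.symm (algebraMap E Ω e) = algebraMap E Ω (σE.symm e) := by
    intro e
    rw [RingEquiv.symm_apply_eq, hsE, RingEquiv.apply_symm_apply]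
  have hsB : ∀ x, x ∈ BB Ω A → s x ∈ BB Ω A := by
    intro x hx
    rw [mem_BB] at hx ⊢
    intro V hV
    apply hx (V.comap (s : Ω →+* Ω))
    intro a ha
    rw [ValuationSubring.mem_comap, RingEquiv.coe_toRingHom, hsE]
    exact hV _ ((hin.1 a).mpr ha)
  have hsB' : ∀ x, x ∈ BB Ω A → s.symm x ∈ BB Ω A := by
    intro x hx
    rw [mem_BB] at hx ⊢
    intro V hV
    apply hx (V.comap (s.symm : Ω →+* Ω))
    intro a ha
    rw [ValuationSubring.mem_comap, RingEquiv.coe_toRingHom, hsE']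
    exact hV _ ((hin.1 _).mp (by rw [RingEquiv.apply_symm_apply]; exact ha))
  let sB : BB Ω A ≃+* BB Ω A :=
    { toFun := fun b => ⟨s b, hsB _ b.2⟩
      invFun := fun b => ⟨s.symm b, hsB' _ b.2⟩
      left_inv := fun b => Subtype.ext (s.symm_apply_apply _)
      right_inv := fun b => Subtype.ext (s.apply_symm_apply _)
      map_mul' := fun a b => Subtype.ext (map_mul s _ _)
      map_add' := fun a b => Subtype.ext (map_add s _ _) }
  have hslt : ∀ x, O.valuation (s x) < 1 ↔ O.valuation x < 1 := by
    intro x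
    rw [val_lt_one_iff', val_lt_one_iff', hsO, ← map_inv₀, hsO]
    simp
  let Q := PI hA
  let P := Q.under A
  letI : TopologicalSpace (BB Ω A) := ⊥
  haveI : DiscreteTopology (BB Ω A) := ⟨rfl⟩
  haveI := BB_isInvariant (E := E) hA
  haveI : ContinuousSMul (Ω ≃ₐ[E] Ω) (BB Ω A) := by
    rw [continuousSMul_iff_stabilizer_isOpen]
    exact BB_isIntegral
  haveI : Q.IsPrime := PI_prime hA
  haveI : Q.LiesOver P := ⟨rfl⟩
  let sbar : (BB Ω A ⧸ Q) ≃+* (BB Ω A ⧸ Q) := Ideal.quotientEquiv Q Q sB (by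
    ext b
    have hm : b ∈ Ideal.map (sB : BB Ω A →+* BB Ω A) Q ↔ ∃ x ∈ Q, sB x = b :=
      Ideal.mem_map_of_equiv sB b
    rw [hm]
    constructor
    · intro hb
      refine ⟨sB.symm b, ?_, sB.apply_symm_apply b⟩
      rw [mem_PI] at hb ⊢
      rw [← hslt]
      have : s (sB.symm b : Ω) = b := s.apply_symm_apply _
      rwa [this]
    · rintro ⟨c, hc, rfl⟩
      exact (hslt _).mpr hc)
  let sa : (BB Ω A ⧸ Q) ≃ₐ[A ⧸ P] (BB Ω A ⧸ Q) := AlgEquiv.ofRingEquiv (f := sbar) (by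
    intro a
    obtain ⟨a, rfl⟩ := Ideal.Quotient.mk_surjective a
    change Ideal.Quotient.mk Q (sB (algebraMap A (BB Ω A) a))
      = Ideal.Quotient.mk Q (algebraMap A (BB Ω A) a)
    rw [Ideal.Quotient.eq]
    change O.valuation (s (algebraMap E Ω a) - algebraMap E Ω a) < 1
    have h1 := hin.2 _ a.2
    rwa [val_lt_one_comap, map_sub, ← hsE] at h1)
  obtain ⟨t, ht⟩ := Ideal.Quotient.stabilizerHom_surjective_of_profinite (G := Ω ≃ₐ[E] Ω) P Q sa.symm
  have hst : ∀ b ∈ BB Ω A, O.valuation (s (t.1 b) - b) < 1 := by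
    intro b hb
    have h1 := congrArg (fun f => sa (f (Ideal.Quotient.mk Q ⟨b, hb⟩))) ht
    simp only [AlgEquiv.apply_symm_apply] at h1
    have h2 : sa (Ideal.Quotient.stabilizerHom Q P (Ω ≃ₐ[E] Ω) t (Ideal.Quotient.mk Q ⟨b, hb⟩))
      = Ideal.Quotient.mk Q (sB (t.1 • ⟨b, hb⟩)) := rfl
    rw [h2, Ideal.Quotient.eq] at h1
    exact h1
  let s' : Ω ≃+* Ω := (t.1 : Ω ≃+* Ω).trans s
  have hs' : ∀ b ∈ BB Ω A, O.valuation (s' b - b) < 1 := hst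
  have hs'B : ∀ b ∈ BB Ω A, s' b ∈ BB Ω A := fun b hb => hsB _ (BB_smul t.1 hb)
  refine ⟨τ0 * t.1, ?_⟩
  change Inr O s'
  have h1 : ∀ x, s' x ∈ O ↔ x ∈ O := by
    apply BB_ext_iff hA hA s' hs'B
    intro b hb
    have h2 := hs' b hb
    constructor
    · intro h3
      have : b = s' b - (s' b - b) := by ring
      rw [this]
      exact lt_of_le_of_lt (O.valuation.map_sub _ _) (max_lt h3 h2)
    · intro h3
      have : s' b = b + (s' b - b) := by ring
      rw [this]
      exact lt_of_le_of_lt (O.valuation.map_add _ _) (max_lt h3 h2)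
  refine ⟨h1, ?_⟩
  intro x hx
  obtain ⟨y, hy, hxy, hv⟩ := exists_BB_frac hA hx (Algebra.IsAlgebraic.isAlgebraic (R := E) x)
  have e1 : s' (x * y) - x * y = (s' x - x) * y + s' x * (s' y - y) := by rw [map_mul]; ring
  have e2 : (s' x - x) * y = (s' (x * y) - x * y) - s' x * (s' y - y) := by rw [e1]; ring
  have e3 : O.valuation ((s' x - x) * y) < 1 := by
    rw [e2]
    refine lt_of_le_of_lt (O.valuation.map_sub _ _) (max_lt (hs' _ hxy) ?_)
    rw [map_mul]
    exact mul_lt_one_of_nonneg_of_lt_one_right ((O.valuation_le_one_iff _).mpr ((h1 x).mpr hx))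
      zero_le (hs' _ hy)
  rwa [map_mul, hv, mul_one] at e3

end Tools2

section Tools3
variable {E Ω : Type*} [Field E] [Field Ω] [Algebra E Ω]

theorem mem_of_pow_mem (O : ValuationSubring Ω) {n : ℕ} (hn : n ≠ 0) (x : Ω) :
    x ^ n ∈ O ↔ x ∈ O := by
  rw [← O.valuation_le_one_iff, ← O.valuation_le_one_iff, map_pow]
  exact pow_le_one_iff_of_nonneg zero_le hn

theorem val_pow_lt (O : ValuationSubring Ω) {n : ℕ} (hn : n ≠ 0) (x : Ω) :
    O.valuation (x ^ n) < 1 ↔ O.valuation x < 1 := by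
  rw [map_pow]
  exact pow_lt_one_iff_of_nonneg zero_le hn

theorem perfectClosure_isGalois [IsAlgClosed Ω] [Algebra.IsAlgebraic E Ω] :
    IsGalois (perfectClosure E Ω) Ω := by
  haveI : Algebra.IsAlgebraic (perfectClosure E Ω) Ω :=
    Algebra.IsAlgebraic.tower_top (K := E) (perfectClosure E Ω)
  haveI : PerfectField (perfectClosure E Ω) := inferInstance
  haveI : Algebra.IsSeparable (perfectClosure E Ω) Ω := inferInstance
  haveI : IsAlgClosure (perfectClosure E Ω) Ω := ⟨inferInstance, inferInstance⟩
  haveI : Normal (perfectClosure E Ω) Ω := IsAlgClosure.normal _ _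
  exact ⟨⟩

theorem conj_gen [IsAlgClosed Ω] [Algebra.IsAlgebraic E Ω] (O1 O2 : ValuationSubring Ω)
    (h : ∀ e, algebraMap E Ω e ∈ O1 ↔ algebraMap E Ω e ∈ O2) :
    ∃ τ : Ω ≃ₐ[E] Ω, ∀ x, τ x ∈ O1 ↔ x ∈ O2 := by
  haveI := perfectClosure_isGalois (E := E) (Ω := Ω)
  obtain ⟨τ, hτ⟩ := conj_galois (E := perfectClosure E Ω) O1 O2 (by
    ext x
    obtain ⟨n, e, he⟩ := (mem_perfectClosure_iff_pow_mem (ringExpChar E)).mp x.2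
    have hq : ringExpChar E ^ n ≠ 0 := pow_ne_zero _ (expChar_pos E _).ne'
    rw [ValuationSubring.mem_comap, ValuationSubring.mem_comap]
    rw [← mem_of_pow_mem O1 hq, ← mem_of_pow_mem O2 hq]
    change (x : Ω) ^ _ ∈ O1 ↔ (x : Ω) ^ _ ∈ O2
    rw [← he, h])
  exact ⟨τ.restrictScalars E, hτ⟩

theorem lift_gen [IsAlgClosed Ω] [Algebra.IsAlgebraic E Ω] (O : ValuationSubring Ω)
    (σ : E ≃+* E) (hin : Inr (O.comap (algebraMap E Ω)) σ) :
    ∃ σ' : Ω ≃+* Ω, Inr O σ' ∧ ∀ e, σ' (algebraMap E Ω e) = algebraMap E Ω (σ e) := by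
  haveI : IsAlgClosure E Ω := ⟨inferInstance, inferInstance⟩
  haveI := perfectClosure_isGalois (E := E) (Ω := Ω)
  let q := ringExpChar E
  haveI : ExpChar E q := inferInstance
  haveI : ExpChar Ω q := expChar_of_injective_algebraMap (algebraMap E Ω).injective q
  let s : Ω ≃+* Ω := IsAlgClosure.equivOfEquiv Ω Ω σ
  have hs : ∀ e, s (algebraMap E Ω e) = algebraMap E Ω (σ e) :=
    fun e => IsAlgClosure.equivOfEquiv_algebraMap Ω Ω σ e
  have hs' : ∀ e, s.symm (algebraMap E Ω e) = algebraMap E Ω (σ.symm e) := by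
    intro e
    rw [RingEquiv.symm_apply_eq, hs, RingEquiv.apply_symm_apply]
  let M := perfectClosure E Ω
  have hM : ∀ x, x ∈ M → s x ∈ M := by
    intro x hx
    obtain ⟨n, e, he⟩ := (mem_perfectClosure_iff_pow_mem q).mp hx
    exact (mem_perfectClosure_iff_pow_mem q).mpr ⟨n, σ e, by rw [← hs, he, map_pow]⟩
  have hM' : ∀ x, x ∈ M → s.symm x ∈ M := by
    intro x hx
    obtain ⟨n, e, he⟩ := (mem_perfectClosure_iff_pow_mem q).mp hx
    exact (mem_perfectClosure_iff_pow_mem q).mpr ⟨n, σ.symm e, by rw [← hs', he, map_pow]⟩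
  let sM : M ≃+* M :=
    { toFun := fun b => ⟨s b, hM _ b.2⟩
      invFun := fun b => ⟨s.symm b, hM' _ b.2⟩
      left_inv := fun b => Subtype.ext (s.symm_apply_apply _)
      right_inv := fun b => Subtype.ext (s.apply_symm_apply _)
      map_mul' := fun a b => Subtype.ext (map_mul s _ _)
      map_add' := fun a b => Subtype.ext (map_add s _ _) }
  have hsM : ∀ x : M, algebraMap M Ω (sM x) = s (algebraMap M Ω x) := fun x => rfl
  obtain ⟨τ, hτ⟩ := lift_galois (E := M) O s sM (fun x => rfl) (by
    constructor
    · intro x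
      obtain ⟨n, e, he⟩ := (mem_perfectClosure_iff_pow_mem q).mp x.2
      have hq : q ^ n ≠ 0 := pow_ne_zero _ (expChar_pos E _).ne'
      rw [ValuationSubring.mem_comap, ValuationSubring.mem_comap, hsM,
        ← mem_of_pow_mem O hq, ← mem_of_pow_mem O hq (algebraMap M Ω x)]
      change algebraMap E Ω e = (algebraMap M Ω x) ^ q ^ n at he
      rw [← map_pow, ← he, hs]
      exact hin.1 e
    · intro x hx
      obtain ⟨n, e, he⟩ := (mem_perfectClosure_iff_pow_mem q).mp x.2
      have hq : q ^ n ≠ 0 := pow_ne_zero _ (expChar_pos E _).ne'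
      change algebraMap E Ω e = (algebraMap M Ω x) ^ q ^ n at he
      rw [ValuationSubring.mem_comap, ← mem_of_pow_mem O hq, ← he] at hx
      rw [val_lt_one_comap, map_sub, hsM, ← val_pow_lt O hq, sub_pow_expChar_pow, ← map_pow,
        ← he, hs, ← map_sub, ← val_lt_one_comap]
      exact hin.2 e hx)
  refine ⟨(τ : Ω ≃+* Ω).trans s, hτ, ?_⟩
  intro e
  change s (τ (algebraMap M Ω (algebraMap E M e))) = _
  rw [AlgEquiv.commutes]
  exact hs e

theorem exists_prolong {E Ω : Type*} [Field E] [Field Ω] (f : E →+* Ω) (A : ValuationSubring E) :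
    ∃ O : ValuationSubring Ω, O.comap f = A := by
  obtain ⟨O, hO1, hO2⟩ := Ideal.image_subset_nonunits_valuationSubring
    (A := A.toSubring.map f) ((IsLocalRing.maximalIdeal A).comap
      ((A.toSubring.equivMapOfInjective f f.injective).symm : _ →+* A))
    (Ideal.comap_ne_top _ (Ideal.IsPrime.ne_top inferInstance))
  have h1 : ∀ e ∈ A, f e ∈ O := fun e he => hO1 ⟨e, he, rfl⟩
  refine ⟨O, ?_⟩
  ext e
  rw [ValuationSubring.mem_comap]
  refine ⟨fun he => ?_, h1 e⟩
  by_contra hn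
  obtain ⟨h0, h2⟩ := (not_mem_iff_inv A e).mp hn
  have hA : e⁻¹ ∈ A := (A.valuation_le_one_iff _).mp h2.le
  have h3 : f e⁻¹ ∈ O.nonunits := by
    apply hO2
    refine ⟨(A.toSubring.equivMapOfInjective f f.injective) ⟨e⁻¹, hA⟩, ?_, rfl⟩
    change _ ∈ Ideal.comap _ _
    rw [Ideal.mem_comap]
    simp only [RingEquiv.coe_toRingHom, RingEquiv.symm_apply_apply]
    exact (A.valuation_lt_one_iff ⟨e⁻¹, hA⟩).mpr h2
  rw [ValuationSubring.mem_nonunits_iff, map_inv₀] at h3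
  exact ((not_mem_iff_inv O (f e)).mpr ⟨by simpa using h0, h3⟩) he

end Tools3

section FM

theorem fm_semigroup_smul {M : Type*} [AddCommGroup M] (P : M → Prop)
    (hadd : ∀ a b, P a → P b → P (a + b)) (a : M) (ha : P a) (n : ℤ) (hn : 0 < n) : P (n • a) := by
  obtain ⟨m, rfl⟩ : ∃ m : ℕ, n = (m + 1 : ℕ) := ⟨(n - 1).toNat, by omega⟩
  clear hn
  induction m with
  | zero => simpa using ha
  | succ m ih =>
    have : ((m + 1 + 1 : ℕ) : ℤ) • a = ((m + 1 : ℕ) : ℤ) • a + a := by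
      push_cast; rw [add_smul _ 1 a, one_smul]
    rw [this]
    exact hadd _ _ ih ha

theorem fm_rat (n : ℕ) : ∀ (P : (Fin n → ℤ) → Prop) (_ : ∀ a b, P a → P b → P (a + b))
    (_ : ¬ P 0) (A : Finset (Fin n → ℤ)) (_ : ∀ a ∈ A, P a),
    ∃ φ : Fin n → ℚ, ∀ a ∈ A, 0 < ∑ i, φ i * a i := by
  classical
  induction n with
  | zero =>
    intro P hadd h0 A hA
    refine ⟨0, fun a ha => ?_⟩
    have : a = 0 := Subsingleton.elim _ _
    exact absurd (hA a ha) (this ▸ h0)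
  | succ n ih =>
    intro P hadd h0 A hA
    let A0 := A.filter (fun a => a 0 = 0)
    let Ap := A.filter (fun a => 0 < a 0)
    let An := A.filter (fun a => a 0 < 0)
    let A' : Finset (Fin n → ℤ) := A0.image Fin.tail ∪
      (Ap ×ˢ An).image (fun p => Fin.tail ((-(p.2 0)) • p.1 + (p.1 0) • p.2))
    obtain ⟨φ, hφ⟩ := ih (fun a => P (Fin.cons 0 a)) (by
      intro a b ha hb
      have := hadd _ _ ha hb
      convert this using 1
      ext i
      refine Fin.cases ?_ (fun j => ?_) i <;> simp) (by
      convert h0 using 2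
      ext i
      refine Fin.cases ?_ (fun j => ?_) i <;> simp) A' (by
      intro a ha
      simp only [A', Finset.mem_union, Finset.mem_image, Finset.mem_product, Prod.exists] at ha
      rcases ha with ⟨b, hb, rfl⟩ | ⟨b, c, ⟨hb, hc⟩, rfl⟩
      · have hb' := Finset.mem_filter.mp hb
        rw [← hb'.2, Fin.cons_self_tail]
        exact hA _ hb'.1
      · have hb' := Finset.mem_filter.mp hb
        have hc' := Finset.mem_filter.mp hc
        have e : (0 : ℤ) = ((-(c 0)) • b + (b 0) • c) 0 := by simp; ring
        rw [e, Fin.cons_self_tail]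
        exact hadd _ _ (fm_semigroup_smul P hadd b (hA _ hb'.1) _ (by linarith [hc'.2]))
          (fm_semigroup_smul P hadd c (hA _ hc'.1) _ hb'.2))
    let d : (Fin (n+1) → ℤ) → ℚ := fun a => ∑ i, φ i * a (Fin.succ i)
    obtain ⟨t, ht1, ht2⟩ := Order.exists_between_finsets (Ap.image (fun a => - d a / a 0))
      (An.image (fun a => - d a / a 0)) (by
        intro x hx y hy
        obtain ⟨b, hb, rfl⟩ := Finset.mem_image.mp hx
        obtain ⟨c, hc, rfl⟩ := Finset.mem_image.mp hy
        have hb' : (0 : ℚ) < b 0 := by exact_mod_cast (Finset.mem_filter.mp hb).2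
        have hc' : (c 0 : ℚ) < 0 := by exact_mod_cast (Finset.mem_filter.mp hc).2
        have h := hφ (Fin.tail ((-(c 0)) • b + (b 0) • c)) (by
          simp only [A', Finset.mem_union, Finset.mem_image, Finset.mem_product, Prod.exists]
          exact Or.inr ⟨b, c, ⟨hb, hc⟩, rfl⟩)
        have h2 : ∑ i, φ i * ((Fin.tail ((-(c 0)) • b + (b 0) • c) : Fin n → ℤ) i : ℚ)
           = (-(c 0)) * d b + b 0 * d c := by
          simp only [d, Finset.mul_sum, ← Finset.sum_add_distrib]
          apply Finset.sum_congr rfl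
          intro i _
          simp [Fin.tail]
          ring
        rw [h2] at h
        rw [div_lt_iff₀ hb', div_mul_eq_mul_div, lt_div_iff_of_neg hc']
        nlinarith)
    refine ⟨Fin.cons t φ, fun a ha => ?_⟩
    rw [Fin.sum_univ_succ]
    simp only [Fin.cons_zero, Fin.cons_succ]
    change 0 < t * a 0 + d a
    rcases lt_trichotomy (a 0) 0 with h | h | h
    · have := ht2 _ (Finset.mem_image_of_mem _ (Finset.mem_filter.mpr ⟨ha, h⟩))
      have h' : (a 0 : ℚ) < 0 := by exact_mod_cast h
      rw [lt_div_iff_of_neg h'] at this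
      linarith
    · have := hφ (Fin.tail a) (by
          simp only [A', Finset.mem_union, Finset.mem_image]
          exact Or.inl ⟨a, Finset.mem_filter.mpr ⟨ha, h⟩, rfl⟩)
      rw [h]
      simpa [d, Fin.tail] using this
    · have := ht1 _ (Finset.mem_image_of_mem _ (Finset.mem_filter.mpr ⟨ha, h⟩))
      have h' : (0 : ℚ) < a 0 := by exact_mod_cast h
      rw [div_lt_iff₀ h'] at this
      linarith

theorem fm_int {ι : Type*} [Fintype ι] (P : (ι → ℤ) → Prop) (hadd : ∀ a b, P a → P b → P (a + b))
    (h0 : ¬ P 0) (A : Finset (ι → ℤ)) (hA : ∀ a ∈ A, P a) :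
    ∃ φ : ι → ℤ, ∀ a ∈ A, 0 < ∑ i, φ i * a i := by
  classical
  let e := (Fintype.equivFin ι)
  obtain ⟨φ, hφ⟩ := fm_rat (Fintype.card ι) (fun a => P (a ∘ e)) (fun a b ha hb => hadd _ _ ha hb)
    h0 (A.image (fun a => a ∘ e.symm)) (by
      intro a ha
      obtain ⟨b, hb, rfl⟩ := Finset.mem_image.mp ha
      have : (b ∘ e.symm) ∘ e = b := by ext; simp
      change P ((b ∘ e.symm) ∘ e)
      rw [this]
      exact hA b hb)
  let D : ℕ := ∏ i, (φ i).den
  have hD : 0 < D := Finset.prod_pos fun i _ => (φ i).den_pos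
  have hdvd : ∀ i, (φ i).den ∣ D := fun i => Finset.dvd_prod_of_mem _ (Finset.mem_univ i)
  have key : ∀ i, ∃ m : ℤ, (m : ℚ) = D * φ i := by
    intro i
    obtain ⟨c, hc⟩ := hdvd i
    refine ⟨c * (φ i).num, ?_⟩
    rw [hc]
    push_cast
    have := Rat.mul_den_eq_num (φ i)
    rw [← this]
    ring
  choose ψ hψ using key
  refine ⟨fun i => ψ (e i), fun a ha => ?_⟩
  have h1 := hφ _ (Finset.mem_image_of_mem _ ha)
  have h2 : ((∑ i, ψ (e i) * a i : ℤ) : ℚ) = D * ∑ i, φ i * ((a ∘ e.symm) i : ℤ) := by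
    push_cast
    rw [Finset.mul_sum, ← Equiv.sum_comp e]
    apply Finset.sum_congr rfl
    intro i _
    rw [hψ]
    simp
    ring
  have h3 : (0 : ℚ) < ((∑ i, ψ (e i) * a i : ℤ) : ℚ) := by
    rw [h2]; positivity
  exact_mod_cast h3

/-- natural exponents with prescribed congruences -/
theorem fm_nat {ι : Type*} [Fintype ι] (P : (ι → ℤ) → Prop)
    (hadd : ∀ a b, P a → P b → P (a + b))
    (h0 : ¬ P 0) (hpos : ∀ a : ι → ℤ, 0 ≤ a → a ≠ 0 → P a) (M : ℕ) (hM : 0 < M) (r : ι → ℕ)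
    (A : Finset (ι → ℤ)) (hA : ∀ a ∈ A, P a) :
    ∃ φ : ι → ℕ, (∀ a ∈ A, 0 < ∑ i, (φ i : ℤ) * a i) ∧ (∀ i, φ i ≡ r i [MOD M]) ∧
      ∀ i, 0 < φ i := by
  classical
  obtain ⟨φ, hφ⟩ := fm_int P hadd h0
    (A ∪ Finset.univ.image (fun i : ι => (Pi.single i 1 : ι → ℤ))) (by
      intro a ha
      rcases Finset.mem_union.mp ha with h | h
      · exact hA a h
      · obtain ⟨i, _, rfl⟩ := Finset.mem_image.mp h
        apply hpos
        · intro j; by_cases h : j = i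
          · subst h; simp
          · simp [h]
        · intro h; have := congrFun h i; simp at this)
  have hφ1 : ∀ i, 0 < φ i := by
    intro i
    have := hφ (Pi.single i 1) (by simp)
    simpa [Pi.single_apply] using this
  let C : ℕ := ∑ a ∈ A, ∑ i, (r i) * (a i).natAbs
  let N : ℤ := C + 1
  have hb : ∀ a ∈ A, 0 < ∑ i, (N * M * φ i + r i) * a i := by
    intro a ha
    have h1 := hφ a (Finset.mem_union_left _ ha)
    have h2 : ∑ i, (N * M * φ i + r i) * a i = N * M * ∑ i, φ i * a i + ∑ i, (r i : ℤ) * a i := by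
      rw [Finset.mul_sum, ← Finset.sum_add_distrib]
      apply Finset.sum_congr rfl
      intro i _; ring
    have h3 : -(C : ℤ) ≤ ∑ i, (r i : ℤ) * a i := by
      have h4 : ∑ i, (r i) * (a i).natAbs ≤ C :=
        Finset.single_le_sum (f := fun a : ι → ℤ => ∑ i, (r i) * (a i).natAbs)
          (fun _ _ => Nat.zero_le _) ha
      have h5 : -((∑ i, (r i) * (a i).natAbs : ℕ) : ℤ) ≤ ∑ i, (r i : ℤ) * a i := by
        push_cast
        rw [← Finset.sum_neg_distrib]
        apply Finset.sum_le_sum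
        intro i _
        rw [← mul_neg]
        exact mul_le_mul_of_nonneg_left (neg_abs_le (a i)) (by positivity)
      have : ((∑ i, (r i) * (a i).natAbs : ℕ) : ℤ) ≤ C := by exact_mod_cast h4
      linarith
    rw [h2]
    have hM' : (1 : ℤ) ≤ M := by exact_mod_cast hM
    have : N ≤ N * M * ∑ i, φ i * a i := by
      have hN : 0 < N := by positivity
      have : N * (1 * 1) ≤ N * (M * ∑ i, φ i * a i) := by
        apply mul_le_mul_of_nonneg_left _ hN.le
        exact mul_le_mul hM' h1 (by norm_num) (by positivity)
      linarith
    simp only [N] at this ⊢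
    linarith
  have hpos' : ∀ i, 0 < N * M * φ i + r i := by
    intro i
    have hN : 0 < N := by positivity
    have := hφ1 i
    positivity
  refine ⟨fun i => (N * M * φ i + r i).toNat, ?_, ?_, ?_⟩
  · intro a ha
    have := hb a ha
    convert this using 3 with i
    rw [Int.toNat_of_nonneg (hpos' i).le]
  · intro i
    rw [← Int.natCast_modEq_iff, Int.toNat_of_nonneg (hpos' i).le]
    rw [Int.modEq_iff_dvd]
    exact ⟨-(N * φ i), by ring⟩
  · intro i
    exact Int.pos_iff_toNat_pos.mp (hpos' i)

theorem fm_ultra {ι : Type*} [Fintype ι] (P : (ι → ℤ) → Prop)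
    (hadd : ∀ a b, P a → P b → P (a + b))
    (h0 : ¬ P 0) (hpos : ∀ a : ι → ℤ, 0 ≤ a → a ≠ 0 → P a) (M : ℕ) (hM : 0 < M) (r : ι → ℕ) :
    ∃ U : Ultrafilter (ι → ℕ),
      (∀ a, P a → ∀ᶠ φ : ι → ℕ in (U : Filter (ι → ℕ)), 0 < ∑ i, (φ i : ℤ) * a i) ∧
      (∀ᶠ φ : ι → ℕ in (U : Filter (ι → ℕ)), ∀ i, φ i ≡ r i [MOD M]) ∧
      ∀ᶠ φ : ι → ℕ in (U : Filter (ι → ℕ)), ∀ i, 0 < φ i := by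
  classical
  let S : Finset (ι → ℤ) → Set (ι → ℕ) := fun A =>
    {φ | (∀ a ∈ A, P a → 0 < ∑ i, (φ i : ℤ) * a i) ∧ (∀ i, φ i ≡ r i [MOD M]) ∧ ∀ i, 0 < φ i}
  have hne : (⨅ a, Filter.principal (S a)).NeBot := by
    rw [Filter.iInf_neBot_iff_of_directed']
    · intro A
      rw [Filter.principal_neBot_iff]
      obtain ⟨φ, h1, h2, h3⟩ := fm_nat P hadd h0 hpos M hM r (A.filter P)
        (fun a ha => (Finset.mem_filter.mp ha).2)
      exact ⟨φ, fun a ha hPa => h1 a (Finset.mem_filter.mpr ⟨ha, hPa⟩), h2, h3⟩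
    · intro A B
      refine ⟨A ∪ B, ?_, ?_⟩
      · refine Filter.principal_mono.mpr ?_
        exact fun φ h => ⟨fun a ha => h.1 a (Finset.mem_union_left _ ha), h.2⟩
      · refine Filter.principal_mono.mpr ?_
        exact fun φ h => ⟨fun a ha => h.1 a (Finset.mem_union_right _ ha), h.2⟩
  obtain ⟨U, hU⟩ := @Ultrafilter.exists_le _ _ hne
  have h : ∀ a, S a ∈ (U : Filter (ι → ℕ)) :=
    fun a => hU (Filter.mem_iInf_of_mem a (Filter.mem_principal_self _))
  refine ⟨U, fun a ha => ?_, ?_, ?_⟩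
  · filter_upwards [h {a}] with φ hφ using hφ.1 a (by simp) ha
  · filter_upwards [h ∅] with φ hφ using hφ.2.1
  · filter_upwards [h ∅] with φ hφ using hφ.2.2

end FM

section Grp

/-- two `ℓ`-elements congruent modulo a normal subgroup of order prime to `ℓ` -/
theorem grp_conj {T : Type*} [Group T] [Finite T] (ℓ : ℕ) [Fact ℓ.Prime] (R : Subgroup T)
    [R.Normal] (hR : ∀ r ∈ R, orderOf r ≠ ℓ) (g η : T) (a b : ℕ) (hg : g ^ ℓ ^ a = 1)
    (hη : η ^ ℓ ^ b = 1) (h : g⁻¹ * η ∈ R) : ∃ (ρ : T) (j : ℕ), g = ρ * η ^ j * ρ⁻¹ := by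
  classical
  let Q : Subgroup T := (Subgroup.zpowers η) ⊔ R
  have hgQ : g ∈ Q := by
    have : g = η * (g⁻¹ * η)⁻¹ := by group
    rw [this]
    exact mul_mem (Subgroup.mem_sup_left (Subgroup.mem_zpowers η))
      (inv_mem (Subgroup.mem_sup_right h))
  have hηQ : η ∈ Q := Subgroup.mem_sup_left (Subgroup.mem_zpowers η)
  let g' : Q := ⟨g, hgQ⟩
  let η' : Q := ⟨η, hηQ⟩
  have pg : IsPGroup ℓ (Subgroup.zpowers g') := by
    rw [IsPGroup.iff_card]
    have : Nat.card (Subgroup.zpowers g') ∣ ℓ ^ a := by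
      rw [Nat.card_zpowers]
      exact orderOf_dvd_of_pow_eq_one (Subtype.ext hg)
    obtain ⟨n, _, hn⟩ := (Nat.dvd_prime_pow Fact.out).mp this
    exact ⟨n, hn⟩
  have pη : IsPGroup ℓ (Subgroup.zpowers η') := by
    rw [IsPGroup.iff_card]
    have : Nat.card (Subgroup.zpowers η') ∣ ℓ ^ b := by
      rw [Nat.card_zpowers]
      exact orderOf_dvd_of_pow_eq_one (Subtype.ext hη)
    obtain ⟨n, _, hn⟩ := (Nat.dvd_prime_pow Fact.out).mp this
    exact ⟨n, hn⟩
  obtain ⟨P1, hP1⟩ := pg.exists_le_sylow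
  obtain ⟨P2, hP2⟩ := pη.exists_le_sylow
  -- P2 ∩ R trivial
  have hPR : ∀ x : Q, x ∈ P2 → (x : T) ∈ R → x = 1 := by
    intro x hx hxR
    by_contra hne
    obtain ⟨n, hn⟩ := P2.2 ⟨x, hx⟩
    have hn' : x ^ ℓ ^ n = 1 := by
      have := congrArg Subtype.val hn
      simpa using this
    obtain ⟨m, hm, ho⟩ := (Nat.dvd_prime_pow Fact.out).mp (orderOf_dvd_of_pow_eq_one hn')
    have hm0 : m ≠ 0 := by
      rintro rfl
      rw [pow_zero, orderOf_eq_one_iff] at ho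
      exact hne ho
    obtain ⟨m', rfl⟩ := Nat.exists_eq_succ_of_ne_zero hm0
    have h1 : orderOf (x ^ ℓ ^ m') = ℓ := by
      rw [orderOf_pow_of_dvd (pow_ne_zero _ (Fact.out : ℓ.Prime).ne_zero)
        (ho ▸ pow_dvd_pow _ (Nat.le_succ m')), ho, Nat.succ_eq_add_one, pow_succ,
        Nat.mul_div_cancel_left _ (pow_pos (Fact.out : ℓ.Prime).pos _)]
    have h2 : orderOf ((x : T) ^ ℓ ^ m') = ℓ := by
      have h3 := Subgroup.orderOf_coe (x ^ ℓ ^ m')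
      rw [h1] at h3
      exact h3
    exact hR _ (pow_mem hxR _) h2
  have hP2le : (P2 : Subgroup Q) ≤ Subgroup.zpowers η' := by
    intro x hx
    have hxQ : (x : T) ∈ (Subgroup.zpowers η) ⊔ R := x.2
    rw [Subgroup.mem_sup_of_normal_right] at hxQ
    obtain ⟨y, hy, z, hz, hyz⟩ := hxQ
    obtain ⟨n, rfl⟩ := Subgroup.mem_zpowers_iff.mp hy
    have h1 : (η' ^ n)⁻¹ * x ∈ P2 :=
      mul_mem (inv_mem (hP2 (Subgroup.zpow_mem _ (Subgroup.mem_zpowers η') n))) hx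
    have h2 : (((η' ^ n)⁻¹ * x : Q) : T) ∈ R := by
      have : (((η' ^ n)⁻¹ * x : Q) : T) = z := by
        push_cast
        rw [← hyz]
        change (η ^ n)⁻¹ * _ = _
        group
      rwa [this]
    have h3 := hPR _ h1 h2
    rw [inv_mul_eq_one] at h3
    rw [← h3]
    exact Subgroup.zpow_mem _ (Subgroup.mem_zpowers η') n
  obtain ⟨q, hq⟩ := MulAction.exists_smul_eq Q P2 P1
  have h1 : g' ∈ P1 := hP1 (Subgroup.mem_zpowers g')
  rw [← hq] at h1
  have h2 : q⁻¹ * g' * q ∈ P2 := by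
    rw [← SetLike.mem_coe, Sylow.coe_smul] at h1
    rw [Set.mem_smul_set_iff_inv_smul_mem] at h1
    have e : (MulAut.conj q)⁻¹ • g' = q⁻¹ * g' * q := by
      rw [← map_inv]; simp [MulAut.smul_def]
    rwa [e] at h1
  obtain ⟨j, hj⟩ := (mem_powers_iff_mem_zpowers).mpr (hP2le h2)
  refine ⟨q, j, ?_⟩
  have h3 : g' = q * η' ^ j * q⁻¹ := by
    change η' ^ j = _ at hj
    rw [hj]; group
  have := congrArg Subtype.val h3
  exact this

/-- make the order of the restriction a power of `ℓ` -/
theorem exists_pow_ell {T : Type*} [Group T] [Finite T] (ℓ : ℕ) (hl : ℓ.Prime) (g : T) (c : ℕ) :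
    ∃ j b : ℕ, (g ^ j) ^ ℓ ^ b = 1 ∧ j ≡ 1 [MOD ℓ ^ c] := by
  obtain ⟨m, n, hn, hm⟩ := Nat.exists_eq_pow_mul_and_not_dvd (orderOf_pos g).ne' ℓ hl.ne_one
  have hco : Nat.Coprime (ℓ ^ c) n :=
    Nat.Coprime.pow_left _ ((Nat.Prime.coprime_iff_not_dvd hl).mpr hn)
  obtain ⟨j, hj1, hj2⟩ := Nat.chineseRemainder hco 1 0
  refine ⟨j, m, ?_, hj1⟩
  rw [← pow_mul, ← orderOf_dvd_iff_pow_eq_one, hm, mul_comm]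
  exact mul_dvd_mul ((Nat.modEq_zero_iff_dvd).mp hj2) (dvd_refl _)

end Grp

section Mono
open MvPolynomial

theorem dom_val {κ F Γ ι : Type*} [Field κ] [Field F] [Algebra κ F] [Fintype ι]
    [LinearOrderedCommGroupWithZero Γ] (v : Valuation F Γ)
    (hv : ∀ c : κ, c ≠ 0 → v (algebraMap κ F c) = 1) (z : ι → F) (P : MvPolynomial ι κ)
    (a0 : ι →₀ ℕ) (h0 : a0 ∈ P.support) (hne : v (∏ i, z i ^ a0 i) ≠ 0)
    (hdom : ∀ a ∈ P.support, a ≠ a0 → v (∏ i, z i ^ a i) < v (∏ i, z i ^ a0 i)) :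
    v (aeval z P) = v (∏ i, z i ^ a0 i) := by
  classical
  rw [aeval_def, eval₂_eq', ← Finset.add_sum_erase _ _ h0]
  have h1 : v (algebraMap κ F (coeff a0 P) * ∏ i, z i ^ a0 i) = v (∏ i, z i ^ a0 i) := by
    rw [map_mul, hv _ (mem_support_iff.mp h0), one_mul]
  rw [Valuation.map_add_eq_of_lt_left, h1]
  rw [h1]
  apply Valuation.map_sum_lt _ hne
  intro a ha
  rw [Finset.mem_erase] at ha
  rw [map_mul, hv _ (mem_support_iff.mp ha.2), one_mul]
  exact hdom a ha.2 ha.1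

/-- multiplicatively independent values -/
def MIndep {F ι : Type*} [Field F] [Fintype ι] (W : ValuationSubring F) (z : ι → F) : Prop :=
  (∀ i, z i ≠ 0) ∧ ∀ a : ι → ℤ, W.valuation (∏ i, z i ^ a i) = 1 → a = 0

theorem prod_zpow_sub {F ι : Type*} [Field F] [Fintype ι] (z : ι → F) (hz : ∀ i, z i ≠ 0)
    (a b : ι →₀ ℕ) : (∏ i, z i ^ ((a i : ℤ) - (b i : ℤ))) = (∏ i, z i ^ a i) / (∏ i, z i ^ b i) := by
  rw [← Finset.prod_div_distrib]
  apply Finset.prod_congr rfl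
  intro i _
  rw [zpow_sub₀ (hz i), zpow_natCast, zpow_natCast]

theorem val_const {κ F : Type*} [Field κ] [Field F] [Algebra κ F] (W : ValuationSubring F)
    (hW : ∀ c : κ, algebraMap κ F c ∈ W) (c : κ) (hc : c ≠ 0) :
    W.valuation (algebraMap κ F c) = 1 := by
  apply le_antisymm
  · exact (W.valuation_le_one_iff _).mpr (hW c)
  · have := (W.valuation_le_one_iff _).mpr (hW c⁻¹)
    rw [map_inv₀, map_inv₀] at this
    have h0 : W.valuation (algebraMap κ F c) ≠ 0 := by simpa using hc
    exact (inv_le_one₀ (zero_lt_iff.mpr h0)).mp this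

theorem mono_exists {κ F ι : Type*} [Field κ] [Field F] [Algebra κ F] [Fintype ι]
    (W : ValuationSubring F) (hW : ∀ c : κ, algebraMap κ F c ∈ W) (z : ι → F)
    (hz : MIndep W z) (P : MvPolynomial ι κ) (hP : P ≠ 0) :
    ∃ a0 ∈ P.support, (∀ a ∈ P.support, a ≠ a0 →
      W.valuation (∏ i, z i ^ ((a i : ℤ) - (a0 i : ℤ))) < 1) ∧
      W.valuation (aeval z P) = W.valuation (∏ i, z i ^ a0 i) := by
  classical
  have hne : P.support.Nonempty := by
    rw [Finset.nonempty_iff_ne_empty, ne_eq, support_eq_empty]; exact hP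
  obtain ⟨a0, ha0, hmax⟩ := Finset.exists_max_image P.support
    (fun a => W.valuation (∏ i, z i ^ a i)) hne
  have hnz : ∀ a : ι →₀ ℕ, W.valuation (∏ i, z i ^ a i) ≠ 0 := by
    intro a
    rw [ne_eq, Valuation.zero_iff]
    exact Finset.prod_ne_zero_iff.mpr fun i _ => pow_ne_zero _ (hz.1 i)
  have hlt : ∀ a ∈ P.support, a ≠ a0 →
      W.valuation (∏ i, z i ^ a i) < W.valuation (∏ i, z i ^ a0 i) := by
    intro a ha hne
    refine lt_of_le_of_ne (hmax a ha) fun h => hne ?_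
    have := hz.2 (fun i => (a i : ℤ) - (a0 i : ℤ)) (by
      rw [prod_zpow_sub z hz.1, map_div₀, h, div_self (hnz a0)])
    ext i
    have h2 := congrFun this i
    simp only [Pi.zero_apply] at h2
    omega
  refine ⟨a0, ha0, fun a ha hne => ?_, dom_val _ (val_const W hW) z P a0 ha0 (hnz a0) hlt⟩
  rw [prod_zpow_sub z hz.1, map_div₀, div_lt_one₀ (zero_lt_iff.mpr (hnz a0))]
  exact hlt a ha hne

theorem mono_ne_zero {κ F ι : Type*} [Field κ] [Field F] [Algebra κ F] [Fintype ι]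
    (W : ValuationSubring F) (hW : ∀ c : κ, algebraMap κ F c ∈ W) (z : ι → F)
    (hz : MIndep W z) (P : MvPolynomial ι κ) (hP : P ≠ 0) : aeval z P ≠ 0 := by
  obtain ⟨a0, _, _, h⟩ := mono_exists W hW z hz P hP
  intro h0
  rw [h0, map_zero] at h
  have := (W.valuation.zero_iff).mp h.symm
  exact Finset.prod_ne_zero_iff.mpr (fun i _ => pow_ne_zero _ (hz.1 i)) this

theorem mono_algInd {κ F ι : Type*} [Field κ] [Field F] [Algebra κ F] [Fintype ι]
    (W : ValuationSubring F) (hW : ∀ c : κ, algebraMap κ F c ∈ W) (z : ι → F)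
    (hz : MIndep W z) : AlgebraicIndependent κ z := by
  rw [algebraicIndependent_iff]
  intro P hP
  by_contra h
  exact mono_ne_zero W hW z hz P h hP

end Mono

section Tadic
open Polynomial
variable (Ω : Type*) [Field Ω]

noncomputable def vt : Valuation (RatFunc Ω) (WithZero (Multiplicative ℤ)) :=
  (Polynomial.idealX Ω).valuation (RatFunc Ω)

variable {Ω}

theorem vt_X : vt Ω RatFunc.X < 1 ∧ vt Ω RatFunc.X ≠ 0 := by
  have : vt Ω RatFunc.X = WithZero.exp (-1 : ℤ) := Polynomial.valuation_X_eq_neg_one Ω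
  rw [this]
  refine ⟨?_, WithZero.exp_ne_zero⟩
  rw [← WithZero.exp_zero, WithZero.exp_lt_exp]; norm_num

theorem vt_poly_le (p : (Polynomial Ω)) : vt Ω (algebraMap _ _ p) ≤ 1 :=
  IsDedekindDomain.HeightOneSpectrum.valuation_le_one _ p

theorem vt_poly_lt (p : (Polynomial Ω)) : vt Ω (algebraMap _ _ p) < 1 ↔ p.coeff 0 = 0 := by
  rw [vt, IsDedekindDomain.HeightOneSpectrum.valuation_lt_one_iff_mem]
  change p ∈ Ideal.span {X} ↔ _
  rw [Ideal.mem_span_singleton, X_dvd_iff]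

theorem vt_poly_eq (p : (Polynomial Ω)) (hp : p.coeff 0 ≠ 0) : vt Ω (algebraMap _ _ p) = 1 :=
  le_antisymm (vt_poly_le p) (not_lt.mp fun h => hp ((vt_poly_lt p).mp h))

theorem vt_const (c : Ω) (hc : c ≠ 0) : vt Ω (algebraMap Ω (RatFunc Ω) c) = 1 := by
  rw [IsScalarTower.algebraMap_apply Ω (Polynomial Ω) (RatFunc Ω)]
  exact vt_poly_eq _ (by simpa using hc)

theorem vt_const_le (c : Ω) : vt Ω (algebraMap Ω (RatFunc Ω) c) ≤ 1 := by
  by_cases h : c = 0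
  · simp [h]
  · exact (vt_const c h).le

theorem vt_residue (f : RatFunc Ω) (hf : vt Ω f ≤ 1) :
    ∃ c : Ω, vt Ω (f - algebraMap Ω (RatFunc Ω) c) < 1 := by
  obtain ⟨p, q, hcop, hq, rfl⟩ : ∃ p q : (Polynomial Ω), IsCoprime p q ∧ q ≠ 0 ∧
      f = algebraMap _ _ p / algebraMap _ _ q :=
    ⟨f.num, f.denom, f.isCoprime_num_denom, f.denom_ne_zero, f.num_div_denom.symm⟩
  have hqa : algebraMap (Polynomial Ω) (RatFunc Ω) q ≠ 0 := by simpa using hq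
  have hq0 : q.coeff 0 ≠ 0 := by
    intro h0
    have hp0 : p.coeff 0 ≠ 0 := by
      intro hp0
      obtain ⟨a, b, hab⟩ := hcop
      have := congrArg (fun r => r.coeff 0) hab
      simp [mul_coeff_zero, h0, hp0] at this
    rw [map_div₀, vt_poly_eq p hp0] at hf
    have h1 := (vt_poly_lt q).mpr h0
    rw [one_div, inv_le_one₀ (zero_lt_iff.mpr (by simpa using hq))] at hf
    exact absurd h1 (not_lt.mpr hf)
  refine ⟨p.coeff 0 / q.coeff 0, ?_⟩
  have e : algebraMap (Polynomial Ω) (RatFunc Ω) p / algebraMap _ _ q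
      - algebraMap Ω (RatFunc Ω) (p.coeff 0 / q.coeff 0)
      = algebraMap (Polynomial Ω) (RatFunc Ω) (p - C (p.coeff 0 / q.coeff 0) * q) / algebraMap _ _ q := by
    rw [IsScalarTower.algebraMap_apply Ω (Polynomial Ω) (RatFunc Ω), map_sub, map_mul]
    field_simp
    rfl
  rw [e, map_div₀, vt_poly_eq q hq0, div_one, vt_poly_lt]
  simp [mul_coeff_zero, hq0]

theorem aeval_scale (ζ : Ω) (p : (Polynomial Ω)) (hp : p.coeff 0 ≠ 0) :
    vt Ω (aeval (algebraMap Ω (RatFunc Ω) ζ * RatFunc.X) p) = 1 := by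
  have h1 : vt Ω (algebraMap Ω (RatFunc Ω) ζ * RatFunc.X) < 1 := by
    rw [map_mul]
    exact mul_lt_one_of_nonneg_of_lt_one_right (vt_const_le ζ) zero_le vt_X.1
  have h2 : ∀ q : (Polynomial Ω), vt Ω (aeval (algebraMap Ω (RatFunc Ω) ζ * RatFunc.X) q) ≤ 1 := by
    intro q
    rw [aeval_def, eval₂_eq_sum, Polynomial.sum]
    refine Valuation.map_sum_le _ fun i _ => ?_
    rw [map_mul, map_pow]
    exact mul_le_one₀ (vt_const_le _) zero_le (pow_le_one₀ zero_le h1.le)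
  rw [← divX_mul_X_add p, map_add, map_mul, aeval_X, aeval_C]
  have h3 := vt_const _ hp
  rw [Valuation.map_add_eq_of_lt_right, h3]
  rw [h3, map_mul]
  exact mul_lt_one_of_nonneg_of_lt_one_right (h2 _) zero_le h1

theorem exists_psi (ζ : Ω) (hζ : ζ ≠ 0) : ∃ ψ : RatFunc Ω →ₐ[Ω] RatFunc Ω,
    ψ RatFunc.X = algebraMap Ω (RatFunc Ω) ζ * RatFunc.X ∧ ∀ f, vt Ω (ψ f) = vt Ω f := by
  let g : (Polynomial Ω) →ₐ[Ω] RatFunc Ω := aeval (algebraMap Ω (RatFunc Ω) ζ * RatFunc.X)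
  have key : ∀ p : (Polynomial Ω), vt Ω (g p) = vt Ω (algebraMap _ _ p) := by
    intro p
    by_cases hp : p = 0
    · simp [hp]
    obtain ⟨q, hq⟩ := exists_eq_pow_rootMultiplicity_mul_and_not_dvd p hp 0
    rw [map_zero, sub_zero] at hq
    rw [hq.1]
    have hq0 : q.coeff 0 ≠ 0 := by rw [ne_eq, ← X_dvd_iff]; exact hq.2
    rw [map_mul, map_mul, map_mul, map_mul, vt_poly_eq q hq0]
    have : vt Ω (g q) = 1 := aeval_scale ζ q hq0
    rw [this, map_pow, map_pow, map_pow, map_pow]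
    have h3 : g X = algebraMap Ω (RatFunc Ω) ζ * RatFunc.X := aeval_X _
    rw [h3, map_mul, vt_const ζ hζ, one_mul, RatFunc.algebraMap_X]
  have hinj : Function.Injective g := by
    rw [injective_iff_map_eq_zero]
    intro p hp
    have := key p
    rw [hp, map_zero] at this
    have := (vt Ω).zero_iff.mp this.symm
    simpa using this
  let ψ : RatFunc Ω →ₐ[Ω] RatFunc Ω := IsFractionRing.liftAlgHom (g := g) hinj
  have hψ : ∀ p : (Polynomial Ω), ψ (algebraMap _ _ p) = g p := fun p => by
    simp [ψ]
  refine ⟨ψ, ?_, ?_⟩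
  · rw [← RatFunc.algebraMap_X, hψ, RatFunc.algebraMap_X]; exact aeval_X _
  · intro f
    rw [← f.num_div_denom, map_div₀, map_div₀, map_div₀, hψ, hψ, key, key]

noncomputable def Ot (Ω : Type*) [Field Ω] : ValuationSubring (RatFunc Ω) := (vt Ω).valuationSubring

theorem mem_Ot (f : RatFunc Ω) : f ∈ Ot Ω ↔ vt Ω f ≤ 1 := Valuation.mem_valuationSubring_iff _ _

theorem Ot_lt (f : RatFunc Ω) : (Ot Ω).valuation f < 1 ↔ vt Ω f < 1 := by
  rw [val_lt_one_iff', mem_Ot, mem_Ot]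
  by_cases hf : f = 0
  · simp [hf]
  have h0 : 0 < vt Ω f := zero_lt_iff.mpr (by simpa using hf)
  rw [map_inv₀, inv_le_one₀ h0, not_le]
  simp only [hf, false_or]
  exact ⟨fun h => h.2, fun h => ⟨h.le, h⟩⟩

theorem Ot_inr (ψ : RatFunc Ω →ₐ[Ω] RatFunc Ω) (hψ : ∀ f, vt Ω (ψ f) = vt Ω f) : Inr (Ot Ω) ψ := by
  refine ⟨fun x => by rw [mem_Ot, mem_Ot, hψ], fun x hx => ?_⟩
  rw [mem_Ot] at hx
  rw [Ot_lt]
  obtain ⟨c, hc⟩ := vt_residue x hx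
  have : ψ x - x = ψ (x - algebraMap _ _ c) - (x - algebraMap _ _ c) := by
    rw [map_sub, AlgHom.commutes]; ring
  rw [this]
  refine lt_of_le_of_lt ((vt Ω).map_sub _ _) (max_lt ?_ hc)
  rwa [hψ]

theorem Inr_comap {E L : Type*} [Field E] [Field L] (O : ValuationSubring L) (θ : E →+* L)
    (σ : E → E) (ψ : L → L) (hc : ∀ x, θ (σ x) = ψ (θ x)) (h : Inr O ψ) :
    Inr (O.comap θ) σ := by
  refine ⟨fun x => ?_, fun x hx => ?_⟩
  · rw [ValuationSubring.mem_comap, ValuationSubring.mem_comap, hc, h.1]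
  · rw [val_lt_one_comap, map_sub, hc]
    exact h.2 _ hx

end Tadic

section LemmaV
open IntermediateField

theorem exists_theta {κ Ω ι : Type*} [Field κ] [Field Ω] [Algebra κ Ω] (z : ι → Ω)
    (hz : AlgebraicIndependent κ z) (φ : ι → ℕ) :
    ∃ θ : adjoin κ (Set.range z) →ₐ[κ] RatFunc Ω,
      ∀ i, θ ⟨z i, subset_adjoin _ _ ⟨i, rfl⟩⟩
        = algebraMap Ω (RatFunc Ω) (z i) * RatFunc.X ^ φ i := by
  let g0 : MvPolynomial ι κ →ₐ[κ] Polynomial Ω :=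
    MvPolynomial.aeval (fun i => Polynomial.C (z i) * Polynomial.X ^ φ i)
  have hg0 : Function.Injective g0 := by
    have h1 : (Polynomial.aeval (R := Ω) (1 : Ω)).toRingHom.comp g0.toRingHom
        = (MvPolynomial.aeval z : MvPolynomial ι κ →ₐ[κ] Ω).toRingHom := by
      apply MvPolynomial.ringHom_ext
      · intro c
        simp [g0]
      · intro i
        simp [g0]
    have h2 : Function.Injective
      ((Polynomial.aeval (R := Ω) (1 : Ω)).toRingHom.comp g0.toRingHom) := by
      rw [h1]; exact hz
    exact Function.Injective.of_comp (f := (Polynomial.aeval (R := Ω) (1 : Ω))) h2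
  let g1 : MvPolynomial ι κ →ₐ[κ] RatFunc Ω :=
    (IsScalarTower.toAlgHom κ (Polynomial Ω) (RatFunc Ω)).comp g0
  have hg1 : Function.Injective g1 :=
    (FaithfulSMul.algebraMap_injective (Polynomial Ω) (RatFunc Ω)).comp hg0
  let g2 : FractionRing (MvPolynomial ι κ) →ₐ[κ] RatFunc Ω :=
    IsFractionRing.liftAlgHom (g := g1) hg1
  refine ⟨g2.comp (hz.aevalEquivField.symm : _ →ₐ[κ] _), fun i => ?_⟩
  have h3 : hz.aevalEquivField (algebraMap (MvPolynomial ι κ) (FractionRing (MvPolynomial ι κ))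
      (MvPolynomial.X i)) = ⟨z i, subset_adjoin _ _ ⟨i, rfl⟩⟩ := by
    apply Subtype.ext
    simp
  rw [← h3]
  simp [g2, g1, g0]

end LemmaV

section Tame
variable {F Ω : Type*} [Field F] [Field Ω] [Algebra F Ω]

theorem val_torsion_poly (W : ValuationSubring Ω) (c : Ω) (hc : c ≠ 0) (p : Polynomial F)
    (hp : p ≠ 0) (h0 : Polynomial.aeval c p = 0) (n : ℕ) (hn : p.natDegree ≤ n) :
    ∃ f : F, f ≠ 0 ∧ W.valuation (c ^ n.factorial) = W.valuation (algebraMap F Ω f) := by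
  classical
  have hne : p.support.Nonempty := Polynomial.support_nonempty.mpr hp
  let w : ℕ → Ω := fun i => algebraMap F Ω (p.coeff i) * c ^ i
  have hsum : ∑ i ∈ p.support, w i = 0 := by
    rw [Polynomial.aeval_def, Polynomial.eval₂_eq_sum, Polynomial.sum] at h0
    exact h0
  obtain ⟨i0, hi0, hmax⟩ := Finset.exists_max_image p.support (fun i => W.valuation (w i)) hne
  have hw0 : ∀ i ∈ p.support, w i ≠ 0 := by
    intro i hi
    exact mul_ne_zero (by simpa using Polynomial.mem_support_iff.mp hi) (pow_ne_zero _ hc)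
  have hex : ∃ i ∈ p.support, i ≠ i0 ∧ W.valuation (w i) = W.valuation (w i0) := by
    by_contra! hcon
    have h1 : W.valuation (∑ i ∈ p.support, w i) = W.valuation (w i0) := by
      rw [← Finset.add_sum_erase _ _ hi0]
      apply Valuation.map_add_eq_of_lt_left
      apply Valuation.map_sum_lt
      · rw [ne_eq, Valuation.zero_iff]; exact hw0 i0 hi0
      · intro i hi
        rw [Finset.mem_erase] at hi
        exact lt_of_le_of_ne (hmax i hi.2) (hcon i hi.2 hi.1)
    rw [hsum, map_zero] at h1
    exact hw0 i0 hi0 (W.valuation.zero_iff.mp h1.symm)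
  obtain ⟨i, hi, hii, hval⟩ := hex
  have key : ∀ i j, i ∈ p.support → j ∈ p.support → i < j → W.valuation (w i) = W.valuation (w j) →
      ∃ f : F, f ≠ 0 ∧ W.valuation (c ^ n.factorial) = W.valuation (algebraMap F Ω f) := by
    intro i j hi hj hij h
    have hj' : j ≤ n := (Polynomial.le_natDegree_of_mem_supp _ hj).trans hn
    obtain ⟨e, he⟩ := Nat.dvd_factorial (m := j - i) (n := n) (by omega) (by omega)
    have hai : p.coeff i ≠ 0 := Polynomial.mem_support_iff.mp hi
    have haj : p.coeff j ≠ 0 := Polynomial.mem_support_iff.mp hj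
    refine ⟨(p.coeff i / p.coeff j) ^ e, pow_ne_zero _ (div_ne_zero hai haj), ?_⟩
    rw [he, pow_mul, map_pow W.valuation (c ^ (j - i)) e, map_pow (algebraMap F Ω),
      map_pow W.valuation _ e]
    congr 1
    have h2 : w j / w i * algebraMap F Ω (p.coeff i / p.coeff j) = c ^ (j - i) := by
      simp only [w, map_div₀]
      have : algebraMap F Ω (p.coeff i) ≠ 0 := by simpa using hai
      have : algebraMap F Ω (p.coeff j) ≠ 0 := by simpa using haj
      rw [show c ^ j = c ^ (j - i) * c ^ i by rw [← pow_add]; congr 1; omega]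
      field_simp
    rw [← h2, map_mul, map_div₀, h, div_self, one_mul]
    rw [ne_eq, Valuation.zero_iff]; exact hw0 j hj
  rcases lt_or_gt_of_ne hii with h | h
  · exact key i i0 hi hi0 h hval
  · exact key i0 i hi0 hi h hval.symm

theorem val_torsion (W : ValuationSubring Ω) (N : IntermediateField F Ω) [FiniteDimensional F N]
    (c : Ω) (hcN : c ∈ N) (hc : c ≠ 0) :
    ∃ f : F, f ≠ 0 ∧
      W.valuation (c ^ (Module.finrank F N).factorial) = W.valuation (algebraMap F Ω f) := by
  have hint : IsIntegral F (⟨c, hcN⟩ : N) := Algebra.IsIntegral.isIntegral _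
  apply val_torsion_poly W c hc (minpoly F (⟨c, hcN⟩ : N)) (minpoly.ne_zero hint)
  · have := minpoly.aeval F (⟨c, hcN⟩ : N)
    have h2 := congrArg (algebraMap N Ω) this
    rwa [← Polynomial.aeval_algebraMap_apply, map_zero] at h2
  · exact minpoly.natDegree_le _

/-- an inertial ring automorphism preserves valuation comparisons -/
theorem Inr_val {L : Type*} [Field L] (W : ValuationSubring L) (σ : L →+* L)
    (hσ : ∀ x, σ x ∈ W ↔ x ∈ W) (x y : L) :
    W.valuation (σ x) < W.valuation (σ y) ↔ W.valuation x < W.valuation y := by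
  rw [lt_iff_not_ge, lt_iff_not_ge, not_iff_not]
  by_cases hx : x = 0
  · subst hx; simp
  have h1 : ∀ a b : L, a ≠ 0 → (W.valuation b ≤ W.valuation a ↔ b / a ∈ W) := by
    intro a b ha
    rw [← W.valuation_le_one_iff, map_div₀, div_le_one₀]
    exact zero_lt_iff.mpr (by simpa using ha)
  rw [h1 _ _ (by simpa using hx), h1 _ _ hx, ← map_div₀, hσ]

/-- The tame conjugacy lemma at a finite level. -/
theorem tame_conj {T : Type*} [Field T] [Algebra F T] [FiniteDimensional F T]
    (W : ValuationSubring T) (ℓ : ℕ) [hl : Fact ℓ.Prime]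
    (hroot : W.valuation (ℓ : T) = 1)
    (g η : T ≃ₐ[F] T) (hg : ∀ x, g x ∈ W ↔ x ∈ W) (hη : ∀ x, η x ∈ W ↔ x ∈ W)
    (a b : ℕ) (hga : g ^ ℓ ^ a = 1) (hηb : η ^ ℓ ^ b = 1)
    (H : ∀ c, c ≠ 0 → W.valuation (η c - g c) < W.valuation c) :
    ∃ (ρ : T ≃ₐ[F] T) (j : ℕ), g = ρ * η ^ j * ρ⁻¹ := by
  let D : Subgroup (T ≃ₐ[F] T) :=
    { carrier := {σ | ∀ x, σ x ∈ W ↔ x ∈ W}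
      one_mem' := fun x => Iff.rfl
      mul_mem' := fun {a b} ha hb x => (ha (b x)).trans (hb x)
      inv_mem' := fun {a} ha x => by
        have h := (ha (a⁻¹ x)).symm
        have h2 : a (a⁻¹ x) = x := a.apply_symm_apply x
        rwa [h2] at h }
  have hD : ∀ σ ∈ D, ∀ x y, W.valuation (σ x) < W.valuation (σ y) ↔
      W.valuation x < W.valuation y := fun σ hσ => Inr_val W (σ : T →+* T) hσ
  let R : Subgroup D :=
    { carrier := {σ | ∀ c, c ≠ 0 → W.valuation (σ.1 c - c) < W.valuation c}
      one_mem' := by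
        intro c hc
        change W.valuation (c - c) < _
        rw [sub_self, map_zero]
        exact zero_lt_iff.mpr (by simpa using hc)
      mul_mem' := by
        intro σ τ hσ hτ c hc
        have e : (σ * τ).1 c - c = σ.1 (τ.1 c - c) + (σ.1 c - c) := by
          change σ.1 (τ.1 c) - c = _
          rw [map_sub]; ring
        rw [e]
        refine lt_of_le_of_lt (W.valuation.map_add _ _) (max_lt ?_ (hσ c hc))
        by_cases h : τ.1 c - c = 0
        · rw [h, map_zero, map_zero]
          exact zero_lt_iff.mpr (by simpa using hc)
        · have h3 := hσ _ h
          have e2 : σ.1 (τ.1 c - c) = (τ.1 c - c) + (σ.1 (τ.1 c - c) - (τ.1 c - c)) := by ring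
          rw [e2]
          exact lt_of_le_of_lt (W.valuation.map_add _ _) (max_lt (hτ c hc) (h3.trans (hτ c hc)))
      inv_mem' := by
        intro σ hσ c hc
        have h1 : σ.1 ((σ⁻¹).1 c) = c := σ.1.apply_symm_apply c
        rw [← hD σ.1 σ.2, map_sub, h1]
        have := hσ c hc
        have e : c - σ.1 c = -(σ.1 c - c) := by ring
        rw [e, Valuation.map_neg]
        have e2 : W.valuation (σ.1 c) = W.valuation c := by
          have : σ.1 c = c + (σ.1 c - c) := by ring
          rw [this]
          apply Valuation.map_add_eq_of_lt_left
          exact hσ c hc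
        rw [e2]; exact this }
  haveI : R.Normal := ⟨by
    intro n hn τ c hc
    have h1 : ∀ x, τ.1 ((τ⁻¹).1 x) = x := fun x => τ.1.apply_symm_apply x
    have h2 := hn ((τ⁻¹).1 c) (by simpa using hc)
    rw [← hD τ.1 τ.2, map_sub, h1] at h2
    exact h2⟩
  have hR : ∀ r ∈ R, orderOf r ≠ ℓ := by
    intro r hr ho
    -- eigenvector
    have hr1 : r.1 ≠ 1 := by
      intro h
      have : r = 1 := Subtype.ext h
      rw [this, orderOf_one] at ho
      exact hl.out.ne_one ho.symm
    have hrp : r.1 ^ ℓ = 1 := by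
      have := pow_orderOf_eq_one r
      rw [ho] at this
      exact congrArg Subtype.val this
    obtain ⟨c, hc⟩ : ∃ c, r.1 c ≠ c := by
      by_contra! h
      exact hr1 (AlgEquiv.ext h)
    set d := r.1 c - c with hd
    have hd0 : d ≠ 0 := sub_ne_zero.mpr hc
    have htel : ∑ k ∈ Finset.range ℓ, (r.1 ^ k) d = 0 := by
      have e : ∀ k, (r.1 ^ k) d = (r.1 ^ (k+1)) c - (r.1 ^ k) c := by
        intro k
        rw [hd, map_sub, pow_succ]; rfl
      rw [Finset.sum_congr rfl (fun k _ => e k), Finset.sum_range_sub (fun k => (r.1 ^ k) c), hrp]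
      simp
    have hsplit : ∑ k ∈ Finset.range ℓ, (r.1 ^ k) d
        = (ℓ : T) * d + ∑ k ∈ Finset.range ℓ, ((r.1 ^ k) d - d) := by
      rw [Finset.sum_sub_distrib]; simp
    have hv : W.valuation ((ℓ : T) * d) = W.valuation d := by rw [map_mul, hroot, one_mul]
    have hvd : W.valuation d ≠ 0 := by simpa using hd0
    have h1 : W.valuation (∑ k ∈ Finset.range ℓ, ((r.1 ^ k) d - d)) < W.valuation d := by
      apply Valuation.map_sum_lt _ hvd
      intro k _
      exact (R.pow_mem hr k) d hd0
    have h2 := Valuation.map_add_eq_of_lt_left W.valuation (h1.trans_eq hv.symm)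
    rw [← hsplit, htel, map_zero, hv] at h2
    exact hvd h2.symm
  obtain ⟨ρ, j, h⟩ := grp_conj (T := D) ℓ R hR ⟨g, hg⟩ ⟨η, hη⟩ a b (Subtype.ext hga)
    (Subtype.ext hηb) (by
      intro c hc
      have h1 : ∀ x, g (g⁻¹ x) = x := fun x => g.apply_symm_apply x
      change W.valuation (g⁻¹ (η c) - c) < _
      rw [← hD g hg, map_sub, h1]
      have h2 : W.valuation (g c) = W.valuation c := by
        have hgn : ∀ n, g ^ n ∈ D := fun n => D.pow_mem hg n
        have hpos : 0 < ℓ ^ a := pow_pos hl.out.pos _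
        have hsucc : ∀ n, (g ^ (n + 1)) c = (g ^ n) (g c) := fun n => by rw [pow_succ]; rfl
        rcases lt_trichotomy (W.valuation (g c)) (W.valuation c) with h | h | h
        · have : ∀ n, 0 < n → W.valuation ((g ^ n) c) < W.valuation c := by
            intro n hn
            induction n with
            | zero => omega
            | succ n ih =>
              have h3 := (hD _ (hgn n) (g c) c).mpr h
              rw [← hsucc] at h3
              rcases Nat.eq_zero_or_pos n with rfl | hn'
              · simpa using h
              · exact h3.trans (ih hn')
          have h4 := this _ hpos
          rw [hga] at h4
          exact absurd h4 (lt_irrefl _)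
        · exact h
        · have : ∀ n, 0 < n → W.valuation c < W.valuation ((g ^ n) c) := by
            intro n hn
            induction n with
            | zero => omega
            | succ n ih =>
              have h3 := (hD _ (hgn n) c (g c)).mpr h
              rw [← hsucc] at h3
              rcases Nat.eq_zero_or_pos n with rfl | hn'
              · simpa using h
              · exact (ih hn').trans h3
          have h4 := this _ hpos
          rw [hga] at h4
          exact absurd h4 (lt_irrefl _)
      rw [h2]
      exact H c hc)
  exact ⟨ρ.1, j, congrArg Subtype.val h⟩

end Tame

section LimFam
open IntermediateField MvPolynomial

/-- ultralimit of valuation subrings -/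
def ultraVS {Ω I : Type*} [Field Ω] (U : Ultrafilter I) (Wf : I → ValuationSubring Ω) :
    ValuationSubring Ω where
  carrier := {x | ∀ᶠ i in (U : Filter I), x ∈ Wf i}
  mul_mem' := by
    intro a b ha hb
    filter_upwards [ha, hb] with i h1 h2 using mul_mem h1 h2
  one_mem' := Filter.Eventually.of_forall fun i => one_mem _
  add_mem' := by
    intro a b ha hb
    filter_upwards [ha, hb] with i h1 h2 using add_mem h1 h2
  zero_mem' := Filter.Eventually.of_forall fun i => zero_mem _
  neg_mem' := by
    intro a ha
    filter_upwards [ha] with i h1 using neg_mem h1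
  mem_or_inv_mem' := by
    intro x
    rcases Ultrafilter.em U (fun i => x ∈ Wf i) with h | h
    · exact Or.inl h
    · right
      filter_upwards [h] with i hi
      exact ((Wf i).mem_or_inv_mem x).resolve_left hi

theorem mem_ultraVS {Ω I : Type*} [Field Ω] (U : Ultrafilter I) (Wf : I → ValuationSubring Ω)
    (x : Ω) : x ∈ ultraVS U Wf ↔ ∀ᶠ i in (U : Filter I), x ∈ Wf i := Iff.rfl

variable {κ Ω ι : Type*} [Field κ] [Field Ω] [Algebra κ Ω] [Fintype ι]

/-- θ on polynomials -/
theorem theta_poly (z : ι → Ω) (θ : adjoin κ (Set.range z) →ₐ[κ] RatFunc Ω) (φ : ι → ℕ)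
    (hθ : ∀ i, θ ⟨z i, subset_adjoin _ _ ⟨i, rfl⟩⟩
        = algebraMap Ω (RatFunc Ω) (z i) * RatFunc.X ^ φ i) (P : MvPolynomial ι κ)
    (h : aeval z P ∈ adjoin κ (Set.range z)) :
    θ ⟨aeval z P, h⟩ = aeval (fun i => algebraMap Ω (RatFunc Ω) (z i) * RatFunc.X ^ φ i) P := by
  have e : (⟨aeval z P, h⟩ : adjoin κ (Set.range z))
      = aeval (fun i => (⟨z i, subset_adjoin _ _ ⟨i, rfl⟩⟩ : adjoin κ (Set.range z))) P := by
    apply Subtype.ext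
    change _ = (adjoin κ (Set.range z)).val _
    rw [comp_aeval_apply]
    rfl
  rw [e, comp_aeval_apply]
  congr 1
  congr 1
  funext i
  exact hθ i

theorem vt_mono (z : ι → Ω) (hz : ∀ i, z i ≠ 0) (φ : ι → ℕ) (a : ι → ℤ) :
    vt Ω (∏ i, (algebraMap Ω (RatFunc Ω) (z i) * RatFunc.X ^ φ i) ^ a i)
      = vt Ω RatFunc.X ^ (∑ i, (φ i : ℤ) * a i) := by
  rw [map_prod]
  have : ∀ i, vt Ω ((algebraMap Ω (RatFunc Ω) (z i) * RatFunc.X ^ φ i) ^ a i)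
      = vt Ω RatFunc.X ^ ((φ i : ℤ) * a i) := by
    intro i
    rw [map_zpow₀, map_mul, vt_const _ (hz i), one_mul, map_pow, zpow_mul, zpow_natCast]
  simp only [this]
  generalize (Finset.univ : Finset ι) = s
  classical
  induction s using Finset.induction_on with
  | empty => simp
  | insert j s hj ih => rw [Finset.prod_insert hj, Finset.sum_insert hj, zpow_add₀ vt_X.2, ih]

theorem vt_mono_lt (z : ι → Ω) (hz : ∀ i, z i ≠ 0) (φ : ι → ℕ) (a : ι → ℤ)
    (h : 0 < ∑ i, (φ i : ℤ) * a i) :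
    vt Ω (∏ i, (algebraMap Ω (RatFunc Ω) (z i) * RatFunc.X ^ φ i) ^ a i) < 1 := by
  rw [vt_mono z hz]
  exact zpow_lt_one₀ (zero_lt_iff.mpr vt_X.2) vt_X.1 h

theorem lim_family [IsAlgClosed Ω] (W : ValuationSubring Ω)
    (hW : ∀ c : κ, algebraMap κ Ω c ∈ W)
    (z : ι → Ω) (hz : MIndep W z) (hlt : ∀ i, W.valuation (z i) < 1)
    [Algebra.IsAlgebraic (adjoin κ (Set.range z)) Ω] (M : ℕ) (hM : 0 < M) (r : ι → ℕ) :
    ∃ (U : Ultrafilter (ι → ℕ)) (Wf : (ι → ℕ) → ValuationSubring Ω),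
      (∀ x, x ∈ W ↔ ∀ᶠ φ in (U : Filter (ι → ℕ)), x ∈ Wf φ) ∧
      (∀ φ, ∃ θ : adjoin κ (Set.range z) →ₐ[κ] RatFunc Ω,
        (∀ i, θ ⟨z i, subset_adjoin _ _ ⟨i, rfl⟩⟩
          = algebraMap Ω (RatFunc Ω) (z i) * RatFunc.X ^ φ i) ∧
        (Wf φ).comap (algebraMap (adjoin κ (Set.range z)) Ω) = (Ot Ω).comap (θ : _ →+* _)) ∧
      (∀ᶠ φ in (U : Filter (ι → ℕ)), ∀ i, φ i ≡ r i [MOD M]) ∧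
      ∀ᶠ φ in (U : Filter (ι → ℕ)), ∀ i, 0 < φ i := by
  have hnz : ∀ a : ι → ℤ, W.valuation (∏ i, z i ^ a i) ≠ 0 := by
    intro a
    rw [ne_eq, Valuation.zero_iff]
    exact Finset.prod_ne_zero_iff.mpr fun i _ => zpow_ne_zero _ (hz.1 i)
  obtain ⟨U, hU1, hU2, hU3⟩ := fm_ultra (fun a : ι → ℤ => W.valuation (∏ i, z i ^ a i) < 1)
    (by
      intro a b ha hb
      have : (∏ i, z i ^ (a + b) i) = (∏ i, z i ^ a i) * ∏ i, z i ^ b i := by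
        rw [← Finset.prod_mul_distrib]
        exact Finset.prod_congr rfl fun i _ => zpow_add₀ (hz.1 i) _ _
      change W.valuation _ < 1
      rw [this, map_mul]
      exact mul_lt_one_of_nonneg_of_lt_one_right ha.le zero_le hb)
    (by simp)
    (by
      intro a ha hne
      refine lt_of_le_of_ne ?_ fun h => hne (hz.2 a h)
      rw [map_prod]
      apply Finset.prod_le_one'
      intro i _
      rw [map_zpow₀]
      obtain ⟨n, hn⟩ := Int.eq_ofNat_of_zero_le (ha i)
      rw [hn]
      rw [zpow_natCast]
      exact pow_le_one₀ zero_le (hlt i).le) M hM r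
  have hAI := mono_algInd W hW z hz
  choose θ hθ using fun φ => exists_theta (κ := κ) z hAI φ
  choose W0 hW0 using fun φ => exists_prolong (algebraMap (adjoin κ (Set.range z)) Ω)
    ((Ot Ω).comap (θ φ : _ →+* _))
  -- comparison
  have hpoly : ∀ P : MvPolynomial ι κ, P ≠ 0 → ∃ a0 : ι →₀ ℕ,
      W.valuation (aeval z P) = W.valuation (∏ i, z i ^ a0 i) ∧
      ∀ᶠ φ in (U : Filter (ι → ℕ)),
        vt Ω (aeval (fun i => algebraMap Ω (RatFunc Ω) (z i) * RatFunc.X ^ φ i) P)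
          = vt Ω (∏ i, (algebraMap Ω (RatFunc Ω) (z i) * RatFunc.X ^ φ i) ^ a0 i) := by
    intro P hP
    obtain ⟨a0, ha0, hdom, hval⟩ := mono_exists W hW z hz P hP
    refine ⟨a0, hval, ?_⟩
    have hev : ∀ᶠ φ in (U : Filter (ι → ℕ)), ∀ a ∈ P.support, a ≠ a0 →
        0 < ∑ i, (φ i : ℤ) * ((a i : ℤ) - (a0 i : ℤ)) := by
      rw [Filter.eventually_all_finset]
      intro a ha
      by_cases h : a = a0
      · simp [h]
      · filter_upwards [hU1 _ (hdom a ha h)] with φ hφ _ using hφ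
    filter_upwards [hev] with φ hφ
    have hz' : ∀ i, algebraMap Ω (RatFunc Ω) (z i) * RatFunc.X ^ φ i ≠ 0 := fun i =>
      mul_ne_zero (by simpa using hz.1 i) (pow_ne_zero _ RatFunc.X_ne_zero)
    have hnz2 : vt Ω (∏ i, (algebraMap Ω (RatFunc Ω) (z i) * RatFunc.X ^ φ i) ^ a0 i) ≠ 0 := by
      rw [ne_eq, Valuation.zero_iff]
      exact Finset.prod_ne_zero_iff.mpr fun i _ => pow_ne_zero _ (hz' i)
    refine dom_val (vt Ω) ?_ _ P a0 ha0 hnz2 ?_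
    · intro c hc
      rw [IsScalarTower.algebraMap_apply κ Ω (RatFunc Ω)]
      exact vt_const _ (by simpa using hc)
    · intro a ha hne
      rw [← div_lt_one₀ (zero_lt_iff.mpr hnz2), ← map_div₀, ← prod_zpow_sub _ hz']
      exact vt_mono_lt z hz.1 φ _ (hφ a ha hne)
  have hcmp : ∀ e : adjoin κ (Set.range z), algebraMap _ Ω e ∈ ultraVS U W0 ↔
      algebraMap _ Ω e ∈ W := by
    -- positive direction facts
    have hfact : ∀ e : adjoin κ (Set.range z), e ≠ 0 → ∃ a : ι → ℤ,
        W.valuation (algebraMap _ Ω e) = W.valuation (∏ i, z i ^ a i) ∧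
        ∀ᶠ φ in (U : Filter (ι → ℕ)), vt Ω (θ φ e) = vt Ω RatFunc.X ^ (∑ i, (φ i : ℤ) * a i) := by
      rintro ⟨e, he⟩ hne
      obtain ⟨P, Q, hPQ⟩ := (IntermediateField.mem_adjoin_range_iff κ z e).mp he
      have he0 : e ≠ 0 := fun h => hne (Subtype.ext h)
      have hP : P ≠ 0 := by rintro rfl; simp at hPQ; exact he0 hPQ
      have hQ : Q ≠ 0 := by rintro rfl; simp at hPQ; exact he0 hPQ
      obtain ⟨a, ha1, ha2⟩ := hpoly P hP
      obtain ⟨b, hb1, hb2⟩ := hpoly Q hQ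
      refine ⟨fun i => (a i : ℤ) - (b i : ℤ), ?_, ?_⟩
      · rw [prod_zpow_sub z hz.1]
        change W.valuation e = _
        rw [hPQ, map_div₀, map_div₀, ha1, hb1]
      · filter_upwards [ha2, hb2] with φ h1 h2
        have hmem : ∀ R : MvPolynomial ι κ, aeval z R ∈ adjoin κ (Set.range z) := fun R => by
          have := (aeval (fun i => (⟨z i, subset_adjoin _ _ ⟨i, rfl⟩⟩ : adjoin κ (Set.range z))) R).2
          have e2 : aeval z R = (adjoin κ (Set.range z)).val
            (aeval (fun i => (⟨z i, subset_adjoin _ _ ⟨i, rfl⟩⟩ : adjoin κ (Set.range z))) R) := by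
            rw [comp_aeval_apply]; rfl
          rw [e2]; exact this
        have e3 : (⟨e, he⟩ : adjoin κ (Set.range z)) = ⟨_, hmem P⟩ / ⟨_, hmem Q⟩ :=
          Subtype.ext hPQ
        rw [e3, map_div₀, map_div₀, theta_poly z (θ φ) φ (hθ φ), theta_poly z (θ φ) φ (hθ φ), h1, h2,
          ← vt_mono z hz.1, prod_zpow_sub, map_div₀]
        exact fun i => mul_ne_zero (by simpa using hz.1 i) (pow_ne_zero _ RatFunc.X_ne_zero)
    have hmemφ : ∀ (φ : ι → ℕ) (e : adjoin κ (Set.range z)),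
        algebraMap _ Ω e ∈ W0 φ ↔ vt Ω (θ φ e) ≤ 1 := by
      intro φ e
      rw [← ValuationSubring.mem_comap, hW0, ValuationSubring.mem_comap, mem_Ot]; rfl
    intro e
    rw [mem_ultraVS]
    by_cases he : e = 0
    · subst he; simp [zero_mem]
    obtain ⟨a, ha1, ha2⟩ := hfact e he
    rcases lt_trichotomy (W.valuation (∏ i, z i ^ a i)) 1 with h | h | h
    · have h2 : algebraMap _ Ω e ∈ W := by
        rw [← W.valuation_le_one_iff, ha1]; exact h.le
      simp only [h2, iff_true]
      filter_upwards [ha2, hU1 a h] with φ h3 h4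
      rw [hmemφ, h3]
      exact (zpow_lt_one₀ (zero_lt_iff.mpr vt_X.2) vt_X.1 h4).le
    · have h2 : algebraMap _ Ω e ∈ W := by
        rw [← W.valuation_le_one_iff, ha1]; exact h.le
      simp only [h2, iff_true]
      have ha0 := hz.2 a h
      filter_upwards [ha2] with φ h3
      rw [hmemφ, h3, ha0]
      simp
    · have h2 : ¬ algebraMap _ Ω e ∈ W := by
        rw [← W.valuation_le_one_iff, ha1, not_le]; exact h
      simp only [h2, iff_false]
      have h5 : W.valuation (∏ i, z i ^ (-a) i) < 1 := by
        have : (∏ i, z i ^ (-a) i) = (∏ i, z i ^ a i)⁻¹ := by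
          rw [← Finset.prod_inv_distrib]
          exact Finset.prod_congr rfl fun i _ => zpow_neg _ _
        rw [this, map_inv₀]
        exact inv_lt_one_of_one_lt₀ h
      rw [← Ultrafilter.eventually_not]
      filter_upwards [ha2, hU1 _ h5] with φ h3 h4
      rw [hmemφ, h3, not_le]
      apply one_lt_zpow_of_neg₀ (zero_lt_iff.mpr vt_X.2) vt_X.1
      simp only [Pi.neg_apply, mul_neg, Finset.sum_neg_distrib] at h4
      omega
  obtain ⟨τ, hτ⟩ := conj_gen (E := adjoin κ (Set.range z)) (ultraVS U W0) W hcmp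
  refine ⟨U, fun φ => (W0 φ).comap (τ : Ω →+* Ω), fun x => ?_, fun φ => ⟨θ φ, hθ φ, ?_⟩, hU2, hU3⟩
  · rw [← hτ x, mem_ultraVS]; rfl
  · rw [← hW0 φ]
    ext e
    simp only [ValuationSubring.mem_comap]
    change τ (algebraMap _ Ω e) ∈ W0 φ ↔ _
    rw [τ.commutes]

theorem lift_h [IsAlgClosed Ω] (z : ι → Ω)
    [Algebra.IsAlgebraic (adjoin κ (Set.range z)) Ω] (M : ℕ) (r φ : ι → ℕ)
    (hr : ∀ i, φ i ≡ r i [MOD M]) (ζ : κ) (hζ0 : ζ ≠ 0) (hζ : ζ ^ M = 1)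
    (g : Ω ≃ₐ[κ] Ω) (hg : ∀ i, g (z i) = algebraMap κ Ω (ζ ^ r i) * z i)
    (Wφ : ValuationSubring Ω) (θ : adjoin κ (Set.range z) →ₐ[κ] RatFunc Ω)
    (hθ : ∀ i, θ ⟨z i, subset_adjoin _ _ ⟨i, rfl⟩⟩
          = algebraMap Ω (RatFunc Ω) (z i) * RatFunc.X ^ φ i)
    (hWφ : Wφ.comap (algebraMap (adjoin κ (Set.range z)) Ω) = (Ot Ω).comap (θ : _ →+* _)) :
    ∃ h : Ω ≃ₐ[κ] Ω, Inr Wφ h ∧ ∀ e ∈ adjoin κ (Set.range z), h e = g e := by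
  have hmap : (adjoin κ (Set.range z)).map (g : Ω →ₐ[κ] Ω) = (adjoin κ (Set.range z)) := by
    rw [IntermediateField.adjoin_map]
    apply le_antisymm
    · rw [adjoin_le_iff]
      rintro _ ⟨_, ⟨i, rfl⟩, rfl⟩
      change g (z i) ∈ _
      rw [hg]
      exact mul_mem (IntermediateField.algebraMap_mem _ _) (subset_adjoin _ _ ⟨i, rfl⟩)
    · rw [adjoin_le_iff]
      rintro _ ⟨i, rfl⟩
      have h1 : z i = algebraMap κ Ω (ζ ^ r i)⁻¹ * g (z i) := by
        rw [hg, ← mul_assoc, ← map_mul, inv_mul_cancel₀ (pow_ne_zero _ hζ0), map_one, one_mul]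
      rw [h1]
      exact mul_mem (IntermediateField.algebraMap_mem _ _) (subset_adjoin _ _ ⟨_, ⟨i, rfl⟩, rfl⟩)
  let gE : (adjoin κ (Set.range z)) ≃ₐ[κ] (adjoin κ (Set.range z)) := (IntermediateField.intermediateFieldMap g (adjoin κ (Set.range z))).trans
    (IntermediateField.equivOfEq hmap)
  have hgE : ∀ e : (adjoin κ (Set.range z)), ((gE e : (adjoin κ (Set.range z))) : Ω) = g e := fun e => rfl
  obtain ⟨ψ, hψX, hψ⟩ := exists_psi (algebraMap κ Ω ζ) (by simpa using hζ0)
  have hcomm : (θ.comp (gE : (adjoin κ (Set.range z)) →ₐ[κ] (adjoin κ (Set.range z)))) = (ψ.restrictScalars κ).comp θ := by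
    apply adjoin_algHom_ext κ
    rintro _ ⟨i, rfl⟩
    have e1 : gE ⟨z i, subset_adjoin _ _ ⟨i, rfl⟩⟩
        = algebraMap κ _ (ζ ^ r i) * ⟨z i, subset_adjoin _ _ ⟨i, rfl⟩⟩ := Subtype.ext (hg i)
    change θ (gE ⟨z i, subset_adjoin _ _ ⟨i, rfl⟩⟩) = ψ (θ ⟨z i, subset_adjoin _ _ ⟨i, rfl⟩⟩)
    rw [e1, map_mul, AlgHom.commutes, hθ, map_mul, AlgHom.commutes, map_pow ψ, hψX, mul_pow]
    have e2 : ζ ^ r i = ζ ^ φ i := (pow_eq_pow_of_modEq (hr i) hζ).symm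
    rw [e2, IsScalarTower.algebraMap_apply κ Ω (RatFunc Ω), map_pow, map_pow]
    ring
  obtain ⟨h, hh1, hh2⟩ := lift_gen (E := (adjoin κ (Set.range z))) Wφ (gE : (adjoin κ (Set.range z)) ≃+* (adjoin κ (Set.range z))) (by
    rw [hWφ]
    exact Inr_comap (Ot Ω) (θ : (adjoin κ (Set.range z)) →+* RatFunc Ω) _ ψ
      (fun x => congrArg (fun f => f x) hcomm) (Ot_inr ψ hψ))
  refine ⟨AlgEquiv.ofRingEquiv (f := h) ?_, hh1, ?_⟩
  · intro c
    have := hh2 (algebraMap κ (adjoin κ (Set.range z)) c)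
    rw [← IsScalarTower.algebraMap_apply] at this
    rw [this]
    change ((gE (algebraMap κ (adjoin κ (Set.range z)) c) : (adjoin κ (Set.range z))) : Ω) = _
    rw [gE.commutes]; rfl
  · intro e he
    exact hh2 ⟨e, he⟩
end LimFam

section OneU
variable {Ω : Type*} [Field Ω]

def OneU (W : ValuationSubring Ω) (x : Ω) : Prop := W.valuation (x - 1) < 1

theorem OneU.val {W : ValuationSubring Ω} {x : Ω} (h : OneU W x) : W.valuation x = 1 := by
  have e : x = 1 + (x - 1) := by ring
  rw [e, Valuation.map_add_eq_of_lt_left _ (by rw [map_one]; exact h), map_one]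

theorem OneU.ne {W : ValuationSubring Ω} {x : Ω} (h : OneU W x) : x ≠ 0 := by
  rintro rfl
  have := h.val
  simp at this

theorem OneU.mul {W : ValuationSubring Ω} {x y : Ω} (hx : OneU W x) (hy : OneU W y) :
    OneU W (x * y) := by
  have e : x * y - 1 = x * (y - 1) + (x - 1) := by ring
  unfold OneU
  rw [e]
  refine lt_of_le_of_lt (W.valuation.map_add _ _) (max_lt ?_ hx)
  rw [map_mul, hx.val, one_mul]; exact hy

theorem OneU.inv {W : ValuationSubring Ω} {x : Ω} (hx : OneU W x) : OneU W x⁻¹ := by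
  have e : x⁻¹ - 1 = - (x⁻¹ * (x - 1)) := by
    have := hx.ne
    field_simp
    ring
  unfold OneU
  rw [e, Valuation.map_neg, map_mul, map_inv₀, hx.val, inv_one, one_mul]; exact hx

theorem OneU.one (W : ValuationSubring Ω) : OneU W 1 := by
  unfold OneU; simp

theorem OneU.pow {W : ValuationSubring Ω} {x : Ω} (hx : OneU W x) (n : ℕ) : OneU W (x ^ n) := by
  induction n with
  | zero => rw [pow_zero]; exact OneU.one W
  | succ n ih => rw [pow_succ]; exact ih.mul hx

theorem OneU.div {W : ValuationSubring Ω} {x y : Ω} (hx : OneU W x) (hy : OneU W y) :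
    OneU W (x / y) := by
  rw [div_eq_mul_inv]; exact hx.mul hy.inv

theorem OneU.zpow {W : ValuationSubring Ω} {x : Ω} (hx : OneU W x) (n : ℤ) : OneU W (x ^ n) := by
  cases n with
  | ofNat n => rw [Int.ofNat_eq_natCast, zpow_natCast]; exact hx.pow n
  | negSucc n => rw [zpow_negSucc]; exact (hx.pow _).inv

theorem OneU.of_coprime {W : ValuationSubring Ω} {x : Ω} (h0 : x ≠ 0) {m n : ℕ}
    (hmn : Nat.Coprime m n) (hm : OneU W (x ^ m)) (hn : OneU W (x ^ n)) : OneU W x := by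
  have hb := Nat.gcd_eq_gcd_ab m n
  rw [hmn.gcd_eq_one] at hb
  have : x = (x ^ m) ^ (m.gcdA n) * (x ^ n) ^ (m.gcdB n) := by
    rw [← zpow_natCast, ← zpow_natCast, ← zpow_mul, ← zpow_mul, ← zpow_add₀ h0, ← hb]; simp
  rw [this]
  exact (hm.zpow _).mul (hn.zpow _)

theorem OneU_of_ev {I : Type*} (U : Ultrafilter I) (Wf : I → ValuationSubring Ω)
    (W : ValuationSubring Ω) (hW : ∀ x, x ∈ W ↔ ∀ᶠ i in (U : Filter I), x ∈ Wf i) (y : Ω)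
    (h : ∀ᶠ i in (U : Filter I), OneU (Wf i) y) : OneU W y := by
  unfold OneU at *
  rw [val_lt_one_iff']
  simp only [val_lt_one_iff'] at h
  refine ⟨(hW _).mpr (h.mono fun i hi => hi.1), ?_⟩
  by_cases h0 : y - 1 = 0
  · exact Or.inl h0
  right
  intro hmem
  have := (h.and ((hW _).mp hmem)).exists
  obtain ⟨i, hi, hi2⟩ := this
  exact (hi.2.resolve_left h0) hi2

theorem Inr.unit {W : ValuationSubring Ω} {g : Ω → Ω} (hg : Inr W g) {d : Ω}
    (hd : W.valuation d = 1) : OneU W (g d / d) := by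
  have h1 := hg.2 d ((W.valuation_le_one_iff _).mp hd.le)
  have h0 : d ≠ 0 := by rintro rfl; simp at hd
  unfold OneU
  rw [div_sub_one h0, map_div₀, hd, div_one]; exact h1

theorem cmpA {W : ValuationSubring Ω} {g : Ω →+* Ω} (hg : Inr W g) (c d P ε : Ω) (m : ℕ)
    (hcd : c ^ m = d * P) (hd : W.valuation d = 1) (hP : P ≠ 0) (hε : ε ≠ 0) (hgP : g P = ε * P) :
    OneU W ((g c / c) ^ m / ε) := by
  have h0 : d ≠ 0 := by rintro rfl; simp at hd
  have : (g c / c) ^ m / ε = g d / d := by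
    rw [div_pow, ← map_pow, hcd, map_mul, hgP]
    field_simp
  rw [this]
  exact hg.unit hd

theorem OneU.map {W : ValuationSubring Ω} {g : Ω →+* Ω} (hg : Inr W g) {u : Ω} (hu : OneU W u) :
    OneU W (g u) := by
  have h := hg.unit hu.val
  have e : g u = (g u / u) * u := by have := hu.ne; field_simp
  rw [e]
  exact h.mul hu

theorem cmpB {W : ValuationSubring Ω} {g : Ω →+* Ω} (hg : Inr W g) (c : Ω) (hc : c ≠ 0)
    (hq : W.valuation (g c / c) = 1) (N : ℕ) (hN : g^[N] c = c) :
    OneU W ((g c / c) ^ N) := by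
  have hq0 : g c / c ≠ 0 := by intro h; rw [h] at hq; simp at hq
  have key : ∀ k, OneU W ((g^[k] c / c) / (g c / c) ^ k) := by
    intro k
    induction k with
    | zero => simp [hc, OneU.one]
    | succ k ih =>
      have h1 := ih.map hg
      have h2 := (hg.unit hq).pow k
      have h3 := h1.mul h2
      have e : g^[k+1] c / c / (g c / c) ^ (k+1)
          = g (g^[k] c / c / (g c / c) ^ k) * (g (g c / c) / (g c / c)) ^ k := by
        rw [Function.iterate_succ_apply', map_div₀, map_div₀, map_pow, div_pow (g (g c / c))]
        have a1 : g (g c / c) ≠ 0 := by simpa using hq0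
        have a2 : g c ≠ 0 := by simpa using hc
        rw [pow_succ]
        generalize g (g c / c) = X at *
        field_simp
      rw [e]; exact h3
  have := key N
  rw [hN, div_self hc, one_div] at this
  simpa using this.inv
end OneU

section Core
open IntermediateField MvPolynomial
variable {κ Ω ι : Type*} [Field κ] [Field Ω] [Algebra κ Ω] [Fintype ι]

theorem F_val (W : ValuationSubring Ω) (hW : ∀ c : κ, algebraMap κ Ω c ∈ W)
    (z : ι → Ω) (hz : MIndep W z) (e : Ω) (he : e ∈ adjoin κ (Set.range z)) (he0 : e ≠ 0) :
    ∃ a : ι → ℤ, W.valuation e = W.valuation (∏ i, z i ^ a i) := by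
  obtain ⟨P, Q, hPQ⟩ := (IntermediateField.mem_adjoin_range_iff κ z e).mp he
  have hP : P ≠ 0 := by rintro rfl; simp at hPQ; exact he0 hPQ
  have hQ : Q ≠ 0 := by rintro rfl; simp at hPQ; exact he0 hPQ
  obtain ⟨a, _, _, ha1⟩ := mono_exists W hW z hz P hP
  obtain ⟨b, _, _, hb1⟩ := mono_exists W hW z hz Q hQ
  refine ⟨fun i => (a i : ℤ) - (b i : ℤ), ?_⟩
  rw [prod_zpow_sub z hz.1, hPQ, map_div₀, map_div₀, ha1, hb1]

theorem coe_pow_alg {R A : Type*} [CommSemiring R] [Semiring A] [Algebra R A] (g : A ≃ₐ[R] A)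
    (n : ℕ) (x : A) : (g ^ n) x = g^[n] x := by
  induction n generalizing x with
  | zero => rfl
  | succ n ih => rw [pow_succ, Function.iterate_succ_apply, ← ih]; rfl

theorem pow_of_mod {R A : Type*} [CommSemiring R] [Semiring A] [Algebra R A] (g : A ≃ₐ[R] A)
    (n j : ℕ) (x : A) (h : (g ^ n) x = x) (hj : j ≡ 1 [MOD n]) : (g ^ j) x = g x := by
  rw [coe_pow_alg] at *
  have hp : Function.IsPeriodicPt g n x := h
  have h1 := hp.iterate_mod_apply j
  have h2 := hp.iterate_mod_apply 1
  rw [← h1, hj, h2]; rfl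

theorem Inr_pow {F : Type*} [Field F] [Algebra F Ω] {W : ValuationSubring Ω} {g : Ω ≃ₐ[F] Ω}
    (hg : Inr W g) (n : ℕ) : Inr W (g ^ n : Ω ≃ₐ[F] Ω) := by
  induction n with
  | zero => exact ⟨fun x => Iff.rfl, fun x hx => by simp⟩
  | succ n ih =>
    refine ⟨fun x => ?_, fun x hx => ?_⟩
    · rw [pow_succ]; exact (ih.1 (g x)).trans (hg.1 x)
    · have h1 := ih.2 (g x) ((hg.1 x).mpr hx)
      have h2 := hg.2 x hx
      have e : (g ^ (n + 1)) x - x = ((g ^ n) (g x) - g x) + (g x - x) := by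
        rw [pow_succ]; change (g ^ n) (g x) - x = _; ring
      rw [e]
      exact lt_of_le_of_lt (W.valuation.map_add _ _) (max_lt h1 h2)
end Core

section Core
open IntermediateField MvPolynomial
variable {κ Ω ι : Type*} [Field κ] [Field Ω] [Algebra κ Ω] [Fintype ι]

theorem core1 [IsAlgClosed κ] [IsAlgClosed Ω] (ℓ : ℕ) [hl : Fact ℓ.Prime] (hℓ : (ℓ : κ) ≠ 0)
    (W : ValuationSubring Ω) (hW : ∀ c : κ, algebraMap κ Ω c ∈ W)
    (x : ι → Ω) (hx : MIndep W x) (hlt : ∀ i, W.valuation (x i) < 1)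
    [Algebra.IsAlgebraic (adjoin κ (Set.range x)) Ω]
    (g : Ω ≃ₐ[adjoin κ (Set.range x)] Ω) (hg : Inr W g)
    (N : IntermediateField (adjoin κ (Set.range x)) Ω)
    [FiniteDimensional (adjoin κ (Set.range x)) N] [Normal (adjoin κ (Set.range x)) N]
    (b : ℕ) (hb : ∀ n ∈ N, (g ^ ℓ ^ b) n = n) :
    ∃ (φ : ι → ℕ) (W' : ValuationSubring Ω) (h : Ω ≃ₐ[adjoin κ (Set.range x)] Ω)
      (θ : adjoin κ (Set.range x) →ₐ[κ] RatFunc Ω),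
      (∀ i, 0 < φ i) ∧ Inr W' h ∧ (∀ n ∈ N, h n = g n) ∧
      (∀ i, θ ⟨x i, subset_adjoin _ _ ⟨i, rfl⟩⟩
          = algebraMap Ω (RatFunc Ω) (x i) * RatFunc.X ^ φ i) ∧
      W'.comap (algebraMap (adjoin κ (Set.range x)) Ω) = (Ot Ω).comap (θ : _ →+* _) := by
  set n := Module.finrank (adjoin κ (Set.range x)) N with hn
  obtain ⟨a, m, hm, hnam⟩ := Nat.exists_eq_pow_mul_and_not_dvd n.factorial_ne_zero ℓ hl.out.ne_one
  have hMpos : 0 < ℓ ^ a := pow_pos hl.out.pos _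
  choose z hzx using fun i => IsAlgClosed.exists_pow_nat_eq (x i) hMpos
  have hz : MIndep W z := by
    refine ⟨fun i h => hx.1 i (by rw [← hzx, h, zero_pow hMpos.ne']), fun e he => ?_⟩
    apply hx.2
    have : ∏ i, x i ^ e i = (∏ i, z i ^ e i) ^ ℓ ^ a := by
      rw [← Finset.prod_pow]
      refine Finset.prod_congr rfl fun i _ => ?_
      rw [← hzx, ← zpow_natCast, ← zpow_natCast, ← zpow_mul, ← zpow_mul, mul_comm]
    rw [this, map_pow, he, one_pow]
  have hzlt : ∀ i, W.valuation (z i) < 1 := fun i => by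
    rw [← val_pow_lt W hMpos.ne', hzx]; exact hlt i
  have hFE : adjoin κ (Set.range x) ≤ adjoin κ (Set.range z) := by
    rw [adjoin_le_iff]
    rintro _ ⟨i, rfl⟩
    change x i ∈ adjoin κ (Set.range z)
    rw [← hzx]
    exact pow_mem (subset_adjoin κ (Set.range z) (Set.mem_range_self i)) _
  haveI hEalg : Algebra.IsAlgebraic (adjoin κ (Set.range z)) Ω := by
    refine ⟨fun y => ?_⟩
    obtain ⟨p, hp0, hp⟩ := Algebra.IsAlgebraic.isAlgebraic (R := adjoin κ (Set.range x)) y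
    refine ⟨p.map (IntermediateField.inclusion hFE).toRingHom, ?_, ?_⟩
    · rw [ne_eq, Polynomial.map_eq_zero]; exact hp0
    · rw [Polynomial.aeval_def, Polynomial.eval₂_map]; exact hp
  -- roots of unity
  have hne : NeZero ((ℓ ^ a : ℕ) : κ) := ⟨by push_cast; exact pow_ne_zero _ hℓ⟩
  obtain ⟨ζ, hζ⟩ := HasEnoughRootsOfUnity.exists_primitiveRoot κ (ℓ ^ a)
  have hζ0 : ζ ≠ 0 := hζ.ne_zero hMpos.ne'
  have hζΩ : IsPrimitiveRoot (algebraMap κ Ω ζ) (ℓ ^ a) :=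
    hζ.map_of_injective (algebraMap κ Ω).injective
  haveI : NeZero (ℓ ^ a) := ⟨hMpos.ne'⟩
  have hgx : ∀ i, g (x i) = x i := fun i => g.commutes ⟨x i, subset_adjoin _ _ ⟨i, rfl⟩⟩
  have hr : ∀ i, ∃ r : ℕ, g (z i) = algebraMap κ Ω (ζ ^ r) * z i := by
    intro i
    have h1 : (g (z i) / z i) ^ ℓ ^ a = 1 := by
      rw [div_pow, ← map_pow, hzx, hgx, div_self (hx.1 i)]
    obtain ⟨r, _, hr⟩ := hζΩ.eq_pow_of_pow_eq_one h1
    refine ⟨r, ?_⟩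
    rw [map_pow, hr, div_mul_cancel₀ _ (hz.1 i)]
  choose r hr using hr
  obtain ⟨U, Wf, hU, hWf, hUr, hUpos⟩ := lim_family W hW z hz hzlt (ℓ ^ a) hMpos r
  -- good φ
  have hex : ∀ φ : ι → ℕ, ∃ h : Ω ≃ₐ[adjoin κ (Set.range x)] Ω, (∀ i, φ i ≡ r i [MOD ℓ ^ a]) →
      Inr (Wf φ) h ∧ (∀ i, h (z i) = algebraMap κ Ω (ζ ^ r i) * z i) ∧
      ∃ b, (AlgEquiv.restrictNormalHom N h) ^ ℓ ^ b = 1 := by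
    intro φ
    by_cases hφ : ∀ i, φ i ≡ r i [MOD ℓ ^ a]
    swap
    · exact ⟨1, fun h => absurd h hφ⟩
    obtain ⟨θ, hθ, hθ2⟩ := hWf φ
    obtain ⟨h, hh1, hh2⟩ := lift_h z (ℓ ^ a) r φ hφ ζ hζ0 hζ.pow_eq_one (g.restrictScalars κ) hr
      (Wf φ) θ hθ hθ2
    let h1 : Ω ≃ₐ[adjoin κ (Set.range x)] Ω := AlgEquiv.ofRingEquiv (f := (h : Ω ≃+* Ω))
      (fun f => by
        change h f.1 = f.1
        rw [hh2 _ (hFE f.2)]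
        exact g.commutes f)
    have hh1z : ∀ i, h1 (z i) = algebraMap κ Ω (ζ ^ r i) * z i := fun i => by
      rw [← hr i]
      exact hh2 _ (subset_adjoin _ _ ⟨i, rfl⟩)
    obtain ⟨j, b, hj, hj2⟩ := exists_pow_ell ℓ hl.out (AlgEquiv.restrictNormalHom N h1) a
    refine ⟨h1 ^ j, fun _ => ⟨Inr_pow (g := h1) hh1 j, fun i => ?_, b, by rw [map_pow]; exact hj⟩⟩
    rw [← hh1z i]
    refine pow_of_mod h1 (ℓ ^ a) j (z i) ?_ hj2
    have hk : ∀ k, (h1 ^ k) (z i) = algebraMap κ Ω (ζ ^ (r i * k)) * z i := by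
      intro k
      induction k with
      | zero => simp
      | succ k ih =>
        rw [pow_succ']
        change h1 ((h1 ^ k) (z i)) = _
        rw [ih, map_mul, hh1z]
        have : h1 (algebraMap κ Ω (ζ ^ (r i * k))) = algebraMap κ Ω (ζ ^ (r i * k)) :=
          h1.commutes (algebraMap κ _ (ζ ^ (r i * k)))
        rw [this, ← mul_assoc, ← map_mul, ← pow_add]
        rfl
    rw [hk, mul_comm (r i), pow_mul, hζ.pow_eq_one, one_pow, map_one, one_mul]
  choose hh hhex using hex
  -- constant η
  obtain ⟨η, hη⟩ : ∃ η, ∀ᶠ φ in (U : Filter (ι → ℕ)), AlgEquiv.restrictNormalHom N (hh φ) = η := by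
    rw [← Ultrafilter.eventually_exists_iff]
    exact Filter.Eventually.of_forall fun φ => ⟨_, rfl⟩
  have hηN : ∀ φ, AlgEquiv.restrictNormalHom N (hh φ) = η → ∀ y : N, hh φ y = (η y : N) := by
    intro φ hφ y
    rw [← hφ]
    exact (AlgEquiv.restrictNormal_commutes (hh φ) N y).symm
  have hgN : ∀ y : N, g y = ((AlgEquiv.restrictNormalHom N g) y : N) := fun y =>
    (AlgEquiv.restrictNormal_commutes g N y).symm
  obtain ⟨φ0, hφ0r, hφ0η, hφ0p⟩ := (hUr.and (hη.and hUpos)).exists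
  obtain ⟨b', hb'⟩ := (hhex φ0 hφ0r).2.2
  rw [hφ0η] at hb'
  have hconst : ∀ φ, AlgEquiv.restrictNormalHom N (hh φ) = η → ∀ y : N,
      (hh φ ^ ℓ ^ b') (y : Ω) = y := by
    intro φ hφ y
    have h1 : AlgEquiv.restrictNormalHom N (hh φ ^ ℓ ^ b') = 1 := by rw [map_pow, hφ, hb']
    have h2 := AlgEquiv.restrictNormal_commutes (hh φ ^ ℓ ^ b') N y
    have h3 : AlgEquiv.restrictNormal (hh φ ^ ℓ ^ b') N = 1 := h1
    rw [h3] at h2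
    exact h2.symm
  have hg0 : (AlgEquiv.restrictNormalHom N g) ^ ℓ ^ b = 1 := by
    rw [← map_pow]
    ext y
    have := AlgEquiv.restrictNormal_commutes (g ^ ℓ ^ b) N y
    exact this.trans (hb y.1 y.2)
  -- key comparison
  have key : ∀ c : N, c ≠ 0 → OneU W ((η c : N) / g c : Ω) ∧ W.valuation (g c / c) = 1 := by
    intro c hc
    have hcΩ : (c : Ω) ≠ 0 := by simpa using hc
    obtain ⟨f, hf0, hf⟩ := val_torsion W N (c : Ω) c.2 hcΩ
    rw [← hn, hnam] at hf
    obtain ⟨e, he⟩ := F_val W hW x hx f.1 f.2 (by simpa using hf0)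
    set P : Ω := ∏ i, z i ^ e i with hP
    have hP0 : P ≠ 0 := Finset.prod_ne_zero_iff.mpr fun i _ => zpow_ne_zero _ (hz.1 i)
    have hPx : P ^ ℓ ^ a = ∏ i, x i ^ e i := by
      rw [hP, ← Finset.prod_pow]
      refine Finset.prod_congr rfl fun i _ => ?_
      rw [← hzx, ← zpow_natCast, ← zpow_natCast, ← zpow_mul, ← zpow_mul, mul_comm]
    have hd : W.valuation ((c : Ω) ^ m / P) = 1 := by
      have h1 : W.valuation ((c : Ω) ^ m / P) ^ ℓ ^ a = 1 := by
        rw [← map_pow, div_pow, hPx, ← pow_mul, mul_comm m, map_div₀, hf]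
        change W.valuation f.1 / _ = 1
        rw [he, div_self]
        rw [← he]; simpa using hf0
      exact (pow_eq_one_iff_of_nonneg zero_le hMpos.ne').mp h1
    set ε : κ := ∏ i, (ζ ^ r i) ^ e i with hε
    have hε0 : algebraMap κ Ω ε ≠ 0 := by
      simp only [ne_eq, map_eq_zero]
      exact Finset.prod_ne_zero_iff.mpr fun i _ => zpow_ne_zero _ (pow_ne_zero _ hζ0)
    have hactP : ∀ σ : Ω ≃ₐ[adjoin κ (Set.range x)] Ω,
        (∀ i, σ (z i) = algebraMap κ Ω (ζ ^ r i) * z i) → σ P = algebraMap κ Ω ε * P := by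
      intro σ hσ
      rw [hP, hε, map_prod, map_prod, ← Finset.prod_mul_distrib]
      refine Finset.prod_congr rfl fun i _ => ?_
      rw [map_zpow₀, hσ, mul_zpow, map_zpow₀]
    have hcm : (c : Ω) ^ m = ((c : Ω) ^ m / P) * P := (div_mul_cancel₀ _ hP0).symm
    -- generic claim
    have gen : ∀ (W1 : ValuationSubring Ω) (hW1 : ∀ c : κ, algebraMap κ Ω c ∈ W1)
        (σ : Ω ≃ₐ[adjoin κ (Set.range x)] Ω), Inr W1 σ → W1.valuation ((c : Ω) ^ m / P) = 1 →
        (∀ i, σ (z i) = algebraMap κ Ω (ζ ^ r i) * z i) → ∀ B : ℕ, (σ ^ ℓ ^ B) (c : Ω) = c →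
        OneU W1 ((σ c / c) ^ m / algebraMap κ Ω ε) ∧ OneU W1 ((σ c / c) ^ ℓ ^ B) := by
      intro W1 hW1 σ hσ hd1 hσz B hB
      have h1 : OneU W1 ((σ c / c) ^ m / algebraMap κ Ω ε) :=
        cmpA (g := (σ : Ω →+* Ω)) hσ c _ P _ m hcm hd1 hP0 hε0 (hactP σ hσz)
      refine ⟨h1, ?_⟩
      have hm0 : m ≠ 0 := by rintro rfl; exact hm (dvd_zero _)
      have h2 := h1.val
      rw [map_div₀, val_const W1 hW1 ε (by simpa using hε0), div_one, map_pow,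
        pow_eq_one_iff_of_nonneg zero_le hm0] at h2
      refine cmpB (g := (σ : Ω →+* Ω)) hσ c hcΩ h2 _ ?_
      rw [coe_pow_alg] at hB
      exact hB
    have hg1 := gen W hW g hg hd hr b (hb _ c.2)
    have hη1 : OneU W (((η c : N) / c : Ω) ^ m / algebraMap κ Ω ε) ∧
        OneU W (((η c : N) / c : Ω) ^ ℓ ^ b') := by
      have hev : ∀ᶠ φ in (U : Filter (ι → ℕ)),
          OneU (Wf φ) (((η c : N) / c : Ω) ^ m / algebraMap κ Ω ε) ∧
          OneU (Wf φ) (((η c : N) / c : Ω) ^ ℓ ^ b') := by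
        have hd1 : (c : Ω) ^ m / P ∈ W := (W.valuation_le_one_iff _).mp hd.le
        have hd2 : ((c : Ω) ^ m / P)⁻¹ ∈ W := (W.valuation_le_one_iff _).mp
          (by rw [map_inv₀, hd, inv_one])
        filter_upwards [hη, hUr, (hU _).mp hd1, (hU _).mp hd2] with φ h1 h2 h3 h4
        have hW1 : ∀ c : κ, algebraMap κ Ω c ∈ Wf φ := by
          intro c
          obtain ⟨θ, hθ, hθ2⟩ := hWf φ
          have : algebraMap κ (adjoin κ (Set.range z)) c ∈
              (Wf φ).comap (algebraMap (adjoin κ (Set.range z)) Ω) := by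
            rw [hθ2, ValuationSubring.mem_comap, mem_Ot]
            change vt Ω (θ (algebraMap κ _ c)) ≤ 1
            rw [θ.commutes, IsScalarTower.algebraMap_apply κ Ω (RatFunc Ω)]
            exact vt_const_le _
          exact this
        have hv : (Wf φ).valuation ((c : Ω) ^ m / P) = 1 := by
          apply le_antisymm (((Wf φ).valuation_le_one_iff _).mpr h3)
          have := ((Wf φ).valuation_le_one_iff _).mpr h4
          rw [map_inv₀] at this
          rw [inv_le_one₀] at this
          · exact this
          · rw [zero_lt_iff, ne_eq, Valuation.zero_iff]
            exact div_ne_zero (pow_ne_zero _ hcΩ) hP0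
        have := gen (Wf φ) hW1 (hh φ) (hhex φ h2).1 hv (hhex φ h2).2.1 b' (hconst φ h1 c)
        rw [hηN φ h1] at this
        exact this
      exact ⟨OneU_of_ev U Wf W hU _ (hev.mono fun _ h => h.1),
        OneU_of_ev U Wf W hU _ (hev.mono fun _ h => h.2)⟩
    have hgc : g c ≠ 0 := by simpa using hcΩ
    have hηc : ((η c : N) : Ω) ≠ 0 := by simpa using hc
    have e1 : ((η c : N) / g c : Ω) = ((η c : N) / c : Ω) / (g c / c) := by field_simp
    refine ⟨?_, by
      have := hg1.2.val
      rwa [map_pow, pow_eq_one_iff_of_nonneg zero_le (pow_pos hl.out.pos _).ne'] at this⟩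
    apply OneU.of_coprime (div_ne_zero hηc hgc) (m := m) (n := ℓ ^ (b + b'))
    · exact ((Nat.Prime.coprime_iff_not_dvd hl.out).mpr hm).symm.pow_right _
    · have := hη1.1.div hg1.1
      rw [div_div_div_cancel_right₀ hε0, ← div_pow, ← e1] at this
      exact this
    · rw [e1, div_pow]
      apply OneU.div
      · rw [pow_add, mul_comm, pow_mul]; exact hη1.2.pow _
      · rw [pow_add, pow_mul]; exact hg1.2.pow _
  -- stabilizers
  let W0 := W.comap (algebraMap N Ω)
  have hηst : ∀ y : N, η y ∈ W0 ↔ y ∈ W0 := by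
    intro y
    change ((η y : N) : Ω) ∈ W ↔ (y : Ω) ∈ W
    rw [hU, hU]
    have : ∀ᶠ φ in (U : Filter (ι → ℕ)), (((η y : N) : Ω) ∈ Wf φ ↔ (y : Ω) ∈ Wf φ) := by
      filter_upwards [hη, hUr] with φ h1 h2
      rw [← hηN φ h1]
      exact (hhex φ h2).1.1 y
    exact Filter.eventually_congr this
  have hgst : ∀ y : N, (AlgEquiv.restrictNormalHom N g) y ∈ W0 ↔ y ∈ W0 := by
    intro y
    change (((AlgEquiv.restrictNormalHom N g) y : N) : Ω) ∈ W ↔ (y : Ω) ∈ W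
    rw [← hgN]
    exact hg.1 y
  have hvℓ : W0.valuation ((ℓ : ℕ) : N) = 1 := by
    have h1 : ∀ c : κ, algebraMap κ N c ∈ W0 := fun c => hW c
    have := val_const W0 h1 (ℓ : κ) hℓ
    rwa [map_natCast] at this
  obtain ⟨ρ, j, hρ⟩ := tame_conj W0 ℓ hvℓ (AlgEquiv.restrictNormalHom N g) η hgst hηst b b' hg0 hb' (by
    intro c hc
    have h1 := key c hc
    have hcv : W0.valuation c ≠ 0 := by simpa using hc
    rw [← div_lt_one₀ (zero_lt_iff.mpr hcv), ← map_div₀]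
    rw [val_lt_one_comap]
    have e2 : algebraMap N Ω ((η c - AlgEquiv.restrictNormalHom N g c) / c)
        = ((η c : N) / g c - 1 : Ω) * (g c / c) := by
      rw [map_div₀, map_sub]
      change (((η c : N) : Ω) - ((AlgEquiv.restrictNormalHom N g c : N) : Ω)) / (c : Ω) = _
      rw [← hgN]
      have hcΩ : (c : Ω) ≠ 0 := by simpa using hc
      have hgc : g c ≠ 0 := by simpa using hcΩ
      field_simp
    rw [e2, map_mul, h1.2, mul_one]
    exact h1.1)
  haveI : IsAlgClosure (adjoin κ (Set.range x)) Ω := ⟨inferInstance, inferInstance⟩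
  haveI : Normal (adjoin κ (Set.range x)) Ω := IsAlgClosure.normal _ _
  obtain ⟨R, hR⟩ := AlgEquiv.restrictNormalHom_surjective (F := adjoin κ (Set.range x)) (K₁ := N) Ω ρ
  obtain ⟨θ, hθ, hθ2⟩ := hWf φ0
  refine ⟨fun i => φ0 i * ℓ ^ a, (Wf φ0).comap (R⁻¹ : Ω ≃ₐ[adjoin κ (Set.range x)] Ω).toRingEquiv.toRingHom,
    R * hh φ0 ^ j * R⁻¹, θ.comp (IntermediateField.inclusion hFE), fun i => Nat.mul_pos (hφ0p i) hMpos,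
    ?_, ?_, ?_, ?_⟩
  · refine Inr_comap (Wf φ0) _ _ (hh φ0 ^ j : Ω ≃ₐ[adjoin κ (Set.range x)] Ω) ?_
      (Inr_pow (hhex φ0 hφ0r).1 j)
    intro y
    change R⁻¹ (R ((hh φ0 ^ j) (R⁻¹ y))) = (hh φ0 ^ j) (R⁻¹ y)
    exact R.symm_apply_apply _
  · intro y hy
    have h1 : AlgEquiv.restrictNormalHom N (R * hh φ0 ^ j * R⁻¹) = AlgEquiv.restrictNormalHom N g := by
      rw [map_mul, map_mul, map_pow, map_inv, hR, hφ0η, hρ]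
    have h2 := AlgEquiv.restrictNormal_commutes (R * hh φ0 ^ j * R⁻¹) N ⟨y, hy⟩
    have h3 : AlgEquiv.restrictNormal (R * hh φ0 ^ j * R⁻¹) N = AlgEquiv.restrictNormalHom N g := h1
    rw [h3] at h2
    exact h2.symm.trans (hgN ⟨y, hy⟩).symm
  · intro i
    have e : IntermediateField.inclusion hFE ⟨x i, subset_adjoin _ _ ⟨i, rfl⟩⟩
        = (⟨z i, subset_adjoin _ _ ⟨i, rfl⟩⟩ : adjoin κ (Set.range z)) ^ ℓ ^ a :=
      Subtype.ext (hzx i).symm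
    change θ (IntermediateField.inclusion hFE ⟨x i, subset_adjoin _ _ ⟨i, rfl⟩⟩) = _
    rw [e, map_pow, hθ, mul_pow, ← map_pow, hzx, ← pow_mul]
  · ext f
    have h1 : (IntermediateField.inclusion hFE f) ∈
        (Wf φ0).comap (algebraMap (adjoin κ (Set.range z)) Ω) ↔
        (IntermediateField.inclusion hFE f) ∈ (Ot Ω).comap (θ : _ →+* _) := by rw [hθ2]
    refine Iff.trans ?_ h1
    change (R⁻¹ : Ω ≃ₐ[adjoin κ (Set.range x)] Ω) (algebraMap _ Ω f) ∈ Wf φ0 ↔ _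
    rw [AlgEquiv.commutes]
    rfl
end Core

section Core2
open IntermediateField MvPolynomial
variable {κ Ω : Type*} [Field κ] [Field Ω] [Algebra κ Ω]

theorem core2 {ι : Type*} [Fintype ι] [IsAlgClosed κ] [IsAlgClosed Ω] (ℓ : ℕ) [hl : Fact ℓ.Prime]
    (hℓ : (ℓ : κ) ≠ 0)
    (W : ValuationSubring Ω) (hW : ∀ c : κ, algebraMap κ Ω c ∈ W)
    (x : ι → Ω) (hx : MIndep W x) (hlt : ∀ i, W.valuation (x i) < 1)
    [Algebra.IsAlgebraic (adjoin κ (Set.range x)) Ω]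
    (g : Ω ≃ₐ[adjoin κ (Set.range x)] Ω) (hg : Inr W g)
    (S : Set Ω) (hS : S.Finite) (c : ℕ) (hc : ∀ s ∈ S, (g ^ ℓ ^ c) s = s) :
    ∃ (φ : ι → ℕ) (W' : ValuationSubring Ω) (h : Ω ≃ₐ[adjoin κ (Set.range x)] Ω)
      (θ : adjoin κ (Set.range x) →ₐ[κ] RatFunc Ω),
      (∀ i, 0 < φ i) ∧ Inr W' h ∧ (∀ s ∈ S, h s = g s) ∧
      (∀ i, θ ⟨x i, subset_adjoin _ _ ⟨i, rfl⟩⟩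
          = algebraMap Ω (RatFunc Ω) (x i) * RatFunc.X ^ φ i) ∧
      W'.comap (algebraMap (adjoin κ (Set.range x)) Ω) = (Ot Ω).comap (θ : _ →+* _) := by
  haveI : IsAlgClosure (adjoin κ (Set.range x)) Ω := ⟨inferInstance, inferInstance⟩
  haveI : Normal (adjoin κ (Set.range x)) Ω := IsAlgClosure.normal _ _
  haveI : Finite S := hS
  haveI : FiniteDimensional (adjoin κ (Set.range x)) (adjoin (adjoin κ (Set.range x)) S) :=
    finiteDimensional_adjoin fun s _ => Algebra.IsIntegral.isIntegral s
  let N := normalClosure (adjoin κ (Set.range x)) (adjoin (adjoin κ (Set.range x)) S) Ω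
  have hSN : ∀ s ∈ S, s ∈ N := fun s hs =>
    (IntermediateField.le_normalClosure (adjoin (adjoin κ (Set.range x)) S)) (subset_adjoin _ _ hs)
  obtain ⟨j, b, hj, hj2⟩ := exists_pow_ell ℓ hl.out (AlgEquiv.restrictNormalHom N g) c
  obtain ⟨φ, W', h, θ, h1, h2, h3, h4, h5⟩ := core1 ℓ hℓ W hW x hx hlt (g ^ j) (Inr_pow hg j) N b (by
    intro n hn
    have h1 : AlgEquiv.restrictNormalHom N ((g ^ j) ^ ℓ ^ b) = 1 := by
      rw [map_pow, map_pow]; exact hj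
    have h2 := AlgEquiv.restrictNormal_commutes ((g ^ j) ^ ℓ ^ b) N ⟨n, hn⟩
    have h3 : AlgEquiv.restrictNormal ((g ^ j) ^ ℓ ^ b) N = 1 := h1
    rw [h3] at h2
    exact h2.symm)
  refine ⟨φ, W', h, θ, h1, h2, fun s hs => ?_, h4, h5⟩
  rw [h3 s (hSN s hs)]
  exact pow_of_mod g _ j s (hc s hs) hj2

theorem core3 {J : Type*} [Fintype J] [IsAlgClosed κ] [IsAlgClosed Ω] (ℓ : ℕ) [hl : Fact ℓ.Prime]
    (hℓ : (ℓ : κ) ≠ 0)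
    (W : ValuationSubring Ω) (hW : ∀ c : κ, algebraMap κ Ω c ∈ W)
    (x : Option J → Ω) (hx : MIndep W x) (hlt : ∀ i, W.valuation (x i) < 1)
    (hal : Algebra.IsAlgebraic (adjoin κ (Set.range x)) Ω)
    (g : Ω ≃ₐ[κ] Ω) (hg : Inr W g) (hgx : ∀ i, g (x i) = x i)
    (S : Set Ω) (hS : S.Finite) (c : ℕ) (hc : ∀ s ∈ S, (g ^ ℓ ^ c) s = s) :
    ∃ (W' : ValuationSubring Ω) (h : Ω ≃ₐ[κ] Ω) (p : ℕ) (q : J → ℕ),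
      Inr W' h ∧ (∀ s ∈ S, h s = g s) ∧ W'.valuation (x none) < 1 ∧
      ∀ P : MvPolynomial J κ, P ≠ 0 →
        W'.valuation (aeval (fun j => x (some j) ^ p / x none ^ q j) P) = 1 := by
  have hgF : ∀ f ∈ adjoin κ (Set.range x), g f = f := by
    intro f hf
    have hle : adjoin κ (Set.range x) ≤ IntermediateField.fixedField (Subgroup.zpowers g) := by
      rw [adjoin_le_iff]
      rintro _ ⟨i, rfl⟩
      rintro ⟨σ, k, rfl⟩
      have : g ∈ MulAction.stabilizer (Ω ≃ₐ[κ] Ω) (x i) := hgx i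
      exact Subgroup.zpow_mem _ this k
    exact hle hf ⟨g, Subgroup.mem_zpowers g⟩
  let g1 : Ω ≃ₐ[adjoin κ (Set.range x)] Ω := AlgEquiv.ofRingEquiv (f := (g : Ω ≃+* Ω))
    (fun f => hgF f.1 f.2)
  obtain ⟨φ, W', h, θ, hφ, hh, hhS, hθ, hW'⟩ := core2 ℓ hℓ W hW x hx hlt g1 hg S hS c (by
    intro s hs
    have := hc s hs
    rw [coe_pow_alg] at this ⊢
    exact this)
  refine ⟨W', h.restrictScalars κ, φ none, fun j => φ (some j), hh, hhS, ?_, ?_⟩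
  · have := val_lt_one_comap W' (algebraMap (adjoin κ (Set.range x)) Ω)
      ⟨x none, subset_adjoin _ _ ⟨none, rfl⟩⟩
    change _ ↔ W'.valuation (x none) < 1 at this
    rw [← this, hW', val_lt_one_comap, Ot_lt]
    change vt Ω (θ _) < 1
    rw [hθ, map_mul, vt_const _ (hx.1 none), one_mul, map_pow]
    exact pow_lt_one₀ zero_le vt_X.1 (hφ none).ne'
  · intro P hP
    set u : J → Ω := fun j => x (some j) ^ φ none / x none ^ φ (some j) with hu
    have hui : MIndep W u := by
      refine ⟨fun j => div_ne_zero (pow_ne_zero _ (hx.1 _)) (pow_ne_zero _ (hx.1 _)), ?_⟩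
      intro a ha
      let b : Option J → ℤ := fun o => o.elim (-∑ j, (φ (some j) : ℤ) * a j)
        (fun j => (φ none : ℤ) * a j)
      have e : ∏ o, x o ^ b o = ∏ j, u j ^ a j := by
        rw [Fintype.prod_option]
        have e1 : ∀ j, u j ^ a j = x none ^ (-((φ (some j) : ℤ) * a j)) * x (some j) ^ b (some j) := by
          intro j
          change (x (some j) ^ φ none / x none ^ φ (some j)) ^ a j = _ * x (some j) ^ ((φ none : ℤ) * a j)
          rw [div_zpow, zpow_mul, zpow_neg, zpow_mul, zpow_natCast, zpow_natCast]
          rw [div_eq_mul_inv, mul_comm]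
        simp only [e1, Finset.prod_mul_distrib]
        congr 1
        change x none ^ (-∑ j, (φ (some j) : ℤ) * a j) = _
        rw [← Finset.sum_neg_distrib]
        have : ∀ (s : Finset J) (f : J → ℤ), x none ^ (∑ j ∈ s, f j) = ∏ j ∈ s, x none ^ f j := by
          intro s f
          classical
          induction s using Finset.induction_on with
          | empty => simp
          | insert j s hj ih =>
            rw [Finset.prod_insert hj, Finset.sum_insert hj, zpow_add₀ (hx.1 none), ih]
        exact this _ _
      have hb := hx.2 b (by rw [e]; exact ha)
      funext j
      have h2 : (φ none : ℤ) * a j = 0 := congrFun hb (some j)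
      have h3 : (φ none : ℤ) ≠ 0 := by exact_mod_cast (hφ none).ne'
      exact (mul_eq_zero.mp h2).resolve_left h3
    have hPu : aeval u P ≠ 0 := mono_ne_zero W hW u hui P hP
    let uF : J → adjoin κ (Set.range x) := fun j =>
      ⟨x (some j), subset_adjoin _ _ ⟨_, rfl⟩⟩ ^ φ none / ⟨x none, subset_adjoin _ _ ⟨_, rfl⟩⟩ ^ φ (some j)
    have e1 : aeval u P = algebraMap (adjoin κ (Set.range x)) Ω (aeval uF P) := by
      change _ = (adjoin κ (Set.range x)).val _
      rw [comp_aeval_apply]; rfl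
    have e2 : θ (aeval uF P) = algebraMap Ω (RatFunc Ω) (aeval u P) := by
      change _ = (IsScalarTower.toAlgHom κ Ω (RatFunc Ω)) _
      rw [comp_aeval_apply, comp_aeval_apply]
      congr 1
      congr 1
      funext j
      change θ (_ ^ _ / _ ^ _) = algebraMap Ω (RatFunc Ω) (u j)
      rw [map_div₀, map_pow, map_pow, hθ, hθ, hu, map_div₀, map_pow, map_pow, mul_pow, mul_pow,
        ← pow_mul, ← pow_mul, mul_comm (φ none) (φ (some j))]
      rw [mul_div_mul_right]
      exact pow_ne_zero _ RatFunc.X_ne_zero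
    have hmem : ∀ f : adjoin κ (Set.range x), (algebraMap _ Ω f) ∈ W' ↔ vt Ω (θ f) ≤ 1 := by
      intro f
      rw [← ValuationSubring.mem_comap, hW', ValuationSubring.mem_comap, mem_Ot]; rfl
    rw [e1]
    have hv := vt_const _ hPu
    rw [← e2] at hv
    apply le_antisymm
    · rw [W'.valuation_le_one_iff, hmem, hv]
    · have h1 : algebraMap _ Ω (aeval uF P)⁻¹ ∈ W' := by
        rw [hmem, map_inv₀, map_inv₀, hv, inv_one]
      rw [← W'.valuation_le_one_iff, map_inv₀, map_inv₀, inv_le_one₀] at h1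
      · exact h1
      · rw [zero_lt_iff, ne_eq, Valuation.zero_iff, ← e1]; exact hPu
end Core2

section ZP
open IntermediateField MvPolynomial
variable {k K : Type*} [Field k] [Field K] [Algebra k K]

def RInd (k : Type*) {K : Type*} [Field k] [Field K] [Algebra k K] (O : ValuationSubring K)
    {ι : Type*} (w : ι → K) : Prop :=
  ∀ P : MvPolynomial ι k, P ≠ 0 → O.valuation (aeval w P) = 1

theorem RInd.base {O : ValuationSubring K} {ι : Type*} {w : ι → K} (h : RInd k O w) (c : k) :
    algebraMap k K c ∈ O := by
  by_cases hc : c = 0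
  · rw [hc, map_zero]; exact O.zero_mem
  have := h (C c) (by simpa using hc)
  rw [← O.valuation_le_one_iff]
  rw [aeval_C] at this
  exact this.le

theorem RInd.ai {O : ValuationSubring K} {ι : Type*} {w : ι → K} (h : RInd k O w) :
    AlgebraicIndependent k w := by
  rw [algebraicIndependent_iff]
  intro P hP
  by_contra h0
  have := h P h0
  rw [hP, map_zero] at this
  exact zero_ne_one this

theorem RInd.adj {O : ValuationSubring K} {ι : Type*} {w : ι → K} (h : RInd k O w)
    (c : adjoin k (Set.range w)) : algebraMap (adjoin k (Set.range w)) K c ∈ O := by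
  obtain ⟨c, hc⟩ := c
  change c ∈ O
  obtain ⟨r, s, rfl⟩ := (mem_adjoin_range_iff k w c).mp hc
  by_cases hr : r = 0
  · rw [hr, map_zero, zero_div]; exact O.zero_mem
  by_cases hs : s = 0
  · rw [hs, map_zero, div_zero]; exact O.zero_mem
  rw [← O.valuation_le_one_iff, map_div₀, h r hr, h s hs, div_one]

theorem sum_ai {O : ValuationSubring K} {ι J : Type*} [Fintype J] {w : ι → K} (h : RInd k O w)
    {x : J → K} (hx : MIndep O x) : AlgebraicIndependent k (Sum.elim x w) := by
  apply h.ai.sumElim_of_tower (S := adjoin k (Set.range w))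
  · rintro _ ⟨i, rfl⟩
    exact ⟨⟨w i, subset_adjoin _ _ ⟨i, rfl⟩⟩, rfl⟩
  · exact mono_algInd O h.adj x hx

theorem MIndep_unit {O : ValuationSubring K} {t : K} (h0 : t ≠ 0) (ht : O.valuation t < 1) :
    MIndep O (fun _ : Unit => t) := by
  refine ⟨fun _ => h0, fun a ha => ?_⟩
  rw [Fintype.prod_unique, map_zpow₀] at ha
  have h0' : 0 < O.valuation t := zero_lt_iff.mpr (by simpa using h0)
  have : a () = 0 := by
    by_contra hne
    exact ((zpow_eq_one_iff_right₀ h0'.le ht.ne).not.mpr hne) ha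
  funext i
  exact this

theorem res_aeval (O : ValuationSubring K) (hb : ∀ c : k, algebraMap k K c ∈ O) {ι : Type*}
    (w : ι → O) (P : MvPolynomial ι k) :
    letI := (resMap O hb).toAlgebra
    ∃ a : O, (a : K) = aeval (fun i => (w i : K)) P ∧
      IsLocalRing.residue O a = aeval (fun i => IsLocalRing.residue O (w i)) P := by
  letI := (resMap O hb).toAlgebra
  refine ⟨eval₂ ((algebraMap k K).codRestrict O.toSubring hb) w P, ?_, ?_⟩
  · rw [aeval_def]
    have := MvPolynomial.eval₂_comp_left O.subtype ((algebraMap k K).codRestrict O.toSubring hb) w P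
    exact this
  · rw [aeval_def]
    have := MvPolynomial.eval₂_comp_left (IsLocalRing.residue O) ((algebraMap k K).codRestrict O.toSubring hb) w P
    exact this

theorem res_ne (O : ValuationSubring K) (a : O) :
    IsLocalRing.residue O a ≠ 0 ↔ O.valuation (a : K) = 1 := by
  rw [Ne, IsLocalRing.residue_eq_zero_iff, ValuationSubring.valuation_lt_one_iff]
  have := O.valuation_le_one a
  constructor
  · intro h; exact le_antisymm this (not_lt.mp h)
  · intro h; rw [h]; exact lt_irrefl _

theorem RInd_iff (O : ValuationSubring K) (hb : ∀ c : k, algebraMap k K c ∈ O) {ι : Type*}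
    (w : ι → O) : RInd k O (fun i => (w i : K)) ↔
    letI := (resMap O hb).toAlgebra
    AlgebraicIndependent k (fun i => IsLocalRing.residue O (w i)) := by
  letI := (resMap O hb).toAlgebra
  rw [algebraicIndependent_iff]
  constructor
  · intro h P hP
    by_contra h0
    obtain ⟨a, h1, h2⟩ := res_aeval O hb w P
    have := (res_ne O a).mpr (by rw [h1]; exact h P h0)
    exact this (h2.trans hP)
  · intro h P hP
    obtain ⟨a, h1, h2⟩ := res_aeval O hb w P
    rw [← h1, ← res_ne, h2]
    exact fun h0 => hP (h P h0)

theorem RInd.mem {O : ValuationSubring K} {ι : Type*} {w : ι → K} (h : RInd k O w) (i : ι) :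
    w i ∈ O := by
  rw [← O.valuation_le_one_iff]
  have := h (X i) (X_ne_zero i)
  rw [aeval_X] at this
  exact this.le

theorem zpd_res {O : ValuationSubring K} (hb : ∀ c : k, algebraMap k K c ∈ O) {ι : Type} [Fintype ι]
    {w : ι → K} (h : RInd k O w)
    {t : K} (h0 : t ≠ 0) (ht : O.valuation t < 1)
    (htd : Algebra.trdeg k K = Fintype.card ι + 1) :
    letI := (resMap O hb).toAlgebra
    Algebra.trdeg k (IsLocalRing.ResidueField O) + 1 = Algebra.trdeg k K := by
  letI := (resMap O hb).toAlgebra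
  apply le_antisymm
  · obtain ⟨s, hs⟩ := exists_isTranscendenceBasis k (IsLocalRing.ResidueField O)
    have hsur : Function.Surjective (IsLocalRing.residue O) := IsLocalRing.residue_surjective
    let w' : s → O := fun i => (hsur i.1).choose
    have hw' : ∀ i, IsLocalRing.residue O (w' i) = i.1 := fun i => (hsur i.1).choose_spec
    have : RInd k O (fun i => (w' i : K)) := by
      rw [RInd_iff O hb]
      simp only [hw']
      exact hs.1
    have := (sum_ai this (MIndep_unit h0 ht)).lift_cardinalMk_le_trdeg
    simp only [Cardinal.mk_sum, Cardinal.mk_fintype, Fintype.card_unit, Cardinal.lift_id'] at this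
    rw [← hs.cardinalMk_eq_trdeg]
    simpa [add_comm] using this
  · rw [htd]
    gcongr
    have := ((RInd_iff O hb (fun i => ⟨w i, h.mem i⟩)).mp h).lift_cardinalMk_le_trdeg
    simpa using this

theorem RInd.basis {O : ValuationSubring K} {ι J : Type} [Fintype ι] [Fintype J] {w : ι → K}
    (h : RInd k O w) {x : J → K} (hx : MIndep O x)
    (htd : Algebra.trdeg k K = Fintype.card J + Fintype.card ι) :
    IsTranscendenceBasis k (Sum.elim x w) := by
  apply (sum_ai h hx).isTranscendenceBasis_of_lift_trdeg_le_of_finite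
  rw [htd]
  simp

theorem alg_tower {M : Type*} [Field M] (A B : Type*) [Field A] [Field B] [Algebra A M] [Algebra B M]
    (f : A →+* B) (hf : ∀ a, algebraMap B M (f a) = algebraMap A M a) (h : Algebra.IsAlgebraic A M) :
    Algebra.IsAlgebraic B M := by
  constructor
  intro a
  obtain ⟨P, hP, hPa⟩ := h.isAlgebraic a
  refine ⟨P.map f, (Polynomial.map_ne_zero_iff (RingHom.injective _)).mpr hP, ?_⟩
  rw [Polynomial.aeval_def, Polynomial.eval₂_map]
  have : (algebraMap B M).comp f = algebraMap A M := RingHom.ext hf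
  rw [this]
  exact hPa

theorem zpd_alg {O : ValuationSubring K} {ι J : Type} [Fintype ι] [Fintype J] {w : ι → K}
    (h : RInd k O w) {x : J → K} (hx : MIndep O x)
    (htd : Algebra.trdeg k K = Fintype.card J + Fintype.card ι) :
    Algebra.IsAlgebraic (adjoin (adjoin k (Set.range w)) (Set.range x)) K := by
  have := (h.basis hx htd).isAlgebraic_field
  have hle : adjoin k (Set.range (Sum.elim x w)) ≤
      (adjoin (adjoin k (Set.range w)) (Set.range x)).restrictScalars k := by
    rw [adjoin_le_iff]
    rintro _ ⟨i | i, rfl⟩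
    · exact subset_adjoin (adjoin k (Set.range w)) _ ⟨i, rfl⟩
    · exact IntermediateField.algebraMap_mem _ (⟨w i, subset_adjoin _ _ ⟨i, rfl⟩⟩ : adjoin k (Set.range w))
  exact alg_tower _ _ (IntermediateField.inclusion hle).toRingHom (fun _ => rfl) this

theorem val_fin_discrete (O : ValuationSubring K) (t : K) (h0 : t ≠ 0) (ht : O.valuation t < 1)
    (n : ℕ) (hn : n ≠ 0)
    (hv : ∀ c : K, c ≠ 0 → ∃ a : ℤ, O.valuation (c ^ n) = O.valuation t ^ a) :
    Nonempty ((O.ValueGroup)ˣ ≃* Multiplicative ℤ) := by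
  have ht0 : O.valuation t ≠ 0 := by simpa using h0
  have hp : 0 < O.valuation t := zero_lt_iff.mpr ht0
  have key : ∀ γ : (O.ValueGroup)ˣ, ∃ a : ℤ, (γ : O.ValueGroup) ^ n = O.valuation t ^ a := by
    intro γ
    obtain ⟨c, hc⟩ := O.valuation_surjective γ
    obtain ⟨a, ha⟩ := hv c (by rintro rfl; rw [map_zero] at hc; exact γ.ne_zero hc.symm)
    exact ⟨a, by rw [← hc, ← map_pow, ha]⟩
  choose f hf using key
  have hinj : Function.Injective (fun a : ℤ => O.valuation t ^ a) := zpow_right_injective₀ hp ht.ne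
  let F : (O.ValueGroup)ˣ →* Multiplicative ℤ := MonoidHom.mk' (fun γ => Multiplicative.ofAdd (f γ)) (by
    intro a b
    rw [← ofAdd_add]
    congr 1
    apply hinj
    change O.valuation t ^ _ = O.valuation t ^ _
    rw [zpow_add₀ ht0, ← hf, ← hf, ← hf, Units.val_mul, mul_pow])
  have hF : Function.Injective F := by
    rw [injective_iff_map_eq_one]
    intro γ hγ
    have h1 : f γ = 0 := hγ
    have h2 := hf γ
    rw [h1, zpow_zero] at h2
    rw [pow_eq_one_iff_of_nonneg zero_le hn] at h2
    exact Units.ext h2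
  have hcyc : IsCyclic (O.ValueGroup)ˣ := isCyclic_of_injective F hF
  have hinf : Infinite (O.ValueGroup)ˣ := by
    apply Infinite.of_injective (fun a : ℤ => (Units.mk0 _ ht0) ^ a)
    intro a b hab
    apply hinj
    have := congrArg (Units.val) hab
    simpa using this
  exact ⟨mulEquivOfCyclicCardEq (by rw [Nat.card_eq_zero_of_infinite, Nat.card_eq_zero_of_infinite])⟩

theorem zpd {O : ValuationSubring K} {ι : Type} [Fintype ι]
    (hKfg : (⊤ : IntermediateField k K).FG)
    {w : ι → K} (h : RInd k O w)
    {t : K} (h0 : t ≠ 0) (ht : O.valuation t < 1)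
    (htd : Algebra.trdeg k K = Fintype.card ι + 1) : IsZPD k O := by
  refine ⟨h.base, ?_, ?_, zpd_res h.base h h0 ht htd⟩
  · intro hO
    have := ((val_lt_one_iff' O t).mp ht).2
    rw [hO] at this
    exact this.elim h0 (fun h => h trivial)
  · have hal := zpd_alg h (MIndep_unit h0 ht) (by rw [htd]; simp [add_comm])
    set κ := adjoin k (Set.range w)
    set F := adjoin κ (Set.range (fun _ : Unit => t))
    have hfd : FiniteDimensional F K := by
      obtain ⟨s, hs⟩ := hKfg
      have htop : adjoin F (s : Set K) = ⊤ := by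
        rw [eq_top_iff]
        intro a _
        have : adjoin k (s : Set K) ≤ ((adjoin F (s : Set K)).restrictScalars κ).restrictScalars k := by
          rw [adjoin_le_iff]
          exact subset_adjoin F _
        exact this (by rw [hs]; trivial)
      have := finiteDimensional_adjoin (K := F) (S := (s : Set K)) (fun x _ => (hal.isAlgebraic x).isIntegral)
      rw [htop] at this
      exact LinearEquiv.finiteDimensional (IntermediateField.topEquiv (F := F) (E := K)).toLinearEquiv
    have hfd' : FiniteDimensional F (⊤ : IntermediateField F K) :=
      LinearEquiv.finiteDimensional (IntermediateField.topEquiv (F := F) (E := K)).symm.toLinearEquiv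
    apply val_fin_discrete O t h0 ht (Module.finrank F (⊤ : IntermediateField F K)).factorial (Nat.factorial_ne_zero _)
    intro c hc
    obtain ⟨f, hf0, hf⟩ := val_torsion O (⊤ : IntermediateField F K) c trivial hc
    obtain ⟨a, ha⟩ := F_val O h.adj _ (MIndep_unit h0 ht) (f : K) f.2 (by simpa using hf0)
    refine ⟨a (), ?_⟩
    rw [hf]
    refine Eq.trans ha ?_
    rw [Fintype.prod_unique, map_zpow₀]
end ZP

section Unp
open IntermediateField MvPolynomial
open scoped TensorProduct
variable {k K : Type*} [Field k] [Field K] [Algebra k K]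

theorem fg_trdeg (hKfg : (⊤ : IntermediateField k K).FG) : Algebra.trdeg k K < Cardinal.aleph0 := by
  obtain ⟨s, hs⟩ := hKfg
  have : Algebra.IsAlgebraic (Algebra.adjoin k (s : Set K)) K := by
    constructor
    intro a
    have ha : a ∈ adjoin k (s : Set K) := by rw [hs]; trivial
    rw [mem_adjoin_iff_div] at ha
    obtain ⟨p, hp, q, hq, rfl⟩ := ha
    have hp := isAlgebraic_algebraMap (A := K) (⟨p, hp⟩ : Algebra.adjoin k (s : Set K))
    have hq := isAlgebraic_algebraMap (A := K) (⟨q, hq⟩ : Algebra.adjoin k (s : Set K))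
    rw [div_eq_mul_inv]
    exact hp.mul hq.inv
  refine lt_of_le_of_lt (Algebra.IsAlgebraic.trdeg_le_cardinalMk k (s : Set K)) ?_
  simp

theorem fin_reindex {V : Type*} {s : Set V} {n : ℕ} (h : Cardinal.mk s = n) : Nonempty (Fin n ≃ s) := by
  have : Cardinal.lift (Cardinal.mk (Fin n)) = Cardinal.lift (Cardinal.mk s) := by simp [h]
  exact Cardinal.lift_mk_eq'.mp this

theorem unpack {O : ValuationSubring K} (hKfg : (⊤ : IntermediateField k K).FG)
    (hd : IsDefectless k O) : ∃ (r s : ℕ) (x : Fin r → K) (y : Fin s → K),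
      MIndep O x ∧ (∀ i, O.valuation (x i) < 1) ∧ RInd k O y ∧ Algebra.trdeg k K = r + s := by
  obtain ⟨hb, hd⟩ := hd
  letI := (resMap O hb).toAlgebra
  change Algebra.trdeg k K = _ + Algebra.trdeg k (IsLocalRing.ResidueField O) at hd
  have hfin := fg_trdeg hKfg
  rw [hd] at hfin
  obtain ⟨r, hr⟩ := Cardinal.lt_aleph0.mp (lt_of_le_of_lt (self_le_add_right _ _) hfin)
  obtain ⟨s, hs⟩ := Cardinal.lt_aleph0.mp (lt_of_le_of_lt (self_le_add_left _ _) hfin)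
  rw [hr, hs] at hd
  have hr' : Module.rank ℤ (Additive ((O.ValueGroup)ˣ)) = r := by
    rw [← hr]
    exact ((TensorProduct.isBaseChange ℤ (Additive ((O.ValueGroup)ˣ)) ℚ).rank_eq).symm
  obtain ⟨A, hA, hAi⟩ := exists_set_linearIndependent ℤ (Additive ((O.ValueGroup)ˣ))
  obtain ⟨e⟩ := fin_reindex (hA.trans hr')
  obtain ⟨B, hB⟩ := exists_isTranscendenceBasis k (IsLocalRing.ResidueField O)
  obtain ⟨e'⟩ := fin_reindex (hB.cardinalMk_eq_trdeg.trans hs)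
  have hx : ∀ i, ∃ x : K, O.valuation x = ((e i).1.toMul : O.ValueGroup) := fun i => O.valuation_surjective _
  choose x hx using hx
  have hx0 : ∀ i, x i ≠ 0 := by
    intro i h
    have := hx i
    rw [h, map_zero] at this
    exact (Units.ne_zero _) this.symm
  have hMI : MIndep O x := by
    refine ⟨hx0, fun a ha => ?_⟩
    rw [map_prod] at ha
    simp only [map_zpow₀, hx] at ha
    have h1 : (∏ i, (e i).1.toMul ^ a i) = 1 := by
      apply Units.ext
      simpa using ha
    have h2 : ∑ i, a i • (e i).1 = 0 := by
      apply Additive.toMul.injective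
      rw [toMul_sum]
      simpa using h1
    have h3 := hAi.comp e e.injective
    rw [Fintype.linearIndependent_iff] at h3
    funext i
    exact h3 a h2 i
  have hsur : Function.Surjective (IsLocalRing.residue O) := IsLocalRing.residue_surjective
  choose w hw using fun i => hsur (e' i).1
  -- invert
  have hne : ∀ i, O.valuation (x i) ≠ 1 := by
    intro i h
    have := hMI.2 (Pi.single i 1) (by
      rw [Finset.prod_eq_single i]
      · simpa using h
      · intro j _ hj; simp [Pi.single_eq_of_ne hj]
      · simp)
    simpa using congrFun this i
  classical
  let ε : Fin r → ℤ := fun i => if O.valuation (x i) < 1 then 1 else -1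
  have hε : ∀ i, ε i ≠ 0 := by intro i; simp only [ε]; split_ifs <;> norm_num
  refine ⟨r, s, fun i => x i ^ ε i, fun i => (w i : K), ⟨fun i => zpow_ne_zero _ (hx0 i), ?_⟩, ?_, ?_, hd⟩
  · intro a ha
    simp only [← zpow_mul] at ha
    have := hMI.2 (fun i => ε i * a i) ha
    funext i
    have := congrFun this i
    simpa [hε i] using this
  · intro i
    simp only [ε]
    split_ifs with h
    · simpa using h
    · rw [zpow_neg, zpow_one, map_inv₀]
      exact inv_lt_one_of_one_lt₀ (lt_of_le_of_ne (not_lt.mp h) (hne i).symm)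
  · rw [RInd_iff O hb]
    simp only [hw]
    exact hB.1.comp e' e'.injective
end Unp

section App
open IntermediateField MvPolynomial

theorem val_eq_one_comap {F Ω : Type*} [Field F] [Field Ω] (O : ValuationSubring Ω) (f : F →+* Ω) (e : F) :
    (O.comap f).valuation e = 1 ↔ O.valuation (f e) = 1 := by
  rw [val_eq_one_iff', val_eq_one_iff', val_lt_one_comap, ValuationSubring.mem_comap]

theorem MIndep_comap {F Ω ι : Type*} [Field F] [Field Ω] [Fintype ι] (O : ValuationSubring Ω) (f : F →+* Ω)
    (x : ι → F) (h : MIndep (O.comap f) x) : MIndep O (fun i => f (x i)) := by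
  refine ⟨fun i => by simpa using h.1 i, fun a ha => h.2 a ?_⟩
  rw [val_eq_one_comap]
  simpa using ha

theorem RInd_comap {k F Ω ι : Type*} [Field k] [Field F] [Field Ω] [Algebra k F] [Algebra k Ω]
    (O : ValuationSubring Ω) (f : F →ₐ[k] Ω) (y : ι → F) :
    RInd k (O.comap (f : F →+* Ω)) y ↔ RInd k O (fun i => f (y i)) := by
  unfold RInd
  simp only [val_eq_one_comap]
  refine forall_congr' fun P => ?_
  have : (f : F →+* Ω) (aeval y P) = aeval (fun i => f (y i)) P := by
    exact MvPolynomial.comp_aeval_apply (f := y) f P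
  rw [this]

theorem RInd_sum {k κ Ω ι J : Type*} [Field k] [Field κ] [Field Ω] [Algebra k κ] [Algebra κ Ω] [Algebra k Ω]
    [IsScalarTower k κ Ω] (W : ValuationSubring Ω) (y : ι → κ) (hy : AlgebraicIndependent k y)
    (u : J → Ω) (hu : RInd κ W u) : RInd k W (Sum.elim u (fun i => algebraMap κ Ω (y i))) := by
  intro P hP
  have h1 : (aeval (Sum.elim u (fun i => algebraMap κ Ω (y i))) : MvPolynomial (J ⊕ ι) k →ₐ[k] Ω) =
    ((aeval u : MvPolynomial J κ →ₐ[κ] Ω).restrictScalars k).comp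
      ((mapAlgHom (aeval y : MvPolynomial ι k →ₐ[k] κ)).comp (sumAlgEquiv k J ι).toAlgHom) := by
    ext (i | i) <;> simp
  rw [h1]
  apply hu
  change MvPolynomial.map _ _ ≠ 0
  intro h0
  have h0 : sumAlgEquiv k J ι P = 0 :=
    (MvPolynomial.map_injective ((aeval y : MvPolynomial ι k →ₐ[k] κ) : MvPolynomial ι k →+* κ) hy) (h0.trans (map_zero _).symm)
  exact hP (by simpa using h0)

theorem mem_of_int {κ Ω : Type*} [Field κ] [Field Ω] [Algebra κ Ω] (W : ValuationSubring Ω)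
    (hW : ∀ c : κ, algebraMap κ Ω c ∈ W) (a : Ω) (ha : IsIntegral κ a) : a ∈ W := by
  obtain ⟨p, hp, hpa⟩ := ha
  have : IsIntegral W a := by
    refine ⟨p.map ((algebraMap κ Ω).codRestrict W.toSubring hW), hp.map _, ?_⟩
    rw [Polynomial.eval₂_map]
    exact hpa
  obtain ⟨b, hb⟩ := IsIntegrallyClosed.isIntegral_iff.mp this
  rw [← hb]
  exact b.2

theorem fix_alg {κ Ω : Type*} [Field κ] [Field Ω] [Algebra κ Ω] (W : ValuationSubring Ω)
    (hW : ∀ c : κ, algebraMap κ Ω c ∈ W) (g : Ω ≃ₐ[κ] Ω) (hg : Inr W g) (a : Ω) (ha : IsIntegral κ a) :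
    g a = a := by
  have h1 : IsIntegral κ (g a - a) := (ha.map g).sub ha
  by_contra hne
  have h0 : g a - a ≠ 0 := sub_ne_zero.mpr hne
  have h2 : (g a - a)⁻¹ ∈ W := mem_of_int W hW _ (IsIntegral.inv h1)
  have h3 := hg.2 a (mem_of_int W hW _ ha)
  rw [val_lt_one_iff'] at h3
  exact h3.2.elim h0 (fun h => h h2)

universe u
variable {k : Type*} {K Ω : Type u} [Field k] [Field K] [Algebra k K] [Field Ω] [Algebra k Ω] [Algebra K Ω]
  [IsScalarTower k K Ω] [IsAlgClosed Ω] [Algebra.IsAlgebraic K Ω]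

theorem trdeg_top : Algebra.trdeg k K = Algebra.trdeg k Ω := by
  have := trdeg_add_eq k K (A := Ω)
  rw [trdeg_eq_zero (R := K) (A := Ω)] at this
  simpa using this

theorem app1 {ι J : Type} [Fintype ι] [Fintype J]  (ℓ : ℕ) [hl : Fact ℓ.Prime] (hℓ : (ℓ : k) ≠ 0)
    (hKfg : (⊤ : IntermediateField k K).FG)
    (W : ValuationSubring Ω) (x : Option J → K) (y : ι → K)
    (hx : MIndep (W.comap (algebraMap K Ω)) x) (hlt : ∀ i, (W.comap (algebraMap K Ω)).valuation (x i) < 1)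
    (hy : RInd k (W.comap (algebraMap K Ω)) y)
    (htd : Algebra.trdeg k K = Fintype.card (Option J) + Fintype.card ι)
    (g : Ω ≃ₐ[K] Ω) (hg : Inr W g) (S : Set Ω) (hS : S.Finite) (c : ℕ)
    (hc : ∀ s ∈ S, (g ^ ℓ ^ c) s = s) :
    ∃ (W' : ValuationSubring Ω) (h : Ω ≃ₐ[K] Ω), Inr W' h ∧ (∀ s ∈ S, h s = g s) ∧
      IsZPD k (W'.comap (algebraMap K Ω)) := by
  have hx' := MIndep_comap W (algebraMap K Ω) x hx
  have hy' := (RInd_comap W (IsScalarTower.toAlgHom k K Ω) y).mp hy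
  set x' : Option J → Ω := fun i => algebraMap K Ω (x i) with hx'def
  set y' : ι → Ω := fun i => IsScalarTower.toAlgHom k K Ω (y i) with hy'def
  have htd' : Algebra.trdeg k Ω = Fintype.card (Option J) + Fintype.card ι := by
    rw [← trdeg_top (K := K), htd]
  have hal := zpd_alg hy' hx' htd'
  set κ0 := adjoin k (Set.range y') with hκ0
  let κ := algebraicClosure κ0 Ω
  haveI : IsAlgClosed κ := IsAlgClosure.isAlgClosed κ0
  have hW0 : ∀ c : κ0, algebraMap κ0 Ω c ∈ W := hy'.adj
  have hW : ∀ c : κ, algebraMap κ Ω c ∈ W := by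
    rintro ⟨c, hc⟩
    exact mem_of_int W hW0 c (mem_algebraicClosure_iff.mp hc).isIntegral
  -- g fixes κ0
  have hg0 : ∀ c : κ0, g (algebraMap κ0 Ω c) = algebraMap κ0 Ω c := by
    rintro ⟨c, hc⟩
    change g c = c
    have : κ0 ≤ (IsScalarTower.toAlgHom k K Ω).fieldRange := by
      rw [hκ0, adjoin_le_iff]
      rintro _ ⟨i, rfl⟩
      exact ⟨y i, rfl⟩
    obtain ⟨b, rfl⟩ := this hc
    exact g.commutes b
  let g0 : Ω ≃ₐ[κ0] Ω := AlgEquiv.ofRingEquiv (f := g.toRingEquiv) hg0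
  have hgκ : ∀ c : κ, g (algebraMap κ Ω c) = algebraMap κ Ω c := by
    rintro ⟨c, hc⟩
    exact fix_alg W hW0 g0 hg c (mem_algebraicClosure_iff.mp hc).isIntegral
  let g1 : Ω ≃ₐ[κ] Ω := AlgEquiv.ofRingEquiv (f := g.toRingEquiv) hgκ
  have hal' : Algebra.IsAlgebraic (adjoin κ (Set.range x')) Ω := by
    have hle : adjoin κ0 (Set.range x') ≤ (adjoin κ (Set.range x')).restrictScalars κ0 := by
      rw [adjoin_le_iff]
      exact subset_adjoin κ _
    exact alg_tower _ _ (IntermediateField.inclusion hle).toRingHom (fun _ => rfl) hal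
  obtain ⟨T, hT⟩ := id hKfg
  have hℓ' : (ℓ : κ) ≠ 0 := by
    intro h
    have h2 : ((ℓ : κ) : Ω) = 0 := by rw [h]; rfl
    have h3 : algebraMap k Ω (ℓ : k) = 0 := by
      rw [map_natCast]; simpa using h2
    exact hℓ ((map_eq_zero _).mp h3)
  have hpow : ∀ (n : ℕ) (s : Ω), (g1 ^ n) s = (g ^ n) s := by
    intro n s
    rw [coe_pow_alg, coe_pow_alg]; rfl
  obtain ⟨W', h, p, q, hI, hag, hxn, hP⟩ := core3 ℓ hℓ' W hW x' hx'
    (fun i => (val_lt_one_comap W _ _).mp (hlt i)) hal' g1 hg (fun i => g.commutes _)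
    (S ∪ (algebraMap K Ω) '' (T : Set K)) (hS.union (T.finite_toSet.image _)) c (by
      rintro s (hs | ⟨t, -, rfl⟩)
      · rw [hpow]; exact hc s hs
      · rw [hpow]; exact AlgEquiv.commutes _ _)
  have hfixk : ∀ a : k, h (algebraMap k Ω a) = algebraMap k Ω a := by
    intro a
    have : algebraMap k Ω a = algebraMap κ Ω (algebraMap κ0 κ (algebraMap k κ0 a)) := rfl
    rw [this]
    exact h.commutes _
  have hfixK : ∀ a : K, h (algebraMap K Ω a) = algebraMap K Ω a := by
    intro a
    have ha : a ∈ adjoin k (T : Set K) := by rw [hT]; trivial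
    induction ha using adjoin_induction with
    | mem x hx => exact (hag _ (Or.inr ⟨x, hx, rfl⟩)).trans (g.commutes x)
    | algebraMap a => rw [← IsScalarTower.algebraMap_apply k K Ω]; exact hfixk a
    | add a b _ _ ha hb => rw [map_add, map_add, ha, hb]
    | inv a _ ha => rw [map_inv₀, map_inv₀, ha]
    | mul a b _ _ ha hb => rw [map_mul, map_mul, ha, hb]
  let h2 : Ω ≃ₐ[K] Ω := AlgEquiv.ofRingEquiv (f := h.toRingEquiv) hfixK
  refine ⟨W', h2, hI, fun s hs => hag s (Or.inl hs), ?_⟩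
  have hyκ : ∀ i, y' i ∈ κ := fun i => κ.algebraMap_mem (⟨y' i, subset_adjoin _ _ ⟨i, rfl⟩⟩ : κ0)
  haveI : IsScalarTower k κ Ω := IsScalarTower.of_algebraMap_eq (fun _ => rfl)
  have hyai : AlgebraicIndependent k (fun i => (⟨y' i, hyκ i⟩ : κ)) := by
    exact AlgebraicIndependent.of_comp (IsScalarTower.toAlgHom k κ Ω) hy'.ai
  have hR := RInd_sum W' (fun i => (⟨y' i, hyκ i⟩ : κ)) hyai _ hP
  have hR' : RInd k (W'.comap (algebraMap K Ω)) (Sum.elim (fun j => x (some j) ^ p / x none ^ q j) y) := by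
    refine (RInd_comap W' (IsScalarTower.toAlgHom k K Ω) _).mpr ?_
    convert hR using 1
    funext i
    rcases i with i | i
    · simp [x']
    · rfl
  refine zpd hKfg hR' (hx.1 none) ((val_lt_one_comap W' _ _).mpr hxn) ?_
  rw [htd]
  simp
  ring
end App

section Fin0
open IntermediateField MvPolynomial
universe u

theorem Ot_one {L : Type*} [Field L] (f : RatFunc L) (hf : vt L f = 1) : (Ot L).valuation f = 1 := by
  rw [val_eq_one_iff', mem_Ot, Ot_lt, hf]
  exact ⟨le_rfl, lt_irrefl _⟩

theorem exists_zpd {k K : Type*} [Field k] [Field K] [Algebra k K]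
    (hKfg : (⊤ : IntermediateField k K).FG) (htd : 0 < Algebra.trdeg k K) :
    ∃ O : ValuationSubring K, IsZPD k O := by
  obtain ⟨n, hn⟩ := Cardinal.lt_aleph0.mp (fg_trdeg hKfg)
  obtain ⟨m, rfl⟩ : ∃ m, n = m + 1 := by
    refine ⟨n - 1, (Nat.succ_pred_eq_of_pos ?_).symm⟩
    rw [hn] at htd
    exact_mod_cast htd
  obtain ⟨B, hB⟩ := exists_isTranscendenceBasis k K
  obtain ⟨e⟩ := fin_reindex (hB.cardinalMk_eq_trdeg.trans hn)
  let b : Fin (m+1) → K := fun i => (e i).1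
  have hb : AlgebraicIndependent k b := hB.1.comp e e.injective
  obtain ⟨θ, hθ⟩ := exists_theta b hb (fun i => if i = 0 then 1 else 0)
  obtain ⟨O, hO⟩ := exists_prolong (algebraMap (adjoin k (Set.range b)) K) ((Ot K).comap (θ : _ →+* RatFunc K))
  refine ⟨O, ?_⟩
  have hb0 : ∀ i, b i ≠ 0 := hb.ne_zero
  let b' : Fin (m+1) → adjoin k (Set.range b) := fun i => ⟨b i, subset_adjoin _ _ ⟨i, rfl⟩⟩
  have h1 : RInd k ((Ot K).comap (θ : _ →+* RatFunc K)) (fun i : Fin m => b' i.succ) := by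
    rw [RInd_comap]
    intro P hP
    have : (fun i : Fin m => θ (b' i.succ)) = fun i => IsScalarTower.toAlgHom k K (RatFunc K) (b i.succ) := by
      funext i
      rw [hθ]
      simp
    rw [this, ← MvPolynomial.comp_aeval_apply]
    apply Ot_one
    apply vt_const
    have h2 := hb.comp _ (Fin.succ_injective m)
    intro h0
    exact hP ((algebraicIndependent_iff.mp h2) P h0)
  have h2 : ((Ot K).comap (θ : _ →+* RatFunc K)).valuation (b' 0) < 1 := by
    rw [val_lt_one_comap, Ot_lt]
    have : (θ : _ →+* RatFunc K) (b' 0) = algebraMap K (RatFunc K) (b 0) * RatFunc.X := by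
      have := hθ 0
      simpa using this
    rw [this, map_mul, vt_const _ (hb0 0), one_mul]
    exact vt_X.1
  rw [← hO] at h1 h2
  have h1' := (RInd_comap O (IsScalarTower.toAlgHom k (adjoin k (Set.range b)) K) (fun i : Fin m => b' i.succ)).mp h1
  rw [val_lt_one_comap] at h2
  exact zpd hKfg h1' (hb0 0) h2 (by rw [hn]; simp)

variable {k : Type*} {K E Ω : Type u} [Field k] [Field K] [Algebra k K] [Field E] [Algebra K E] [Field Ω] [Algebra k Ω] [Algebra K Ω]
  [IsScalarTower k K Ω] [Algebra E Ω] [IsScalarTower K E Ω] [IsAlgClosed Ω] [Algebra.IsAlgebraic K Ω]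

theorem app0 {ι : Type} [Fintype ι] (W : ValuationSubring Ω) (y : ι → K)
    (hy : RInd k (W.comap (algebraMap K Ω)) y)
    (htd : Algebra.trdeg k K = Fintype.card ι)
    (g : Ω ≃ₐ[K] Ω) (hg : Inr W g) (a : Ω) : g a = a := by
  have hy' := (RInd_comap W (IsScalarTower.toAlgHom k K Ω) y).mp hy
  set y' : ι → Ω := fun i => IsScalarTower.toAlgHom k K Ω (y i) with hy'def
  have hb : IsTranscendenceBasis k y' := by
    apply hy'.ai.isTranscendenceBasis_of_lift_trdeg_le_of_finite
    rw [← trdeg_top (K := K), htd]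
    simp
  have hal := hb.isAlgebraic_field
  set κ0 := adjoin k (Set.range y') with hκ0
  have hW0 : ∀ c : κ0, algebraMap κ0 Ω c ∈ W := hy'.adj
  have hg0 : ∀ c : κ0, g (algebraMap κ0 Ω c) = algebraMap κ0 Ω c := by
    rintro ⟨c, hc⟩
    change g c = c
    have : κ0 ≤ (IsScalarTower.toAlgHom k K Ω).fieldRange := by
      rw [hκ0, adjoin_le_iff]
      rintro _ ⟨i, rfl⟩
      exact ⟨y i, rfl⟩
    obtain ⟨b, rfl⟩ := this hc
    exact g.commutes b
  let g0 : Ω ≃ₐ[κ0] Ω := AlgEquiv.ofRingEquiv (f := g.toRingEquiv) hg0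
  exact fix_alg W hW0 g0 hg a (hal.isAlgebraic a).isIntegral

theorem MIndep_equiv {F ι ι' : Type*} [Field F] [Fintype ι] [Fintype ι'] (O : ValuationSubring F)
    (x : ι → F) (h : MIndep O x) (e : ι' ≃ ι) : MIndep O (fun i => x (e i)) := by
  refine ⟨fun i => h.1 _, fun a ha => ?_⟩
  have := h.2 (fun i => a (e.symm i)) (by
    rw [← e.prod_comp]
    simpa using ha)
  funext i
  simpa using congrFun this (e i)

theorem app_fin (hΩ : Algebra.IsAlgebraic E Ω) [Normal K E] (ℓ : ℕ) [hl : Fact ℓ.Prime] (hℓ : (ℓ : k) ≠ 0)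
    (hKfg : (⊤ : IntermediateField k K).FG) (htd : 0 < Algebra.trdeg k K)
    (g : E ≃ₐ[K] E) (Ow : ValuationSubring E) (hd : IsDefectless k (Ow.comap (algebraMap K E)))
    (hg : Inr Ow g) (S : Set E) (hS : S.Finite) (ht : ∀ s : E, ∃ c, (g ^ ℓ ^ c) s = s) :
    ∃ (Ow' : ValuationSubring E) (h : E ≃ₐ[K] E), IsZPD k (Ow'.comap (algebraMap K E)) ∧
      Inr Ow' h ∧ ∀ s ∈ S, h s = g s := by
  obtain ⟨W, rfl⟩ := exists_prolong (algebraMap E Ω) Ow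
  obtain ⟨g1, hg1, hgg⟩ := lift_gen W (g : E ≃+* E) hg
  have hcc : ∀ V : ValuationSubring Ω, (V.comap (algebraMap E Ω)).comap (algebraMap K E) = V.comap (algebraMap K Ω) := by
    intro V
    rw [ValuationSubring.comap_comap, ← IsScalarTower.algebraMap_eq]
  rw [hcc] at hd
  let g2 : Ω ≃ₐ[K] Ω := AlgEquiv.ofRingEquiv (f := g1) (by
    intro a
    rw [IsScalarTower.algebraMap_apply K E Ω, hgg]
    congr 1
    exact g.commutes a)
  have hg2 : ∀ e, g2 (algebraMap E Ω e) = algebraMap E Ω (g e) := hgg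
  obtain ⟨r, s, x, y, hx, hlt, hy, htd'⟩ := unpack hKfg hd
  rcases r with _ | r
  · have hid : ∀ a, g2 a = a := app0 W y hy (by rw [htd']; simp) g2 hg1
    have hid' : ∀ e, g e = e := fun e => (algebraMap E Ω).injective (by rw [← hg2, hid])
    obtain ⟨O, hO⟩ := exists_zpd hKfg htd
    obtain ⟨O', rfl⟩ := exists_prolong (algebraMap K E) O
    exact ⟨O', g, hO, ⟨fun x => by rw [hid'], fun x _ => by rw [hid', sub_self, map_zero]; exact zero_lt_one⟩, fun _ _ => rfl⟩
  · choose c hc using ht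
    have hpw : ∀ (n : ℕ) (e : E), (g2 ^ n) (algebraMap E Ω e) = algebraMap E Ω ((g ^ n) e) := by
      intro n
      induction n with
      | zero => intro e; simp
      | succ n ih => intro e; rw [pow_succ, pow_succ, AlgEquiv.mul_apply, AlgEquiv.mul_apply, hg2, ih]
    obtain ⟨C, hC⟩ := (hS.image c).bddAbove
    obtain ⟨W', h, h1, h2, h3⟩ := app1 (J := Fin r) ℓ hℓ hKfg W (fun i => x ((finSuccEquiv r).symm i)) y
      (MIndep_equiv _ x hx _) (fun i => hlt _) hy (by rw [htd']; simp) g2 hg1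
      (algebraMap E Ω '' S) (hS.image _) C (by
        rintro _ ⟨e, he, rfl⟩
        rw [hpw]
        congr 1
        have : c e ≤ C := hC ⟨e, he, rfl⟩
        obtain ⟨d, rfl⟩ := Nat.exists_eq_add_of_le this
        rw [pow_add, pow_mul, coe_pow_alg]
        exact Function.iterate_fixed (hc e) _)
    have hcom : ∀ e, algebraMap E Ω (h.restrictNormal E e) = h (algebraMap E Ω e) := h.restrictNormal_commutes E
    refine ⟨W'.comap (algebraMap E Ω), h.restrictNormal E, by rw [hcc]; exact h3, Inr_comap W' _ _ _ hcom h1, ?_⟩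
    intro e he
    apply (algebraMap E Ω).injective
    rw [hcom, h2 _ ⟨e, he, rfl⟩, hg2]
end Fin0

section FinalPart
open IntermediateField

theorem proL_tors (ℓ : ℕ) (K : Type*) [Field K] (s : AlgebraicClosure K) (hs : s ∈ proL ℓ K) :
    ∃ c, ∀ σ : AlgebraicClosure K ≃ₐ[K] AlgebraicClosure K, (σ ^ ℓ ^ c) s = s := by
  have hmono : ∀ (c d : ℕ) (s : AlgebraicClosure K),
      (∀ σ : AlgebraicClosure K ≃ₐ[K] AlgebraicClosure K, (σ ^ ℓ ^ c) s = s) →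
      ∀ σ : AlgebraicClosure K ≃ₐ[K] AlgebraicClosure K, (σ ^ ℓ ^ (c + d)) s = s := by
    intro c d s h σ
    rw [pow_add, pow_mul, coe_pow_alg]
    exact Function.iterate_fixed (h σ) _
  let T : IntermediateField K (AlgebraicClosure K) :=
    { carrier := {s | ∃ c, ∀ σ : AlgebraicClosure K ≃ₐ[K] AlgebraicClosure K, (σ ^ ℓ ^ c) s = s}
      mul_mem' := by
        rintro a b ⟨c, hc⟩ ⟨d, hd⟩
        refine ⟨c + d, fun σ => ?_⟩
        rw [map_mul, hmono c d a hc, add_comm, hmono d c b hd]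
      add_mem' := by
        rintro a b ⟨c, hc⟩ ⟨d, hd⟩
        refine ⟨c + d, fun σ => ?_⟩
        rw [map_add, hmono c d a hc, add_comm c d, hmono d c b hd]
      algebraMap_mem' := fun a => ⟨0, fun σ => AlgEquiv.commutes _ a⟩
      inv_mem' := by
        rintro a ⟨c, hc⟩
        exact ⟨c, fun σ => by rw [map_inv₀, hc]⟩ }
  have hle : proL ℓ K ≤ T := by
    refine iSup₂_le ?_
    rintro L ⟨hL, n, hn⟩ a ha
    refine ⟨n, fun σ => ?_⟩
    by_cases h0 : ℓ ^ n = 0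
    · rw [h0]; rfl
    haveI : FiniteDimensional K L := Module.finite_of_finrank_pos (by rw [hn]; exact Nat.pos_of_ne_zero h0)
    have h1 : (AlgEquiv.restrictNormalHom L σ) ^ ℓ ^ n = 1 := by
      rw [← hn, ← IsGalois.card_aut_eq_finrank]
      exact pow_card_eq_one'
    rw [← map_pow] at h1
    have h2 := AlgEquiv.restrictNormal_commutes (σ ^ ℓ ^ n) L ⟨a, ha⟩
    have h3 : AlgEquiv.restrictNormal (σ ^ ℓ ^ n) L = 1 := h1
    rw [h3] at h2
    exact h2.symm
  exact hle hs

theorem closure_crit {K E : Type*} [Field K] [Field E] [Algebra K E] (D : Set (E ≃ₐ[K] E)) (g : E ≃ₐ[K] E)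
    (h : ∀ S : Set E, S.Finite → ∃ h ∈ D, ∀ s ∈ S, h s = g s) : g ∈ closure D := by
  rw [mem_closure_iff_nhds]
  intro U hU
  have h1 : (fun x => g * x) ⁻¹' U ∈ nhds (1 : E ≃ₐ[K] E) := by
    apply (continuous_mul_left g).continuousAt.preimage_mem_nhds
    rwa [mul_one]
  rw [krullTopology_mem_nhds_one_iff] at h1
  obtain ⟨L, hL, hLU⟩ := h1
  obtain ⟨T, hT⟩ := IntermediateField.essFiniteType_iff.mp (inferInstance : Algebra.EssFiniteType K L)
  obtain ⟨τ, hτD, hτ⟩ := h T T.finite_toSet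
  refine ⟨τ, ?_, hτD⟩
  have : g⁻¹ * τ ∈ (fun x => g * x) ⁻¹' U := by
    apply hLU
    rintro ⟨a, ha⟩
    change (g⁻¹ * τ) a = a
    have key : τ a = g a := by
      rw [← hT] at ha
      induction ha using adjoin_induction with
      | mem x hx => exact hτ x hx
      | algebraMap a => rw [AlgEquiv.commutes, AlgEquiv.commutes]
      | add a b _ _ ha hb => rw [map_add, map_add, ha, hb]
      | inv a _ ha => rw [map_inv₀, map_inv₀, ha]
      | mul a b _ _ ha hb => rw [map_mul, map_mul, ha, hb]
    rw [AlgEquiv.mul_apply, key]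
    exact g.symm_apply_apply a
  simpa using this

end FinalPart

/-- The topological closure of the set of divisorial inertia elements in
`Gal(K'|K)` contains every inertia element at (a prolongation of) a defectless valuation of `K`
trivial on `k`. -/
theorem statement9 (ℓ p : ℕ) (hℓ : ℓ.Prime) (hpℓ : p ≠ ℓ)
    (k K : Type*) [Field k] [Field K] [Algebra k K]
    [IsAlgClosed k] [CharP k p]
    (hKfg : (⊤ : IntermediateField k K).FG) (htd : 0 < trdeg k K)
    (K' : IntermediateField K ↥(proL ℓ K)) [IsGalois K ↥K']
    (g : ↥K' ≃ₐ[K] ↥K')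
    (hg : ∃ Ow : ValuationSubring ↥K',
      IsDefectless k (Ow.comap (algebraMap K ↥K')) ∧ g ∈ inertiaSubgroup Ow) :
    g ∈ closure {h : ↥K' ≃ₐ[K] ↥K' |
      ∃ Ow : ValuationSubring ↥K',
        IsZPD k (Ow.comap (algebraMap K ↥K')) ∧ h ∈ inertiaSubgroup Ow} := by
  haveI : Fact ℓ.Prime := ⟨hℓ⟩
  have hℓk : (ℓ : k) ≠ 0 := by
    intro h
    rw [CharP.cast_eq_zero_iff k p] at h
    rcases CharP.char_is_prime_or_zero k p with hp | hp
    · exact hpℓ ((Nat.prime_dvd_prime_iff_eq hp hℓ).mp h)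
    · rw [hp, zero_dvd_iff] at h
      exact hℓ.ne_zero h
  obtain ⟨Ow, hd, hgi⟩ := hg
  haveI : IsScalarTower K K' (AlgebraicClosure K) := IsScalarTower.of_algebraMap_eq (fun _ => rfl)
  have hal : Algebra.IsAlgebraic K' (AlgebraicClosure K) := Algebra.IsAlgebraic.tower_top (K := K) K'
  have htors : ∀ s : K', ∃ c, (g ^ ℓ ^ c) s = s := by
    intro s
    obtain ⟨c, hc⟩ := proL_tors ℓ K (algebraMap K' (AlgebraicClosure K) s) (s : proL ℓ K).2
    refine ⟨c, ?_⟩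
    obtain ⟨σ, hσ⟩ := AlgEquiv.restrictNormalHom_surjective (F := K) (K₁ := K') (AlgebraicClosure K) g
    apply (algebraMap K' (AlgebraicClosure K)).injective
    rw [← hσ, ← map_pow]
    exact (AlgEquiv.restrictNormal_commutes (σ ^ ℓ ^ c) K' s).trans (hc σ)
  apply closure_crit
  intro S hS
  obtain ⟨Ow', h, h1, h2, h3⟩ := app_fin (Ω := AlgebraicClosure K) hal ℓ hℓk hKfg htd g Ow hd hgi S hS htors
  exact ⟨h, ⟨Ow', h1, h2⟩, h3⟩
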